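/- arXiv:0912.3999 — 3 statements merged into one kernel-verified Lean document; each statement's English description precedes it below -/
import Mathlib

section
/- Fix a real α > −1 and an integer n ≥ 1. For every R > 0 there exist a constant C_R and an integer N₀ such that for all integers N ≥ max(N₀, n+1), (2N)^{−2n/3} ∫_{B_R} R_n^{δ,(N+α)/4}( 1 + y₁/(2N)^{2/3}, …, 1 + yₙ/(2N)^{2/3} ) dy₁⋯dyₙ ≤ C_R, where B_R is the closed ball of radius R centered at the origin in ℝⁿ. (Uniform integral bound for the rescaled fixed trace LUE correlation function at the soft edge.) -/
open MeasureTheory Filter Topology Finset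
open scoped Real Classical

noncomputable section

namespace RMT

/-- Extend a finite tuple by zero. -/
def extFun {n : ℕ} (t : Fin n → ℝ) : ℕ → ℝ := fun k => if h : k < n then t ⟨k, h⟩ else 0

/-- Squared Vandermonde determinant ∏_{i<j} (x_j - x_i)². -/
def vdm2 {N : ℕ} (x : Fin N → ℝ) : ℝ :=
  ∏ p ∈ Finset.univ.filter (fun p : Fin N × Fin N => p.1 < p.2), (x p.2 - x p.1) ^ 2

/-- Laguerre weight ∏ xᵢ^α (real power). -/
def lagWeight (α : ℝ) {N : ℕ} (x : Fin N → ℝ) : ℝ := ∏ i, x i ^ α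

/-- Partition function of the fixed trace LUE:
`Z_δ^r = r^{N(N+α)} ∏_{j=1}^N Γ(1+j)Γ(α+j) / Γ(N(N+α))`. -/
def ftlueZ (α : ℝ) (N : ℕ) (r : ℝ) : ℝ :=
  r ^ ((N : ℝ) * ((N : ℝ) + α)) *
    (∏ j ∈ Finset.range N, Real.Gamma (1 + ((j : ℝ) + 1)) * Real.Gamma (α + ((j : ℝ) + 1))) /
      Real.Gamma ((N : ℝ) * ((N : ℝ) + α))

/-- The full eigenvalue vector for the fixed trace LUE: the first `n` coordinates are the fixed
arguments `t`, the next `N-1-n` coordinates are the integration variables `y`, and the last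
coordinate is `r - ∑ t - ∑ y`. -/
def ftlueVec (N n : ℕ) (r : ℝ) (t : Fin n → ℝ) (y : Fin (N - 1 - n) → ℝ) : Fin N → ℝ :=
  fun i =>
    if (i : ℕ) < n then extFun t (i : ℕ)
    else if (i : ℕ) < N - 1 then extFun y ((i : ℕ) - n)
    else r - (∑ j, t j) - (∑ k, y k)

/-- `n`-point correlation function of the fixed trace LUE (FTLUE) with trace `r`. -/
def ftlueR (α : ℝ) (N n : ℕ) (r : ℝ) (t : Fin n → ℝ) : ℝ :=
  if (∀ i, 0 ≤ t i) ∧ (∑ i, t i) ≤ r then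
    ((N.factorial : ℝ) / ((N - n).factorial : ℝ)) / ftlueZ α N r *
      ∫ y : Fin (N - 1 - n) → ℝ,
        (if (∀ k, 0 ≤ y k) ∧ (∑ i, t i) + (∑ k, y k) ≤ r then
          vdm2 (ftlueVec N n r t y) * lagWeight α (ftlueVec N n r t y) else 0)
  else 0

/-- Full eigenvalue vector for ensembles where all of `x_{n+1},…,x_N` are integrated. -/
def fullVec (N n : ℕ) (t : Fin n → ℝ) (y : Fin (N - n) → ℝ) : Fin N → ℝ :=
  fun i => if (i : ℕ) < n then extFun t (i : ℕ) else extFun y ((i : ℕ) - n)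

/-- Partition function of the bounded trace LUE. -/
def btlueZ (α : ℝ) (N : ℕ) (r : ℝ) : ℝ :=
  ∫ x : Fin N → ℝ,
    (if (∀ i, 0 ≤ x i) ∧ (∑ i, x i) ≤ r then vdm2 x * lagWeight α x else 0)

/-- `n`-point correlation function of the bounded trace LUE (BTLUE). -/
def btlueR (α : ℝ) (N n : ℕ) (r : ℝ) (t : Fin n → ℝ) : ℝ :=
  if ∀ i, 0 ≤ t i then
    ((N.factorial : ℝ) / ((N - n).factorial : ℝ)) / btlueZ α N r *
      ∫ y : Fin (N - n) → ℝ,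
        (if (∀ k, 0 ≤ y k) ∧ (∑ i, t i) + (∑ k, y k) ≤ r then
          vdm2 (fullVec N n t y) * lagWeight α (fullVec N n t y) else 0)
  else 0

/-- Partition function of the LUE with scale `s`. -/
def lueZ (α : ℝ) (N : ℕ) (s : ℝ) : ℝ :=
  s ^ ((N : ℝ) * ((N : ℝ) + α)) *
    ∏ j ∈ Finset.range N, Real.Gamma (1 + ((j : ℝ) + 1)) * Real.Gamma (α + ((j : ℝ) + 1))

/-- Joint eigenvalue density of the LUE with scale `s`. -/
def luePdf (α : ℝ) (N : ℕ) (s : ℝ) (x : Fin N → ℝ) : ℝ :=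
  if ∀ i, 0 ≤ x i then
    (1 / lueZ α N s) * vdm2 x * ∏ i, x i ^ α * Real.exp (-(x i) / s)
  else 0

/-- `n`-point correlation function of the LUE with scale `s`. -/
def lueR (α : ℝ) (N n : ℕ) (s : ℝ) (t : Fin n → ℝ) : ℝ :=
  ((N.factorial : ℝ) / ((N - n).factorial : ℝ)) *
    ∫ y : Fin (N - n) → ℝ,
      (if ∀ k, 0 ≤ y k then luePdf α N s (fullVec N n t y) else 0)

/-- Gamma(N(N+α),1) density. -/
def gammaDens (α : ℝ) (N : ℕ) (x : ℝ) : ℝ :=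
  if 0 ≤ x then
    Real.exp (-x) * x ^ ((N : ℝ) * ((N : ℝ) + α) - 1) / Real.Gamma ((N : ℝ) * ((N : ℝ) + α))
  else 0

/-- Sine kernel. -/
def Ksin (u v : ℝ) : ℝ :=
  if u = v then 1 else Real.sin (π * (u - v)) / (π * (u - v))

/-- Marchenko–Pastur density. -/
def psiMP (x : ℝ) : ℝ :=
  if 0 < x ∧ x ≤ 1 then (2 / π) * Real.sqrt ((1 - x) / x) else 0

/-- Airy function, as a convergent improper integral. -/
def Ai (x : ℝ) : ℝ :=
  limUnder atTop (fun T : ℝ => (1 / π) * ∫ t in (0 : ℝ)..T, Real.cos (t ^ 3 / 3 + x * t))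

/-- Airy kernel. -/
def KAiry (u v : ℝ) : ℝ :=
  if u = v then (deriv Ai u) ^ 2 - u * (Ai u) ^ 2
  else (deriv Ai u * Ai v - deriv Ai v * Ai u) / (u - v)

/-- Bessel function of the first kind of (real) index `α`, as a power series. -/
def besselJ (α : ℝ) (x : ℝ) : ℝ :=
  ∑' m : ℕ,
    ((-1 : ℝ) ^ m / ((m.factorial : ℝ) * Real.Gamma ((m : ℝ) + α + 1))) *
      (x / 2) ^ (2 * (m : ℝ) + α)

/-- Bessel kernel off the diagonal. -/
def KBesselOff (α : ℝ) (u v : ℝ) : ℝ :=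
  (besselJ α (Real.sqrt u) * Real.sqrt v * deriv (besselJ α) (Real.sqrt v) -
      besselJ α (Real.sqrt v) * Real.sqrt u * deriv (besselJ α) (Real.sqrt u)) /
    (2 * (u - v))

/-- Bessel kernel, extended to the diagonal by its limiting value. -/
def KBessel (α : ℝ) (u v : ℝ) : ℝ :=
  if u = v then limUnder (𝓝[≠] u) (fun w => KBesselOff α u w) else KBesselOff α u v

/-- Orthonormal polynomials for the weight `x^α e^{-x}` on `(0,∞)`, at complex arguments. -/
def hkC (α : ℝ) (k : ℕ) (z : ℂ) : ℂ :=
  (Real.sqrt (Real.Gamma ((k : ℝ) + 1) / Real.Gamma ((k : ℝ) + α + 1)) : ℂ) *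
    ∑ j ∈ Finset.range (k + 1),
      (-1 : ℂ) ^ (k - j) *
        ((Real.Gamma ((k : ℝ) + α + 1) /
            (Real.Gamma ((j : ℝ) + α + 1) * ((k - j).factorial : ℝ) * (j.factorial : ℝ)) : ℝ) : ℂ) *
        z ^ j

/-- `φ_k(z) = z^{α/2} e^{-z/2} h_k(z)` (principal branch). -/
def phikC (α : ℝ) (k : ℕ) (z : ℂ) : ℂ :=
  z ^ ((α : ℂ) / 2) * Complex.exp (-z / 2) * hkC α k z

/-- Correlation kernel `K_N(z,w) = ∑_{k<N} φ_k(z) φ_k(w)`. -/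
def KNC (α : ℝ) (N : ℕ) (z w : ℂ) : ℂ := ∑ k ∈ Finset.range N, phikC α k z * phikC α k w

/-- Rescaled kernel `K̃_N(z,w,s) = s⁻¹ K_N(z/s, w/s)`. -/
def KNS (α : ℝ) (N : ℕ) (z w s : ℂ) : ℂ := s⁻¹ * KNC α N (z / s) (w / s)

/-- `Λ(H) = 1 + iH`. -/
def Lam (H : ℝ) : ℂ := 1 + Complex.I * (H : ℂ)

/-- Analytic continuation `ψ̂` of the Marchenko–Pastur density to the upper half plane,
with boundary values `ψ` on the reals. -/
def psihat (z : ℂ) : ℂ :=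
  if z.im = 0 then (psiMP z.re : ℂ)
  else (2 / (Complex.I * (π : ℂ))) * (z - 1) ^ ((1 : ℂ) / 2) / z ^ ((1 : ℂ) / 2)

/-- Characteristic function `φ_N(y) = e^{iy(N+α)} (1+iy/N)^{-N(N+α)}` (principal branch). -/
def phiN (α : ℝ) (N : ℕ) (y : ℝ) : ℂ :=
  Complex.exp (Complex.I * (y : ℂ) * (((N : ℝ) + α : ℝ) : ℂ)) *
    (1 + Complex.I * (y : ℂ) / (N : ℂ)) ^ (-((((N : ℝ) * ((N : ℝ) + α) : ℝ) : ℂ)))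

end RMT

namespace RMT

def Lc (β : ℝ) (i l : ℕ) : ℝ := (i.choose l : ℝ) * (Real.Gamma (β + i + 1) / Real.Gamma (β + l + 1))

lemma Lc_succ (β : ℝ) (hβ : -1 < β) (i l : ℕ) :
    Lc (β + 1) i l = Lc β i l + (l + 1) * Lc β i (l + 1) := by
  have hl : (0:ℝ) ≤ l := Nat.cast_nonneg l
  have hi : (0:ℝ) ≤ i := Nat.cast_nonneg i
  have e1 : Real.Gamma (β + 1 + i + 1) = (β + i + 1) * Real.Gamma (β + i + 1) := by
    rw [← Real.Gamma_add_one (by linarith)]; ring_nf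
  have e2 : Real.Gamma (β + 1 + l + 1) = (β + l + 1) * Real.Gamma (β + l + 1) := by
    rw [← Real.Gamma_add_one (by linarith)]; ring_nf
  have e3 : Real.Gamma (β + (l + 1 : ℕ) + 1) = (β + l + 1) * Real.Gamma (β + l + 1) := by
    rw [← Real.Gamma_add_one (by linarith)]; push_cast; ring_nf
  have h3 : (0:ℝ) < Real.Gamma (β + l + 1) := Real.Gamma_pos_of_pos (by linarith)
  have h4 : (0:ℝ) < β + l + 1 := by linarith
  have hc : (i.choose (l+1) : ℝ) * (l + 1) = i.choose l * ((i:ℝ) - l) := by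
    rcases le_or_gt l i with h | h
    · have := Nat.choose_succ_right_eq i l
      rw [← Nat.cast_sub h]
      exact_mod_cast this
    · rw [Nat.choose_eq_zero_of_lt h, Nat.choose_eq_zero_of_lt (by omega)]; simp
  unfold Lc
  rw [e1, e2, e3]
  field_simp
  linear_combination (-Real.Gamma (β + i + 1)) * hc

lemma pascal_sum (k : ℕ) (f : ℕ → ℝ) :
    ∑ a ∈ range (k + 2), ((k + 1).choose a : ℝ) * f a
      = ∑ a ∈ range (k + 1), (k.choose a : ℝ) * (f a + f (a + 1)) := by
  rw [Finset.sum_range_succ' _ (k+1)]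
  simp only [Nat.choose_succ_succ, Nat.cast_add, add_mul, mul_add, Finset.sum_add_distrib]
  rw [Finset.sum_range_succ (fun a => (k.choose (a+1) : ℝ) * f (a+1)) k]
  rw [Finset.sum_range_succ' (fun a => (k.choose (a) : ℝ) * f (a)) k]
  simp
  ring

lemma Lc_add (β : ℝ) (hβ : -1 < β) (i k l : ℕ) :
    Lc (β + k) i l = ∑ a ∈ range (k + 1), (k.choose a : ℝ) *
      (((l + a).factorial : ℝ) / l.factorial * Lc β i (l + a)) := by
  induction k generalizing l with
  | zero => 
    have : (l.factorial : ℝ) ≠ 0 := by positivity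
    simp [this]
  | succ k ih =>
    rw [pascal_sum k]
    have : β + ((k + 1 : ℕ) : ℝ) = (β + k) + 1 := by push_cast; ring
    rw [this, Lc_succ _ (by have : (0:ℝ) ≤ k := Nat.cast_nonneg k
                            linarith), ih, ih, Finset.mul_sum, ← Finset.sum_add_distrib]
    refine Finset.sum_congr rfl fun a _ => ?_
    have h1 : (l.factorial : ℝ) ≠ 0 := by positivity
    have h2 : l + 1 + a = l + (a + 1) := by ring
    rw [h2, Nat.factorial_succ l]
    push_cast
    field_simp

def Dg (β : ℝ) (l : ℕ) : ℝ := l.factorial * Real.Gamma (β + l + 1)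

lemma Dg_pos (β : ℝ) (hβ : -1 < β) (l : ℕ) : 0 < Dg β l := by
  have hl : (0:ℝ) ≤ l := Nat.cast_nonneg l
  have := Real.Gamma_pos_of_pos (show 0 < β + l + 1 by linarith)
  unfold Dg; positivity

def Hm (β : ℝ) (N : ℕ) : Matrix (Fin N) (Fin N) ℝ :=
  Matrix.of fun i j => Real.Gamma (β + (i : ℕ) + (j : ℕ) + 1)
def Lm (β : ℝ) (N : ℕ) : Matrix (Fin N) (Fin N) ℝ := Matrix.of fun i j => Lc β i j
def Tm (k N : ℕ) : Matrix (Fin N) (Fin N) ℝ := Matrix.of fun j l =>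
  if (l : ℕ) ≤ j then (k.choose ((j : ℕ) - l) : ℝ) * ((j : ℕ).factorial / (l : ℕ).factorial) else 0

lemma Lc_zero_of_lt {β : ℝ} {i l : ℕ} (h : i < l) : Lc β i l = 0 := by
  unfold Lc; rw [Nat.choose_eq_zero_of_lt h]; simp

lemma Lc_add' (β : ℝ) (hβ : -1 < β) (k N i l : ℕ) (hi : i < N) :
    Lc (β + k) i l = ∑ a ∈ range N, (k.choose a : ℝ) *
      (((l + a).factorial : ℝ) / l.factorial * Lc β i (l + a)) := by
  rw [Lc_add β hβ]
  have h1 : ∑ a ∈ range (k + 1), (k.choose a : ℝ) *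
      (((l + a).factorial : ℝ) / l.factorial * Lc β i (l + a)) = 
      ∑ a ∈ range (k + 1 + N), (k.choose a : ℝ) *
      (((l + a).factorial : ℝ) / l.factorial * Lc β i (l + a)) := by
    apply Finset.sum_subset (by intro x; simp; omega)
    intro x _ hx
    rw [Nat.choose_eq_zero_of_lt (by simpa using hx)]; simp
  rw [h1]
  symm
  apply Finset.sum_subset (by intro x; simp; omega)
  intro x _ hx
  rw [Lc_zero_of_lt (by simp at hx; omega)]; simp

lemma Lm_mul_Tm (β : ℝ) (hβ : -1 < β) (k N : ℕ) : Lm β N * Tm k N = Lm (β + k) N := by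
  ext i l
  simp only [Lm, Tm, Matrix.mul_apply, Matrix.of_apply]
  rw [Lc_add' β hβ k N i l i.2]
  rw [Fin.sum_univ_eq_sum_range (fun j : ℕ => Lc β i j * (if (l : ℕ) ≤ j then (k.choose (j - l) : ℝ) * (j.factorial / (l : ℕ).factorial) else 0)) N]
  have h1 : ∑ j ∈ range N, Lc β i j * (if (l : ℕ) ≤ j then (k.choose (j - l) : ℝ) * (j.factorial / (l : ℕ).factorial) else 0)
     = ∑ j ∈ range (l + N), Lc β i j * (if (l : ℕ) ≤ j then (k.choose (j - l) : ℝ) * (j.factorial / (l : ℕ).factorial) else 0) := by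
    apply Finset.sum_subset (by intro x; simp; omega)
    intro x _ hx
    rw [Lc_zero_of_lt (by simp at hx; omega)]; simp
  rw [h1, Finset.sum_range_add]
  rw [Finset.sum_eq_zero, zero_add]
  · refine Finset.sum_congr rfl fun a _ => ?_
    simp
    ring
  · intro x hx
    simp at hx
    rw [if_neg (by omega)]; simp

lemma Hm_eq (β : ℝ) (hβ : -1 < β) (N : ℕ) :
    Hm β N = Lm β N * Matrix.diagonal (fun l : Fin N => Dg β l) * (Lm β N).transpose := by
  ext i j
  rw [Matrix.mul_apply]
  simp only [Matrix.mul_diagonal, Matrix.transpose_apply, Hm, Lm, Matrix.of_apply]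
  rw [Fin.sum_univ_eq_sum_range (fun l : ℕ => Lc β i l * Dg β l * Lc β j l) N]
  have h := Lc_add' β hβ i N j 0 j.2
  have hi : (0:ℝ) ≤ (i:ℕ) := Nat.cast_nonneg _
  have hg := Real.Gamma_pos_of_pos (show 0 < β + (i:ℕ) + 1 by linarith)
  have h2 : Real.Gamma (β + (i : ℕ) + (j : ℕ) + 1) = Real.Gamma (β + (i : ℕ) + 1) * Lc (β + (i:ℕ)) j 0 := by
    simp [Lc]; field_simp
  rw [h2, h, Finset.mul_sum]
  refine Finset.sum_congr rfl fun a _ => ?_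
  have ha : (0:ℝ) ≤ a := Nat.cast_nonneg _
  have hg := Real.Gamma_pos_of_pos (show 0 < β + a + 1 by linarith)
  simp [Lc, Dg]
  field_simp

lemma Lm_det (β : ℝ) (hβ : -1 < β) (N : ℕ) : (Lm β N).det = 1 := by
  rw [Matrix.det_of_isLowerTriangular]
  · apply Finset.prod_eq_one
    intro i _
    have hi : (0:ℝ) ≤ (i:ℕ) := Nat.cast_nonneg _
    have hg := Real.Gamma_pos_of_pos (show 0 < β + (i:ℕ) + 1 by linarith)
    simp [Lm, Lc]; exact hg.ne'
  · intro i j hij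
    simp only [Lm, Matrix.of_apply]
    exact Lc_zero_of_lt (by simpa using hij)

/-- trace term -/
def trT (α : ℝ) (k N : ℕ) : ℝ := ∑ j : Fin N, ∑ l : Fin N, (Tm k N j l) ^ 2 * Dg (α + k) l / Dg α j

lemma det_le (S : ℕ) (A : Matrix (Fin S) (Fin S) ℝ) (hA : A.PosSemidef) :
    (1 + A).det ≤ Real.exp A.trace := by
  have h1 : (1 + A).PosSemidef := Matrix.PosSemidef.one.add hA
  rw [h1.1.det_eq_prod_eigenvalues]
  have htr := h1.1.trace_eq_sum_eigenvalues
  rw [Matrix.trace_add, Matrix.trace_one] at htr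
  simp at htr
  have : A.trace = ∑ i, (h1.1.eigenvalues i - 1) := by
    rw [Finset.sum_sub_distrib, ← htr]; simp
  rw [this, Real.exp_sum]
  apply Finset.prod_le_prod
  · intro i _; simpa using h1.eigenvalues_nonneg i
  · intro i _
    have := Real.add_one_le_exp (h1.1.eigenvalues i - 1)
    simp at this ⊢; linarith

lemma det_Hm_le (α : ℝ) (hα : -1 < α) (k N : ℕ) (c : ℝ) (hc : 0 ≤ c) :
    (Hm α N + c • Hm (α + k) N).det ≤ (∏ l : Fin N, Dg α l) * Real.exp (c * trT α k N) := by
  have hk : (0:ℝ) ≤ k := Nat.cast_nonneg _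
  set s : Fin N → ℝ := fun l => Real.sqrt (Dg α l)
  set u : Fin N → ℝ := fun l => Real.sqrt (Dg (α + k) l)
  have hs : ∀ l, 0 < s l := fun l => Real.sqrt_pos.2 (Dg_pos α hα l)
  have hss : ∀ l : Fin N, s l * s l = Dg α l := fun l => Real.mul_self_sqrt (Dg_pos α hα l).le
  have huu : ∀ l : Fin N, u l * u l = Dg (α + k) l := fun l => 
    Real.mul_self_sqrt (Dg_pos (α+k) (by linarith) l).le
  set B : Matrix (Fin N) (Fin N) ℝ := 
    Matrix.diagonal (fun l => (s l)⁻¹) * Tm k N * Matrix.diagonal u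
  have hP : Hm α N + c • Hm (α + k) N = 
     (Lm α N * Matrix.diagonal s) * (1 + c • (B * B.transpose)) * (Lm α N * Matrix.diagonal s).transpose := by
    rw [Hm_eq α hα, Hm_eq (α + k) (by linarith), ← Lm_mul_Tm α hα]
    have e1 : Matrix.diagonal s * Matrix.diagonal (fun l => (s l)⁻¹) = 1 := by
      rw [Matrix.diagonal_mul_diagonal, ← Matrix.diagonal_one]
      congr 1; ext l; exact mul_inv_cancel₀ (hs l).ne'
    have e2 : Matrix.diagonal (fun l => (s l)⁻¹) * Matrix.diagonal s = 1 := by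
      rw [Matrix.diagonal_mul_diagonal, ← Matrix.diagonal_one]
      congr 1; ext l; exact inv_mul_cancel₀ (hs l).ne'
    have e3 : Matrix.diagonal s * B = Tm k N * Matrix.diagonal u := by
      simp only [B, ← Matrix.mul_assoc, e1, Matrix.one_mul]
    have e4 : B.transpose * Matrix.diagonal s = Matrix.diagonal u * (Tm k N).transpose := by
      have := congrArg Matrix.transpose e3
      simpa using this
    have e5 : Matrix.diagonal s * Matrix.diagonal s = Matrix.diagonal (fun l : Fin N => Dg α l) := by
      rw [Matrix.diagonal_mul_diagonal]; congr 1; ext l; exact hss l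
    have e6 : Matrix.diagonal u * Matrix.diagonal u = Matrix.diagonal (fun l : Fin N => Dg (α + k) l) := by
      rw [Matrix.diagonal_mul_diagonal]; congr 1; ext l; exact huu l
    rw [← e5, ← e6]
    simp only [Matrix.mul_add, Matrix.add_mul, Matrix.mul_one, Matrix.transpose_mul, Matrix.diagonal_transpose,
      Matrix.mul_smul, Matrix.smul_mul]
    congr 1
    · simp only [Matrix.mul_assoc]
    congr 1
    calc _ = Lm α N * (Tm k N * Matrix.diagonal u) * (Matrix.diagonal u * (Tm k N).transpose) * (Lm α N).transpose := by
          simp only [Matrix.mul_assoc]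
      _ = _ := by
        rw [← e3, ← e4]; simp only [Matrix.mul_assoc]
  rw [hP, Matrix.det_mul, Matrix.det_mul, Matrix.det_transpose, Matrix.det_mul, Lm_det α hα, Matrix.det_diagonal]
  have hBP : (c • (B * B.transpose)).PosSemidef := by
    have := Matrix.posSemidef_self_mul_conjTranspose B
    rw [Matrix.conjTranspose_eq_transpose_of_trivial] at this
    exact this.smul hc
  have hd := det_le N _ hBP
  have htr : (c • (B * B.transpose)).trace = c * trT α k N := by
    rw [Matrix.trace_smul, smul_eq_mul]
    congr 1
    rw [Matrix.trace, trT]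
    refine Finset.sum_congr rfl fun j _ => ?_
    rw [Matrix.diag_apply, Matrix.mul_apply]
    refine Finset.sum_congr rfl fun l _ => ?_
    simp only [B, Matrix.mul_diagonal, Matrix.diagonal_mul, Matrix.transpose_apply]
    rw [← huu, ← hss]
    have := hs j
    field_simp
  rw [htr] at hd
  have hp : (∏ l : Fin N, Dg α l) = (∏ l, s l) * ∏ l, s l := by
    rw [← Finset.prod_mul_distrib]; exact Finset.prod_congr rfl fun l _ => (hss l).symm
  rw [hp]
  have h0 : 0 ≤ (∏ l, s l) * ∏ l, s l := mul_self_nonneg _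
  nlinarith [mul_le_mul_of_nonneg_left hd h0]



lemma Gamma_prod (x : ℝ) (hx : 0 < x) (m : ℕ) :
    Real.Gamma (x + m) = (∏ i ∈ range m, (x + i)) * Real.Gamma x := by
  induction m with
  | zero => simp
  | succ m ih =>
    have hm : (0:ℝ) ≤ m := Nat.cast_nonneg _
    rw [Finset.prod_range_succ, Nat.cast_succ, ← add_assoc, Real.Gamma_add_one (by linarith), ih]
    ring

lemma centralBinom_sq_le (n : ℕ) : ((n.centralBinom : ℝ)) ^ 2 * (2 * n + 1) ≤ 16 ^ n := by
  induction n with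
  | zero => simp
  | succ n ih =>
    have h : ((n:ℝ) + 1) * ((n+1).centralBinom : ℝ) = 2 * (2 * n + 1) * n.centralBinom := by
      exact_mod_cast Nat.succ_mul_centralBinom_succ n
    have hn : (0:ℝ) ≤ n := Nat.cast_nonneg _
    have h2 : ((n+1).centralBinom : ℝ) = 2 * (2 * n + 1) * n.centralBinom / (n + 1) := by
      field_simp; linarith
    rw [h2, pow_succ (16:ℝ) n]
    push_cast
    rw [div_pow, div_mul_eq_mul_div, div_le_iff₀ (by positivity)]
    have : (n.centralBinom : ℝ)^2 * (2*n+1) * (4 * ((2*n+1)*(2*n+3))) ≤ 16^n * (4 * (4 * (n+1)^2)) := by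
      apply mul_le_mul ih _ (by positivity) (by positivity)
      nlinarith
    nlinarith

lemma choose_le_central (m a : ℕ) : ((2*m).choose a : ℝ) ≤ 2 ^ (2*m) / Real.sqrt ((2*m : ℕ) + 1) := by
  have h1 : ((2*m).choose a : ℝ) ≤ m.centralBinom := by
    exact_mod_cast Nat.choose_le_centralBinom a m
  refine h1.trans ?_
  rw [le_div_iff₀ (by positivity)]
  have h := centralBinom_sq_le m
  refine (sq_le_sq₀ (by positivity) (by positivity)).1 ?_
  rw [mul_pow, Real.sq_sqrt (by positivity)]
  push_cast
  refine h.trans (le_of_eq ?_)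
  rw [← pow_mul, show (16:ℝ) = 2^4 by norm_num, ← pow_mul]; congr 1; ring

lemma pow_succ_ge (x : ℝ) (hx : 0 ≤ x) (k : ℕ) : x^(k+1) + (k+1) * x^k ≤ (x+1)^(k+1) := by
  induction k with
  | zero => simp
  | succ k ih =>
    have : (x^(k+1) + (k+1) * x^k) * (x+1) ≤ (x+1)^(k+1) * (x+1) := 
      mul_le_mul_of_nonneg_right ih (by linarith)
    rw [pow_succ (x+1) (k+1)]
    refine le_trans ?_ this
    push_cast
    have h0 : 0 ≤ x^k := by positivity
    have hk : (0:ℝ) ≤ k := Nat.cast_nonneg _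
    rw [pow_succ x (k+1), pow_succ x k]
    nlinarith [mul_nonneg hk h0]

lemma sum_pow_le (K : ℝ) (hK : 0 ≤ K) (k N : ℕ) :
    ∑ j ∈ range N, ((j:ℝ) + K)^k ≤ ((N:ℝ) + K)^(k+1) / (k+1) := by
  rw [le_div_iff₀ (by positivity)]
  induction N with
  | zero => simp; positivity
  | succ N ih =>
    rw [Finset.sum_range_succ, add_mul]
    have := pow_succ_ge (N + K) (by positivity) k
    push_cast
    rw [show (N:ℝ) + 1 + K = N + K + 1 by ring]
    linarith

/-- explicit summand -/
def Qt (α : ℝ) (k a j : ℕ) : ℝ :=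
  (∏ i ∈ range a, ((j - i : ℕ) : ℝ)) * ∏ i ∈ range (k - a), (α + j + 1 + i)

lemma Qt_nonneg (α : ℝ) (hα : -1 < α) (k a j : ℕ) : 0 ≤ Qt α k a j := by
  unfold Qt
  apply mul_nonneg (by positivity)
  apply Finset.prod_nonneg
  intro i _
  have : (0:ℝ) ≤ j := Nat.cast_nonneg _
  have : (0:ℝ) ≤ i := Nat.cast_nonneg _
  linarith

lemma trT_le (α : ℝ) (hα : -1 < α) (k N : ℕ) :
    trT α k N ≤ ∑ j ∈ range N, ∑ a ∈ range (k+1), (k.choose a : ℝ)^2 * Qt α k a j := by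
  unfold trT
  rw [← Fin.sum_univ_eq_sum_range (fun j => ∑ a ∈ range (k+1), (k.choose a : ℝ)^2 * Qt α k a j) N]
  apply Finset.sum_le_sum
  intro j _
  have hterm : ∀ l : ℕ, l ≤ (j:ℕ) → (j:ℕ) - l ≤ k →
    ((k.choose ((j : ℕ) - l) : ℝ) * ((j : ℕ).factorial / l.factorial))^2 * Dg (α + k) l / Dg α j
      = (k.choose ((j:ℕ) - l) : ℝ)^2 * Qt α k ((j:ℕ) - l) j := by
    intro l hl hk
    obtain ⟨a, ha⟩ := Nat.exists_eq_add_of_le hl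
    have ha' : (j:ℕ) - l = a := by omega
    rw [ha'] at hk ⊢
    have hj : (0:ℝ) ≤ (j:ℕ) := Nat.cast_nonneg _
    have hg := Real.Gamma_pos_of_pos (show 0 < α + (j:ℕ) + 1 by linarith)
    have hG : Real.Gamma (α + k + l + 1) = (∏ i ∈ range (k - a), (α + (j:ℕ) + 1 + i)) * Real.Gamma (α + (j:ℕ) + 1) := by
      rw [← Gamma_prod _ (by linarith)]
      congr 1
      rw [Nat.cast_sub hk, ha]; push_cast; ring
    have hf : ((j:ℕ).factorial : ℝ) = (∏ i ∈ range a, (((j:ℕ) - i : ℕ) : ℝ)) * l.factorial := by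
      rw [← Nat.cast_prod, ← Nat.descFactorial_eq_prod_range]
      have := Nat.factorial_mul_descFactorial (show a ≤ (j:ℕ) by omega)
      rw [show (j:ℕ) - a = l by omega] at this
      rw [← this]; push_cast; ring
    unfold Qt Dg
    rw [hG]
    have h1 : (0:ℝ) < l.factorial := by positivity
    have h2 : (0:ℝ) < (j:ℕ).factorial := by positivity
    field_simp
    rw [hf]; ring
  calc ∑ l : Fin N, (Tm k N j l) ^ 2 * Dg (α + k) l / Dg α j 
      = ∑ l ∈ (univ : Finset (Fin N)).filter (fun l : Fin N => (l:ℕ) ≤ j ∧ (j:ℕ) - l ≤ k), (Tm k N j l) ^ 2 * Dg (α + k) l / Dg α j := by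
        symm
        apply Finset.sum_subset (Finset.filter_subset _ _)
        intro l _ hl
        simp only [Finset.mem_filter, Finset.mem_univ, true_and, not_and] at hl
        simp only [Tm, Matrix.of_apply]
        split_ifs with h
        · rw [Nat.choose_eq_zero_of_lt (by have := hl h; omega)]; simp
        · simp
    _ = ∑ l ∈ (univ : Finset (Fin N)).filter (fun l : Fin N => (l:ℕ) ≤ j ∧ (j:ℕ) - l ≤ k), (k.choose ((j:ℕ) - l) : ℝ)^2 * Qt α k ((j:ℕ) - l) j := by
        refine Finset.sum_congr rfl fun l hl => ?_
        simp only [Finset.mem_filter, Finset.mem_univ, true_and] at hl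
        simp only [Tm, Matrix.of_apply, if_pos hl.1]
        exact hterm l hl.1 hl.2
    _ = ∑ a ∈ ((univ : Finset (Fin N)).filter (fun l : Fin N => (l:ℕ) ≤ j ∧ (j:ℕ) - l ≤ k)).image (fun l : Fin N => (j:ℕ) - (l:ℕ)), (k.choose a : ℝ)^2 * Qt α k a j := by
        rw [Finset.sum_image]
        intro x hx y hy hxy
        simp at hx hy hxy
        ext; omega
    _ ≤ _ := by
        apply Finset.sum_le_sum_of_subset_of_nonneg
        · intro a ha
          simp only [Finset.mem_image, Finset.mem_filter, Finset.mem_univ, true_and] at ha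
          obtain ⟨l, hl, rfl⟩ := ha
          simp; omega
        · intro a _ _
          exact mul_nonneg (by positivity) (Qt_nonneg α hα _ _ _)

lemma Qt_le (α : ℝ) (hα : -1 < α) (k a j N : ℕ) (ha : a ≤ k) (hkN : k ≤ N) (hN : 0 < N) (hj : j ≤ N) :
    Qt α k a j ≤ (((j:ℝ) + (k + |α|)) / (N + (k + |α|)))^k * (N:ℝ)^k *
      (Real.exp ((k:ℝ) * (α + 1) / N) * Real.exp (((k:ℝ) - 1) / (2 * N) * (k - 2 * a))) := by
  set K : ℝ := k + |α| with hK
  have hNr : (0:ℝ) < N := by exact_mod_cast hN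
  have hjr : (0:ℝ) ≤ j := Nat.cast_nonneg _
  have hkr : (0:ℝ) ≤ k := Nat.cast_nonneg _
  have har : (a:ℝ) ≤ k := by exact_mod_cast ha
  have har0 : (0:ℝ) ≤ a := Nat.cast_nonneg _
  have hjN : (j:ℝ) ≤ N := by exact_mod_cast hj
  have hK0 : 0 ≤ K := by positivity
  set ρ : ℝ := ((j:ℝ) + K) / (N + K) with hρ
  have hρ0 : 0 ≤ ρ := by positivity
  have key : ∀ c : ℝ, c ≤ K → 0 ≤ N + c → (j:ℝ) + c ≤ ρ * N * Real.exp (c / N) := by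
    intro c hc hc0
    have h1 : (j:ℝ) + c ≤ ρ * (N + c) := by
      rw [hρ, div_mul_eq_mul_div, le_div_iff₀ (by linarith)]
      nlinarith [mul_nonneg (sub_nonneg.2 hc) (sub_nonneg.2 hjN)]
    have h2 : (N:ℝ) + c ≤ N * Real.exp (c / N) := by
      have := Real.add_one_le_exp (c / N)
      have h3 := mul_le_mul_of_nonneg_left this hNr.le
      have h4 : (N:ℝ) * (c / N + 1) = N + c := by field_simp; ring
      linarith
    calc _ ≤ _ := h1
      _ ≤ ρ * (N * Real.exp (c / N)) := mul_le_mul_of_nonneg_left h2 hρ0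
      _ = _ := by ring
  have p1 : ∏ i ∈ range a, ((j - i : ℕ) : ℝ) ≤ ∏ i ∈ range a, (ρ * N * Real.exp (-(i:ℝ) / N)) := by
    apply Finset.prod_le_prod
    · intro i _; positivity
    · intro i hi
      have hi' : i < a := by simpa using hi
      rcases le_or_gt i j with h | h
      · rw [Nat.cast_sub h, sub_eq_add_neg]
        apply key
        · have : (0:ℝ) ≤ i := Nat.cast_nonneg _
          linarith
        · have : (i:ℝ) ≤ N := by exact_mod_cast (by omega)
          linarith
      · rw [Nat.sub_eq_zero_of_le h.le]; simp; positivity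
  have p2 : ∏ i ∈ range (k - a), (α + j + 1 + i) ≤ ∏ i ∈ range (k - a), (ρ * N * Real.exp ((α + 1 + i) / N)) := by
    apply Finset.prod_le_prod
    · intro i _
      have : (0:ℝ) ≤ i := Nat.cast_nonneg _
      linarith
    · intro i hi
      have hi' : i < k - a := by simpa using hi
      have hi2 : (0:ℝ) ≤ i := Nat.cast_nonneg _
      have hi3 : (i:ℝ) + 1 ≤ k := by exact_mod_cast (by omega)
      rw [show α + j + 1 + i = j + (α + 1 + i) by ring]
      apply key
      · have := le_abs_self α
        rw [hK]; linarith
      · linarith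
  have gauss : ∀ m : ℕ, ∑ i ∈ range m, (i:ℝ) = m * (m - 1) / 2 := by
    intro m
    induction m with
    | zero => simp
    | succ m ih => rw [Finset.sum_range_succ, ih]; push_cast; ring
  rw [Finset.prod_mul_distrib, Finset.prod_const, Finset.card_range, ← Real.exp_sum, ← Finset.sum_div,
    Finset.sum_neg_distrib, gauss] at p1
  rw [Finset.prod_mul_distrib, Finset.prod_const, Finset.card_range, ← Real.exp_sum, ← Finset.sum_div,
    Finset.sum_add_distrib, Finset.sum_const, Finset.card_range, gauss, nsmul_eq_mul, Nat.cast_sub ha] at p2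
  unfold Qt
  refine (mul_le_mul p1 p2 ?_ (by positivity)).trans ?_
  · apply Finset.prod_nonneg
    intro i _
    have : (0:ℝ) ≤ i := Nat.cast_nonneg _
    linarith
  · rw [← mul_pow]
    have e : (ρ * N)^k = (ρ * N)^a * (ρ * N)^(k-a) := by rw [← pow_add]; congr 1; omega
    rw [e, ← Real.exp_add]
    calc _ = (ρ * N)^a * (ρ * N)^(k-a) * (Real.exp (-((a:ℝ) * (a - 1) / 2) / N) * 
          Real.exp ((((k:ℝ) - a) * (α + 1) + ((k:ℝ) - a) * (k - a - 1) / 2) / N)) := by ring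
      _ ≤ _ := by
        apply mul_le_mul_of_nonneg_left _ (by positivity)
        rw [← Real.exp_add]
        apply Real.exp_le_exp.2
        have h5 : ((k:ℝ) - 1) / (2 * N) * (k - 2 * a) = ((k:ℝ) - 1) * (k - 2 * a) / 2 / N := by
          field_simp
        rw [h5, ← add_div, ← add_div]
        apply div_le_div_of_nonneg_right _ hNr.le
        nlinarith [mul_nonneg har0 (by linarith : 0 ≤ α + 1)]

lemma sum_choose_exp (k : ℕ) (t : ℝ) :
    ∑ a ∈ range (k+1), (k.choose a : ℝ) * Real.exp (t * (k - 2 * a)) ≤ 2^k * Real.exp (t^2/2 * k) := by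
  have h : ∑ a ∈ range (k+1), (k.choose a : ℝ) * Real.exp (t * (k - 2 * a)) 
      = (Real.exp (-t) + Real.exp t)^k := by
    rw [add_pow]
    refine Finset.sum_congr rfl fun a ha => ?_
    have ha' : a ≤ k := by simp at ha; omega
    rw [← Real.exp_nat_mul, ← Real.exp_nat_mul, ← Real.exp_add, mul_comm, Nat.cast_sub ha']
    congr 2; ring
  rw [h]
  have h2 : Real.exp (-t) + Real.exp t = 2 * Real.cosh t := by rw [Real.cosh_eq]; ring
  rw [h2, mul_pow]
  apply mul_le_mul_of_nonneg_left _ (by positivity)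
  rw [mul_comm, Real.exp_nat_mul]
  exact pow_le_pow_left₀ (Real.cosh_pos t).le (Real.cosh_le_exp_half_sq t) k

lemma trT_bound (α : ℝ) (hα : -1 < α) (m N : ℕ) (hN : 0 < N) (hk : 2 * m ≤ N)
    (h1 : (N:ℝ) ≤ ((2*m:ℕ) + 1) * Real.sqrt ((2*m:ℕ) + 1)) (h2 : ((2*m:ℕ):ℝ)^3 ≤ 64 * (N:ℝ)^2) :
    trT α (2*m) N ≤ (4 * (N:ℝ))^(2*m) * ((2 + |α|) * Real.exp (α + 9)) := by
  refine (trT_le α hα _ N).trans ?_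
  set k := 2 * m with hkdef
  have hNr : (0:ℝ) < N := by exact_mod_cast hN
  have hN1 : (1:ℝ) ≤ N := by exact_mod_cast hN
  have hkr : (0:ℝ) ≤ k := Nat.cast_nonneg _
  have hkN : (k:ℝ) ≤ N := by exact_mod_cast hk
  set K : ℝ := k + |α| with hK
  set t : ℝ := ((k:ℝ) - 1) / (2 * N) with ht
  have hK0 : 0 ≤ K := by positivity
  set E : ℝ := Real.exp ((k:ℝ) * (α + 1) / N) with hE
  have hs : 0 < Real.sqrt ((k:ℝ) + 1) := Real.sqrt_pos.2 (by positivity)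
  have inner : ∀ j ∈ range N, ∑ a ∈ range (k+1), (k.choose a : ℝ)^2 * Qt α k a j ≤
      (((j:ℝ) + K) / (N + K))^k * ((N:ℝ)^k * E * (2^k / Real.sqrt ((k:ℝ) + 1)) * (2^k * Real.exp (t^2/2 * k))) := by
    intro j hj
    have hj' : j < N := by simpa using hj
    calc _ ≤ ∑ a ∈ range (k+1), (2^k / Real.sqrt ((k:ℝ) + 1)) * ((k.choose a : ℝ) * 
        ((((j:ℝ) + K) / (N + K))^k * (N:ℝ)^k * (E * Real.exp (t * (k - 2 * a))))) := by
          apply Finset.sum_le_sum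
          intro a ha
          have ha' : a ≤ k := by simp at ha; omega
          rw [sq, mul_assoc]
          apply mul_le_mul (choose_le_central m a) _ (by have := Qt_nonneg α hα k a j; positivity) (by positivity)
          apply mul_le_mul_of_nonneg_left (Qt_le α hα k a j N ha' hk hN hj'.le) (by positivity)
      _ = (((j:ℝ) + K) / (N + K))^k * ((N:ℝ)^k * E * (2^k / Real.sqrt ((k:ℝ) + 1)) *
          ∑ a ∈ range (k+1), (k.choose a : ℝ) * Real.exp (t * (k - 2 * a))) := by
          simp only [Finset.mul_sum]
          refine Finset.sum_congr rfl fun a _ => ?_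
          ring
      _ ≤ _ := by
          apply mul_le_mul_of_nonneg_left _ (by positivity)
          apply mul_le_mul_of_nonneg_left (sum_choose_exp k t) (by positivity)
  refine (Finset.sum_le_sum inner).trans ?_
  rw [← Finset.sum_mul]
  have hsum : ∑ j ∈ range N, (((j:ℝ) + K) / (N + K))^k ≤ (N + K) / (k + 1) := by
    simp only [div_pow]
    rw [← Finset.sum_div, div_le_iff₀ (by positivity)]
    refine (sum_pow_le K hK0 k N).trans (le_of_eq ?_)
    rw [pow_succ]; ring
  refine (mul_le_mul_of_nonneg_right hsum (by positivity)).trans ?_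
  have hexp : E * Real.exp (t^2/2 * k) ≤ Real.exp (α + 9) := by
    rw [hE, ← Real.exp_add]
    apply Real.exp_le_exp.2
    have a1 : (k:ℝ) * (α + 1) / N ≤ α + 1 := by
      rw [div_le_iff₀ hNr, mul_comm]
      exact mul_le_mul_of_nonneg_left hkN (by linarith)
    have a2 : t^2/2 * k ≤ 8 := by
      have : t^2/2 * k = ((k:ℝ)-1)^2 * k / (8 * N^2) := by rw [ht]; field_simp; ring
      rw [this, div_le_iff₀ (by positivity)]
      rcases Nat.eq_zero_or_pos k with h0 | h0
      · rw [h0]; simp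
      · have : (1:ℝ) ≤ k := by exact_mod_cast h0
        nlinarith
    linarith
  have hNK : (N:ℝ) + K ≤ (2 + |α|) * N := by
    rw [hK]; nlinarith [abs_nonneg α]
  have hfrac : (N + K) / (k + 1) / Real.sqrt ((k:ℝ) + 1) ≤ 2 + |α| := by
    rw [div_div, div_le_iff₀ (by positivity)]
    have : (2 + |α|) * N ≤ (2 + |α|) * (((k:ℝ) + 1) * Real.sqrt ((k:ℝ) + 1)) := 
      mul_le_mul_of_nonneg_left h1 (by positivity)
    linarith
  calc _ = (4 * (N:ℝ))^k * (((N + K) / (k + 1) / Real.sqrt ((k:ℝ) + 1)) * (E * Real.exp (t^2/2 * k))) := by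
        rw [mul_pow, show (4:ℝ) = 2 * 2 by norm_num, mul_pow]; field_simp
    _ ≤ _ := by
      apply mul_le_mul_of_nonneg_left _ (by positivity)
      exact mul_le_mul hfrac hexp (by positivity) (by positivity)


lemma vdm2_eq {N : ℕ} (x : Fin N → ℝ) : vdm2 x = (Matrix.vandermonde x).det ^ 2 := by
  rw [Matrix.det_vandermonde, vdm2, Finset.prod_pow]
  congr 1
  rw [Finset.prod_sigma']
  refine Finset.prod_bij' (fun p _ => ⟨p.1, p.2⟩) (fun p _ => (p.1, p.2)) ?_ ?_ ?_ ?_ ?_ <;> simp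

lemma vdm2_nonneg {N : ℕ} (x : Fin N → ℝ) : 0 ≤ vdm2 x := by rw [vdm2_eq]; positivity

lemma vdm2_perm {N : ℕ} (σ : Equiv.Perm (Fin N)) (x : Fin N → ℝ) : vdm2 (fun i => x (σ i)) = vdm2 x := by
  rw [vdm2_eq, vdm2_eq]
  have : Matrix.vandermonde (fun i => x (σ i)) = (Matrix.vandermonde x).submatrix σ id := by
    ext i j; simp [Matrix.vandermonde]
  rw [this, Matrix.det_permute, mul_pow]
  have : (((Equiv.Perm.sign σ : ℤˣ) : ℤ) : ℝ)^2 = 1 := by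
    rcases Int.units_eq_one_or (Equiv.Perm.sign σ) with h | h <;> rw [h] <;> simp
  rw [this, one_mul]

lemma measurable_vdm2 {N : ℕ} : Measurable (vdm2 : (Fin N → ℝ) → ℝ) := by
  unfold vdm2; fun_prop

lemma measurable_lagWeight {N : ℕ} (α : ℝ) : Measurable (lagWeight α : (Fin N → ℝ) → ℝ) := by
  unfold lagWeight; fun_prop

/-- Andreief identity -/
lemma andreief (N : ℕ) (g : ℝ → ℝ) (hg : ∀ i : ℕ, Integrable (fun x => x ^ i * g x)) :
    Integrable (fun x : Fin N → ℝ => vdm2 x * ∏ i, g (x i)) ∧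
    ∫ x : Fin N → ℝ, vdm2 x * ∏ i, g (x i) = N.factorial * 
      (Matrix.of fun i j : Fin N => ∫ x, x ^ ((i : ℕ) + (j : ℕ)) * g x).det := by
  set M : Matrix (Fin N) (Fin N) ℝ := Matrix.of fun i j : Fin N => ∫ x, x ^ ((i : ℕ) + (j : ℕ)) * g x with hM
  have hexp : (fun x : Fin N → ℝ => vdm2 x * ∏ i, g (x i)) = fun x => 
      ∑ σ : Equiv.Perm (Fin N), ∑ τ : Equiv.Perm (Fin N), 
        (((Equiv.Perm.sign σ : ℤˣ) : ℤ) : ℝ) * (((Equiv.Perm.sign τ : ℤˣ) : ℤ) : ℝ) *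
          ∏ i, (x i ^ ((σ i : ℕ) + (τ i : ℕ)) * g (x i)) := by
    funext x
    have h1 : (Matrix.vandermonde x).det = ∑ σ : Equiv.Perm (Fin N), 
        (((Equiv.Perm.sign σ : ℤˣ) : ℤ) : ℝ) * ∏ i, x i ^ (σ i : ℕ) := by
      rw [← Matrix.det_transpose, Matrix.det_apply']
      simp [Matrix.vandermonde]
    rw [vdm2_eq, h1, sq, Finset.sum_mul_sum, Finset.sum_mul]
    refine Finset.sum_congr rfl fun σ _ => ?_
    rw [Finset.sum_mul]
    refine Finset.sum_congr rfl fun τ _ => ?_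
    simp only [pow_add, Finset.prod_mul_distrib]
    ring
  have hint : ∀ σ τ : Equiv.Perm (Fin N), Integrable (fun x : Fin N → ℝ => 
     (((Equiv.Perm.sign σ : ℤˣ) : ℤ) : ℝ) * (((Equiv.Perm.sign τ : ℤˣ) : ℤ) : ℝ) *
          ∏ i, (x i ^ ((σ i : ℕ) + (τ i : ℕ)) * g (x i))) := by
    intro σ τ
    apply Integrable.const_mul
    exact Integrable.fintype_prod (f := fun i : Fin N => fun y : ℝ => y ^ ((σ i : ℕ) + (τ i : ℕ)) * g y) (fun i => hg _)
  constructor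
  · rw [hexp]
    exact integrable_finsetSum _ fun σ _ => integrable_finsetSum _ fun τ _ => hint σ τ
  · rw [hexp, integral_finsetSum _ (fun σ _ => integrable_finsetSum _ fun τ _ => hint σ τ)]
    have : ∀ σ : Equiv.Perm (Fin N), ∫ x : Fin N → ℝ, ∑ τ : Equiv.Perm (Fin N), 
        (((Equiv.Perm.sign σ : ℤˣ) : ℤ) : ℝ) * (((Equiv.Perm.sign τ : ℤˣ) : ℤ) : ℝ) *
          ∏ i, (x i ^ ((σ i : ℕ) + (τ i : ℕ)) * g (x i)) = M.det := by
      intro σ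
      rw [integral_finsetSum _ (fun τ _ => hint σ τ)]
      have h2 : ∀ τ : Equiv.Perm (Fin N), ∫ x : Fin N → ℝ,
        (((Equiv.Perm.sign σ : ℤˣ) : ℤ) : ℝ) * (((Equiv.Perm.sign τ : ℤˣ) : ℤ) : ℝ) *
          ∏ i, (x i ^ ((σ i : ℕ) + (τ i : ℕ)) * g (x i)) = 
          (((Equiv.Perm.sign σ : ℤˣ) : ℤ) : ℝ) * ((((Equiv.Perm.sign τ : ℤˣ) : ℤ) : ℝ) * ∏ i, M (σ i) (τ i)) := by
        intro τ
        rw [integral_const_mul, mul_assoc]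
        congr 2
        rw [integral_fintype_prod_volume_eq_prod (fun i : Fin N => fun y : ℝ => y ^ ((σ i : ℕ) + (τ i : ℕ)) * g y)]
        rfl
      simp only [h2]
      rw [← Finset.mul_sum]
      have h3 : ∑ τ : Equiv.Perm (Fin N), (((Equiv.Perm.sign τ : ℤˣ) : ℤ) : ℝ) * ∏ i, M (σ i) (τ i)
          = (M.submatrix σ id).det := by
        rw [← Matrix.det_transpose, Matrix.det_apply']
        rfl
      rw [h3, Matrix.det_permute, ← mul_assoc]
      have : (((Equiv.Perm.sign σ : ℤˣ) : ℤ) : ℝ) * (((Equiv.Perm.sign σ : ℤˣ) : ℤ) : ℝ) = 1 := by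
        rcases Int.units_eq_one_or (Equiv.Perm.sign σ) with h | h <;> rw [h] <;> simp
      rw [this, one_mul]
    simp only [this]
    simp [Fintype.card_perm]

lemma gam_int (s : ℝ) (hs : 0 < s) : Integrable (fun x : ℝ => if 0 ≤ x then x ^ (s - 1) * Real.exp (-x) else 0) ∧
    ∫ x : ℝ, (if 0 ≤ x then x ^ (s - 1) * Real.exp (-x) else 0) = Real.Gamma s := by
  have h : (fun x : ℝ => if 0 ≤ x then x ^ (s - 1) * Real.exp (-x) else 0) = 
    (Set.Ici (0:ℝ)).indicator (fun x => Real.exp (-x) * x ^ (s - 1)) := by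
    funext x; simp [Set.indicator, mul_comm]
  rw [h]
  constructor
  · rw [integrable_indicator_iff measurableSet_Ici, integrableOn_Ici_iff_integrableOn_Ioi]
    exact Real.GammaIntegral_convergent hs
  · rw [integral_indicator measurableSet_Ici, integral_Ici_eq_integral_Ioi, Real.Gamma_eq_integral hs]

def gw (α : ℝ) (k : ℕ) (c : ℝ) (x : ℝ) : ℝ := if 0 ≤ x then x ^ α * Real.exp (-x) * (1 + c * x ^ k) else 0

lemma gw_moment (α : ℝ) (hα : -1 < α) (k : ℕ) (c : ℝ) (i : ℕ) :
    Integrable (fun x => x ^ i * gw α k c x) ∧ 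
    ∫ x, x ^ i * gw α k c x = Real.Gamma (α + i + 1) + c * Real.Gamma (α + k + i + 1) := by
  have hi : (0:ℝ) ≤ i := Nat.cast_nonneg _
  have hk : (0:ℝ) ≤ k := Nat.cast_nonneg _
  obtain ⟨a1, a2⟩ := gam_int (α + i + 1) (by linarith)
  obtain ⟨b1, b2⟩ := gam_int (α + k + i + 1) (by linarith)
  have h : (fun x => x ^ i * gw α k c x) =ᵐ[volume] fun x => (if 0 ≤ x then x ^ (α + i + 1 - 1) * Real.exp (-x) else 0) + 
      c * (if 0 ≤ x then x ^ (α + k + i + 1 - 1) * Real.exp (-x) else 0) := by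
    have : ∀ᵐ x : ℝ, x ≠ 0 := by simp [ae_iff]
    filter_upwards [this] with x hx
    unfold gw
    split_ifs with h0
    · have hx' : 0 < x := lt_of_le_of_ne h0 (Ne.symm hx)
      rw [show α + i + 1 - 1 = α + i by ring, show α + k + i + 1 - 1 = α + k + i by ring,
        Real.rpow_add hx', Real.rpow_add hx', Real.rpow_add hx', Real.rpow_natCast, Real.rpow_natCast]
      ring
    · simp
  constructor
  · rw [integrable_congr h]
    exact a1.add (b1.const_mul c)
  · rw [integral_congr_ae h, integral_add a1 (b1.const_mul c), integral_const_mul, a2, b2]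

/-- Laguerre density (unnormalised). -/
def Wd (α : ℝ) {N : ℕ} (x : Fin N → ℝ) : ℝ :=
  if ∀ i, 0 ≤ x i then vdm2 x * lagWeight α x * Real.exp (-∑ i, x i) else 0

lemma Wd_mul (α : ℝ) {N : ℕ} (k : ℕ) (c : ℝ) (x : Fin N → ℝ) :
    Wd α x * ∏ i, (1 + c * x i ^ k) = vdm2 x * ∏ i, gw α k c (x i) := by
  unfold Wd
  split_ifs with h
  · have : ∏ i, gw α k c (x i) = ∏ i, (x i ^ α * Real.exp (-(x i)) * (1 + c * x i ^ k)) :=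
      Finset.prod_congr rfl fun i _ => by unfold gw; rw [if_pos (h i)]
    rw [this, Finset.prod_mul_distrib, Finset.prod_mul_distrib, lagWeight, ← Real.exp_sum, Finset.sum_neg_distrib]
    ring
  · push Not at h
    obtain ⟨i, hi⟩ := h
    have h0 : ∏ i, gw α k c (x i) = 0 :=
      Finset.prod_eq_zero (Finset.mem_univ i) (by unfold gw; rw [if_neg (not_le.2 hi)])
    rw [h0]; simp

lemma Wd_nonneg (α : ℝ) {N : ℕ} (x : Fin N → ℝ) : 0 ≤ Wd α x := by
  unfold Wd
  split_ifs with h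
  · have := vdm2_nonneg x
    have h2 : 0 ≤ lagWeight α x := Finset.prod_nonneg fun i _ => Real.rpow_nonneg (h i) _
    positivity
  · exact le_rfl

lemma measurableSet_nonneg (N : ℕ) : MeasurableSet {x : Fin N → ℝ | ∀ i, 0 ≤ x i} := by
  have : {x : Fin N → ℝ | ∀ i, 0 ≤ x i} = ⋂ i, {x | 0 ≤ x i} := by ext; simp
  rw [this]
  exact MeasurableSet.iInter fun i => measurableSet_le measurable_const (measurable_pi_apply i)

lemma measurable_Wd (α : ℝ) {N : ℕ} : Measurable (Wd α : (Fin N → ℝ) → ℝ) := by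
  unfold Wd
  refine Measurable.ite (measurableSet_nonneg N) ?_ measurable_const
  have := measurable_vdm2 (N := N)
  have := measurable_lagWeight (N := N) α
  fun_prop

def JS (α : ℝ) (N k : ℕ) (S : Finset (Fin N)) : ENNReal :=
  ∫⁻ x : Fin N → ℝ, ENNReal.ofReal (Wd α x * ∏ i ∈ S, x i ^ k)

lemma JS_perm (α : ℝ) (N k : ℕ) (S : Finset (Fin N)) (σ : Equiv.Perm (Fin N)) :
    JS α N k (S.map σ.toEmbedding) = JS α N k S := by
  unfold JS
  have hmp := volume_measurePreserving_piCongrLeft (fun _ : Fin N => ℝ) σ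
  rw [← hmp.lintegral_comp_emb (MeasurableEquiv.measurableEmbedding _)]
  refine lintegral_congr fun x => ?_
  have hx : ∀ i, (MeasurableEquiv.piCongrLeft (fun _ : Fin N => ℝ) σ x) (σ i) = x i := by
    intro i
    exact MeasurableEquiv.piCongrLeft_apply_apply (β := fun _ : Fin N => ℝ) σ x i
  set y := MeasurableEquiv.piCongrLeft (fun _ : Fin N => ℝ) σ x
  congr 1
  have hxy : x = fun i => y (σ i) := by funext i; exact (hx i).symm
  rw [Finset.prod_map, hxy]
  congr 1
  unfold Wd
  rw [vdm2_perm]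
  have h1 : (∀ i, 0 ≤ y i) ↔ ∀ i, 0 ≤ y (σ i) := σ.forall_congr_right.symm
  have h2 : lagWeight α (fun i => y (σ i)) = lagWeight α y := by
    unfold lagWeight; exact Equiv.prod_comp σ (fun i => y i ^ α)
  rw [h2, Equiv.sum_comp σ y]
  simp only [h1]

lemma JS_card (α : ℝ) (N k : ℕ) (S T : Finset (Fin N)) (h : S.card = T.card) : JS α N k S = JS α N k T := by
  obtain ⟨σ, hσ⟩ : ∃ σ : Equiv.Perm (Fin N), S.map σ.toEmbedding = T := by
    let e : S ≃ T := Fintype.equivOfCardEq (by simpa using h)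
    refine ⟨e.extendSubtype, ?_⟩
    apply Finset.eq_of_subset_of_card_le
    · intro x hx
      simp only [Finset.mem_map, Equiv.coe_toEmbedding] at hx
      obtain ⟨y, hy, rfl⟩ := hx
      exact Equiv.extendSubtype_mem e y hy
    · simp [h]
  rw [← hσ, JS_perm]

lemma JS_bound (α : ℝ) (hα : -1 < α) (N k n : ℕ) (c : ℝ) (hc : 0 ≤ c) (S : Finset (Fin N)) (hS : S.card = n) :
    (N.choose n : ENNReal) * (ENNReal.ofReal (c ^ n) * JS α N k S) ≤ 
      ENNReal.ofReal (N.factorial * (Hm α N + c • Hm (α + k) N).det) := by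
  have hgm := gw_moment α hα k c
  obtain ⟨hI, hE⟩ := andreief N (gw α k c) (fun i => (hgm i).1)
  have hmat : (Matrix.of fun i j : Fin N => ∫ x, x ^ ((i : ℕ) + (j : ℕ)) * gw α k c x) = Hm α N + c • Hm (α + k) N := by
    ext i j
    simp only [Matrix.of_apply, Matrix.add_apply, Matrix.smul_apply, Hm, smul_eq_mul]
    rw [(hgm _).2]
    push_cast
    congr 2
    · ring
    · ring_nf
  rw [hmat] at hE
  rw [← hE]
  simp only [← Wd_mul] at hI ⊢
  have hnn : ∀ x : Fin N → ℝ, 0 ≤ Wd α x * ∏ i, (1 + c * x i ^ k) := by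
    intro x
    rw [Wd_mul]
    apply mul_nonneg (vdm2_nonneg x) (Finset.prod_nonneg fun i _ => ?_)
    unfold gw
    split_ifs with h
    · positivity
    · exact le_rfl
  rw [ofReal_integral_eq_lintegral_ofReal hI (ae_of_all _ hnn)]
  have hsum : (N.choose n : ENNReal) * (ENNReal.ofReal (c ^ n) * JS α N k S) = 
      ∑ T ∈ (univ : Finset (Fin N)).powersetCard n, ENNReal.ofReal (c ^ n) * JS α N k T := by
    rw [Finset.sum_congr rfl (fun T hT => by rw [JS_card α N k T S (by rw [hS]; exact (Finset.mem_powersetCard.1 hT).2)])]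
    rw [Finset.sum_const, Finset.card_powersetCard]
    simp
  rw [hsum]
  have hmeas : ∀ T : Finset (Fin N), Measurable (fun x : Fin N → ℝ => ENNReal.ofReal (Wd α x * ∏ i ∈ T, x i ^ k)) := by
    intro T
    have := measurable_Wd α (N := N)
    fun_prop
  unfold JS
  rw [Finset.sum_congr rfl (fun T _ => (lintegral_const_mul _ (hmeas T)).symm)]
  rw [← lintegral_finsetSum _ (fun T _ => (hmeas T).const_mul _)]
  apply lintegral_mono
  intro x
  by_cases hx : ∀ i, 0 ≤ x i
  · have hW := Wd_nonneg α x
    have hp : ∀ T : Finset (Fin N), 0 ≤ ∏ i ∈ T, x i ^ k := fun T => Finset.prod_nonneg fun i _ => pow_nonneg (hx i) _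
    have hcp : 0 ≤ c ^ n := pow_nonneg hc n
    simp only
    rw [Finset.sum_congr rfl (fun T _ => (ENNReal.ofReal_mul hcp).symm)]
    rw [← ENNReal.ofReal_sum_of_nonneg (fun T _ => mul_nonneg hcp (mul_nonneg hW (hp T)))]
    apply ENNReal.ofReal_le_ofReal
    have e1 : ∑ T ∈ (univ : Finset (Fin N)).powersetCard n, c ^ n * (Wd α x * ∏ i ∈ T, x i ^ k)
      = Wd α x * ∑ T ∈ (univ : Finset (Fin N)).powersetCard n, ∏ i ∈ T, (c * x i ^ k) := by
      rw [Finset.mul_sum]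
      refine Finset.sum_congr rfl fun T hT => ?_
      rw [Finset.prod_mul_distrib, Finset.prod_const, (Finset.mem_powersetCard.1 hT).2]
      ring
    rw [e1]
    apply mul_le_mul_of_nonneg_left _ hW
    rw [Finset.prod_one_add]
    apply Finset.sum_le_sum_of_subset_of_nonneg
    · intro T _; simp
    · intro T _ _
      exact Finset.prod_nonneg fun i _ => mul_nonneg hc (pow_nonneg (hx i) _)
  · have : Wd α x = 0 := by unfold Wd; rw [if_neg hx]
    simp [this]


/-- append one coordinate at the end -/
def sv {q : ℕ} (x : Fin q → ℝ) (a : ℝ) : Fin (q + 1) → ℝ := Fin.snoc (α := fun _ => ℝ) x a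

lemma sv_smul {q : ℕ} (c : ℝ) (x : Fin q → ℝ) (a : ℝ) : sv (c • x) (c * a) = c • sv x a := by
  funext i
  refine Fin.lastCases ?_ (fun i => ?_) i <;> simp [sv]

lemma sv_sum {q : ℕ} (x : Fin q → ℝ) (a : ℝ) : ∑ i, sv x a i = (∑ i, x i) + a := by
  rw [Fin.sum_univ_castSucc]; simp [sv]

lemma measurable_sv {q : ℕ} : Measurable (fun p : (Fin q → ℝ) × ℝ => sv p.1 p.2) := by
  rw [measurable_pi_iff]
  intro i
  refine Fin.lastCases ?_ (fun i => ?_) i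
  · simp only [sv, Fin.snoc_last]; fun_prop
  · simp only [sv, Fin.snoc_castSucc]; fun_prop

lemma lint_sv {q : ℕ} (f : (Fin (q + 1) → ℝ) → ENNReal) (hf : Measurable f) :
    ∫⁻ x, f x = ∫⁻ x : Fin q → ℝ, ∫⁻ a : ℝ, f (sv x a) := by
  have hmp := (volume_preserving_piFinSuccAbove (fun _ : Fin (q+1) => ℝ) (Fin.last q)).symm
  rw [← hmp.lintegral_comp_emb (MeasurableEquiv.measurableEmbedding _)]
  rw [Measure.volume_eq_prod, lintegral_prod_symm]
  · refine lintegral_congr fun x => lintegral_congr fun a => ?_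
    congr 1
    simp [MeasurableEquiv.piFinSuccAbove, sv, Fin.insertNthEquiv]
  · exact (hf.comp (MeasurableEquiv.measurable _)).aemeasurable

lemma lint_smul {n : ℕ} (c : ℝ) (hc : 0 < c) (f : (Fin n → ℝ) → ENNReal) :
    ∫⁻ x, f (c • x) = ENNReal.ofReal ((c ^ n)⁻¹) * ∫⁻ x, f x := by
  have h := Measure.map_addHaar_smul (volume : Measure (Fin n → ℝ)) hc.ne'
  have h2 := lintegral_map_equiv (μ := (volume : Measure (Fin n → ℝ))) f
    (Homeomorph.smulOfNeZero c hc.ne').toMeasurableEquiv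
  have e : ⇑(Homeomorph.smulOfNeZero c hc.ne' : (Fin n → ℝ) ≃ₜ (Fin n → ℝ)).toMeasurableEquiv = fun x => c • x := rfl
  rw [e, h] at h2
  rw [← h2, lintegral_smul_measure]
  simp [abs_of_pos (show 0 < (c^n)⁻¹ by positivity)]

lemma polar {q : ℕ} (F : (Fin (q + 1) → ℝ) → ENNReal) (hF : Measurable F) (d r : ℝ) (hr : 0 < r)
    (hd : 0 < q + 1 + d)
    (hhom : ∀ c : ℝ, 0 < c → ∀ x, F (c • x) = ENNReal.ofReal (c ^ d) * F x)
    (hpos : ∀ x, (∃ i, x i < 0) → F x = 0) :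
    ∫⁻ x, F x * ENNReal.ofReal (Real.exp (-∑ i, x i)) =
      ENNReal.ofReal (Real.Gamma (q + 1 + d) / r ^ (q + d)) *
        ∫⁻ x : Fin q → ℝ, F (sv x (r - ∑ i, x i)) := by
  set I : ℝ → ENNReal := fun ρ => ∫⁻ x : Fin q → ℝ, F (sv x (ρ - ∑ i, x i)) with hI
  have hm1 : Measurable (fun p : (Fin q → ℝ) × ℝ => F (sv p.1 (p.2 - ∑ i, p.1 i))) := by
    apply hF.comp
    exact measurable_sv.comp (f := fun p : (Fin q → ℝ) × ℝ => (p.1, p.2 - ∑ i, p.1 i)) (by fun_prop)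
  have hmr : ∀ ρ : ℝ, Measurable (fun x : Fin q → ℝ => F (sv x (ρ - ∑ i, x i))) :=
    fun ρ => hm1.comp (measurable_id.prodMk measurable_const)
  have hIr : ∀ ρ : ℝ, 0 < ρ → I ρ = ENNReal.ofReal ((ρ / r) ^ (q + d)) * I r := by
    intro ρ hρ
    have hc : 0 < ρ / r := by positivity
    have h1 := lint_smul (ρ / r) hc (fun x : Fin q → ℝ => F (sv x (ρ - ∑ i, x i)))
    have h2 : ∀ x : Fin q → ℝ, F (sv ((ρ / r) • x) (ρ - ∑ i, ((ρ / r) • x) i)) = 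
       ENNReal.ofReal ((ρ / r) ^ d) * F (sv x (r - ∑ i, x i)) := by
      intro x
      rw [← hhom _ hc, ← sv_smul]
      congr 2
      simp only [Pi.smul_apply, smul_eq_mul, ← Finset.mul_sum]
      field_simp
    simp only [h2] at h1
    rw [lintegral_const_mul _ (hmr r)] at h1
    change _ * I r = _ * I ρ at h1
    have h3 : ENNReal.ofReal ((ρ / r) ^ (q + d)) * I r = ENNReal.ofReal ((ρ / r)^q) * (ENNReal.ofReal ((ρ / r) ^ d) * I r) := by
      rw [← mul_assoc, ← ENNReal.ofReal_mul (by positivity), Real.rpow_add hc, Real.rpow_natCast]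
    rw [h3, h1, ← mul_assoc, ← ENNReal.ofReal_mul (by positivity), mul_inv_cancel₀ (by positivity)]
    simp
  have hI0 : ∀ ρ : ℝ, ρ < 0 → I ρ = 0 := by
    intro ρ hρ
    have : ∀ x : Fin q → ℝ, F (sv x (ρ - ∑ i, x i)) = 0 := by
      intro x
      apply hpos
      by_contra h
      push Not at h
      have h2 : 0 ≤ ∑ i, sv x (ρ - ∑ i, x i) i := Finset.sum_nonneg fun i _ => h i
      rw [sv_sum] at h2
      linarith
    simp only [hI, this, lintegral_zero]
  have hm2 : Measurable (fun p : (Fin q → ℝ) × ℝ => F (sv p.1 (p.2 - ∑ i, p.1 i)) * ENNReal.ofReal (Real.exp (-p.2))) := by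
    apply hm1.mul
    fun_prop
  calc ∫⁻ x, F x * ENNReal.ofReal (Real.exp (-∑ i, x i)) 
      = ∫⁻ x : Fin q → ℝ, ∫⁻ a : ℝ, F (sv x a) * ENNReal.ofReal (Real.exp (-∑ i, sv x a i)) := 
        lint_sv (fun x => F x * ENNReal.ofReal (Real.exp (-∑ i, x i))) (by apply hF.mul; fun_prop)
    _ = ∫⁻ x : Fin q → ℝ, ∫⁻ ρ : ℝ, F (sv x (ρ - ∑ i, x i)) * ENNReal.ofReal (Real.exp (-ρ)) := by
        refine lintegral_congr fun x => ?_
        rw [← lintegral_sub_right_eq_self _ (∑ i, x i)]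
        refine lintegral_congr fun ρ => ?_
        rw [sv_sum]; congr 4; ring
    _ = ∫⁻ ρ : ℝ, ∫⁻ x : Fin q → ℝ, F (sv x (ρ - ∑ i, x i)) * ENNReal.ofReal (Real.exp (-ρ)) := 
        lintegral_lintegral_swap (f := fun (x : Fin q → ℝ) (ρ : ℝ) => F (sv x (ρ - ∑ i, x i)) * ENNReal.ofReal (Real.exp (-ρ))) hm2.aemeasurable
    _ = ∫⁻ ρ : ℝ, I ρ * ENNReal.ofReal (Real.exp (-ρ)) := by
        refine lintegral_congr fun ρ => ?_
        rw [lintegral_mul_const _ (hmr ρ)]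
    _ = ∫⁻ ρ : ℝ, ENNReal.ofReal ((r ^ (q + d))⁻¹ * (if 0 ≤ ρ then ρ ^ (q + 1 + d - 1) * Real.exp (-ρ) else 0)) * I r := by
        apply lintegral_congr_ae
        have : ∀ᵐ x : ℝ, x ≠ 0 := by simp [ae_iff]
        filter_upwards [this] with ρ hρ
        rcases lt_or_gt_of_ne hρ with h | h
        · rw [hI0 ρ h, if_neg (not_le.2 h)]; simp
        · rw [hIr ρ h, if_pos h.le, mul_right_comm, ← ENNReal.ofReal_mul (by positivity)]
          congr 2
          rw [Real.div_rpow h.le hr.le, show (q:ℝ) + 1 + d - 1 = q + d by ring]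
          field_simp
    _ = _ := by
        obtain ⟨g1, g2⟩ := gam_int (q + 1 + d) hd
        rw [lintegral_mul_const'' _ (by exact ((g1.const_mul _).1.aemeasurable).ennreal_ofReal)]
        congr 1
        rw [← ofReal_integral_eq_lintegral_ofReal (g1.const_mul _), integral_const_mul, g2]
        · congr 1; field_simp
        · refine ae_of_all _ fun ρ => ?_
          simp only
          split_ifs with h
          · simp only [Pi.zero_apply]; positivity
          · simp

lemma lint_append {n p : ℕ} (f : (Fin (n + p) → ℝ) → ENNReal) (hf : Measurable f) :
    ∫⁻ x, f x = ∫⁻ t : Fin n → ℝ, ∫⁻ y : Fin p → ℝ, f (Fin.append t y) := by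
  have h1 := volume_measurePreserving_piCongrLeft (fun _ : Fin (n + p) => ℝ) (finSumFinEquiv (m := n) (n := p))
  have h2 := volume_measurePreserving_sumPiEquivProdPi_symm (fun _ : Fin n ⊕ Fin p => ℝ)
  rw [← h1.lintegral_comp_emb (MeasurableEquiv.measurableEmbedding _)]
  rw [← h2.lintegral_comp_emb (MeasurableEquiv.measurableEmbedding _)]
  rw [Measure.volume_eq_prod, lintegral_prod]
  · refine lintegral_congr fun t => lintegral_congr fun y => ?_
    congr 1
    funext i
    refine Fin.addCases (fun i => ?_) (fun i => ?_) i
    · have := MeasurableEquiv.piCongrLeft_apply_apply (β := fun _ : Fin (n + p) => ℝ) finSumFinEquiv 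
        ((MeasurableEquiv.sumPiEquivProdPi fun _ : Fin n ⊕ Fin p => ℝ).symm (t, y)) (Sum.inl i)
      rw [finSumFinEquiv_apply_left] at this
      rw [this, Fin.append_left]; rfl
    · have := MeasurableEquiv.piCongrLeft_apply_apply (β := fun _ : Fin (n + p) => ℝ) finSumFinEquiv 
        ((MeasurableEquiv.sumPiEquivProdPi fun _ : Fin n ⊕ Fin p => ℝ).symm (t, y)) (Sum.inr i)
      rw [finSumFinEquiv_apply_right] at this
      rw [this, Fin.append_right]; rfl
  · exact (hf.comp ((MeasurableEquiv.measurable _).comp (MeasurableEquiv.measurable _))).aemeasurable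

/-- weighted density without the exponential -/
def Fd (α : ℝ) (n k N : ℕ) (x : Fin N → ℝ) : ENNReal :=
  if ∀ i, 0 ≤ x i then ENNReal.ofReal (vdm2 x * lagWeight α x * 
    ∏ i ∈ univ.filter (fun i : Fin N => (i : ℕ) < n), x i ^ k) else 0

lemma measurable_Fd (α : ℝ) (n k N : ℕ) : Measurable (Fd α n k N) := by
  unfold Fd
  refine Measurable.ite (measurableSet_nonneg N) ?_ measurable_const
  have := measurable_vdm2 (N := N)
  have := measurable_lagWeight (N := N) α
  fun_prop

lemma card_lt (N : ℕ) : (univ.filter (fun p : Fin N × Fin N => p.1 < p.2)).card = N.choose 2 := by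
  have h1 : univ.filter (fun p : Fin N × Fin N => p.1 < p.2) = 
     ((univ : Finset (Fin N)).sigma (fun i => Finset.Ioi i)).map (Equiv.sigmaEquivProd _ _).toEmbedding := by
    ext ⟨a, b⟩
    simp [Equiv.sigmaEquivProd]
  rw [h1, Finset.card_map, Finset.card_sigma]
  simp only [Fin.card_Ioi]
  rw [Fin.sum_univ_eq_sum_range (fun i => N - 1 - i) N, Finset.sum_range_reflect (fun i => i) N,
    Finset.sum_range_id, Nat.choose_two_right]

lemma Fd_hom (α : ℝ) (n k N : ℕ) (hn : n ≤ N) (c : ℝ) (hc : 0 < c) (x : Fin N → ℝ) :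
    Fd α n k N (c • x) = ENNReal.ofReal (c ^ ((N:ℝ) * (N - 1) + N * α + n * k)) * Fd α n k N x := by
  unfold Fd
  have hiff : (∀ i, 0 ≤ (c • x) i) ↔ ∀ i, 0 ≤ x i := by
    refine forall_congr' fun i => ?_
    simp [hc]
  rw [if_congr hiff rfl rfl]
  split_ifs with h
  · rw [← ENNReal.ofReal_mul (by positivity)]
    congr 1
    have e1 : vdm2 (c • x) = c ^ ((N:ℝ) * (N - 1)) * vdm2 x := by
      have hx : ∀ p : Fin N × Fin N, ((c • x) p.2 - (c • x) p.1)^2 = c^2 * (x p.2 - x p.1)^2 := by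
        intro p; simp; ring
      unfold vdm2
      simp only [hx]
      rw [Finset.prod_mul_distrib, Finset.prod_const, card_lt, ← pow_mul, ← Real.rpow_natCast]
      congr 2
      push_cast
      rw [Nat.cast_choose_two]; ring
    have e2 : lagWeight α (c • x) = c ^ ((N:ℝ) * α) * lagWeight α x := by
      unfold lagWeight
      simp only [Pi.smul_apply, smul_eq_mul]
      rw [Finset.prod_congr rfl (fun i _ => Real.mul_rpow hc.le (h i)), Finset.prod_mul_distrib, Finset.prod_const]
      rw [Finset.card_univ, Fintype.card_fin, ← Real.rpow_mul_natCast hc.le, mul_comm α]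
    have e3 : ∏ i ∈ univ.filter (fun i : Fin N => (i : ℕ) < n), (c • x) i ^ k = c ^ ((n:ℝ) * k) * 
       ∏ i ∈ univ.filter (fun i : Fin N => (i : ℕ) < n), x i ^ k := by
      simp only [Pi.smul_apply, smul_eq_mul, mul_pow]
      rw [Finset.prod_mul_distrib, Finset.prod_const]
      rw [Fin.card_filter_val_lt, min_eq_right hn, ← pow_mul, ← Real.rpow_natCast]
      congr 2; push_cast; ring
    rw [e1, e2, e3, Real.rpow_add hc, Real.rpow_add hc]
    ring
  · simp

lemma JS_eq (α : ℝ) (N k n : ℕ) :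
    JS α N k (univ.filter (fun i : Fin N => (i : ℕ) < n)) = 
      ∫⁻ x, Fd α n k N x * ENNReal.ofReal (Real.exp (-∑ i, x i)) := by
  unfold JS
  refine lintegral_congr fun x => ?_
  unfold Fd Wd
  split_ifs with h
  · rw [← ENNReal.ofReal_mul' (by positivity)]
    congr 1; ring
  · simp

lemma JS_polar (α : ℝ) (hα : -1 < α) (q k n : ℕ) (hn : n ≤ q + 1) (r : ℝ) (hr : 0 < r) :
    JS α (q+1) k (univ.filter (fun i : Fin (q+1) => (i : ℕ) < n)) = 
      ENNReal.ofReal (Real.Gamma (((q+1:ℕ):ℝ) * ((q+1:ℕ) + α) + (n * k : ℕ)) / 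
        r ^ (((q+1:ℕ):ℝ) * ((q+1:ℕ) + α) + (n * k : ℕ) - 1)) *
        ∫⁻ x : Fin q → ℝ, Fd α n k (q+1) (sv x (r - ∑ i, x i)) := by
  rw [JS_eq]
  have hq : (0:ℝ) ≤ q := Nat.cast_nonneg _
  have hnk : (0:ℝ) ≤ (n:ℝ) * k := by positivity
  have := polar (Fd α n k (q+1)) (measurable_Fd _ _ _ _) (((q+1:ℕ):ℝ) * ((q+1:ℕ) - 1) + (q+1:ℕ) * α + n * k) r hr
    (by push_cast; nlinarith) (fun c hc x => Fd_hom α n k (q+1) hn c hc x) 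
    (fun x ⟨i, hi⟩ => by unfold Fd; rw [if_neg]; push Not; exact ⟨i, hi⟩)
  rw [this]
  congr 3
  · congr 1; push_cast; ring
  · congr 1; push_cast; ring

lemma le_ofReal_div (g D : ℝ) (hg : 0 < g) (X : ENNReal) (h : ENNReal.ofReal g * X ≤ ENNReal.ofReal D) :
    X ≤ ENNReal.ofReal (D / g) := by
  rw [ENNReal.ofReal_div_of_pos hg, ENNReal.le_div_iff_mul_le (Or.inl (by simpa using hg)) (Or.inl ENNReal.ofReal_ne_top), mul_comm]
  exact h

/-- the numerator product of the partition function -/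
def Pz (α : ℝ) (N : ℕ) : ℝ :=
  ∏ j ∈ Finset.range N, Real.Gamma (1 + ((j : ℝ) + 1)) * Real.Gamma (α + ((j : ℝ) + 1))

lemma Pz_eq (α : ℝ) (N : ℕ) : (N.factorial : ℝ) * ∏ l : Fin N, Dg α l = Pz α N := by
  rw [Fin.prod_univ_eq_prod_range (fun l => Dg α l) N, Pz]
  induction N with
  | zero => simp
  | succ N ih =>
    rw [Finset.prod_range_succ, Finset.prod_range_succ, ← ih, Nat.factorial_succ]
    have : Real.Gamma (1 + ((N:ℝ) + 1)) = (N + 1) * N.factorial := by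
      rw [add_comm, Real.Gamma_add_one (by positivity), Real.Gamma_nat_eq_factorial]
    rw [this, Dg]
    push_cast
    rw [add_assoc α]
    ring

lemma Pz_pos (α : ℝ) (hα : -1 < α) (N : ℕ) : 0 < Pz α N := by
  refine Finset.prod_pos fun j _ => ?_
  have : (0:ℝ) ≤ j := Nat.cast_nonneg _
  exact mul_pos (Real.Gamma_pos_of_pos (by linarith)) (Real.Gamma_pos_of_pos (by linarith))

lemma X_bound (α : ℝ) (hα : -1 < α) (q n m : ℕ) (hn : n ≤ q + 1) (r : ℝ) (hr : 0 < r)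
    (hk : 2 * m ≤ q + 1) (h1 : ((q+1:ℕ):ℝ) ≤ ((2*m:ℕ)+1)*√((2*m:ℕ)+1)) 
    (h2 : ((2*m:ℕ):ℝ)^3 ≤ 64*((q+1:ℕ):ℝ)^2) (hM : 0 < ((q+1:ℕ):ℝ) * ((q+1:ℕ) + α)) :
    ∫⁻ x : Fin q → ℝ, Fd α n (2*m) (q+1) (sv x (r - ∑ i, x i)) ≤
      ENNReal.ofReal ((Pz α (q+1) * Real.exp ((2+|α|)*Real.exp (α+9))) / 
        ((q+1).choose n * ((((4 * ((q+1:ℕ):ℝ)) ^ (2*m))⁻¹) ^ n * 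
          (Real.Gamma (((q+1:ℕ):ℝ) * ((q+1:ℕ) + α) + (n * (2*m) : ℕ)) / 
        r ^ (((q+1:ℕ):ℝ) * ((q+1:ℕ) + α) + (n * (2*m) : ℕ) - 1))))) := by
  set N : ℕ := q + 1 with hN
  have hNpos : 0 < N := by omega
  have hNr : (0:ℝ) < N := by exact_mod_cast hNpos
  set c : ℝ := ((4 * (N:ℝ)) ^ (2*m))⁻¹ with hc
  have hc0 : 0 < c := by positivity
  have hch : (0:ℝ) < (N.choose n : ℝ) := by exact_mod_cast Nat.choose_pos hn
  have hg : 0 < Real.Gamma ((N:ℝ) * (N + α) + (n * (2*m) : ℕ)) := Real.Gamma_pos_of_pos (by positivity)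
  apply le_ofReal_div _ _ (by positivity)
  have hJ := JS_bound α hα N (2*m) n c hc0.le (univ.filter (fun i : Fin N => (i : ℕ) < n)) 
    (by rw [Fin.card_filter_val_lt, min_eq_right hn])
  rw [JS_polar α hα q (2*m) n hn r hr] at hJ
  rw [ENNReal.ofReal_mul hch.le, ENNReal.ofReal_mul (by positivity), ENNReal.ofReal_natCast, mul_assoc, mul_assoc]
  refine hJ.trans (ENNReal.ofReal_le_ofReal ?_)
  have hd := det_Hm_le α hα (2*m) N c hc0.le
  rw [← Pz_eq, mul_assoc]
  refine mul_le_mul_of_nonneg_left (hd.trans ?_) (by positivity)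
  refine mul_le_mul_of_nonneg_left ?_ (Finset.prod_nonneg fun l _ => (Dg_pos α hα l).le)
  apply Real.exp_le_exp.2
  have := trT_bound α hα m N hNpos hk h1 h2
  calc c * trT α (2*m) N ≤ c * ((4*(N:ℝ))^(2*m) * ((2+|α|)*Real.exp (α+9))) := by gcongr
    _ = _ := by rw [hc, ← mul_assoc, inv_mul_cancel₀ (by positivity), one_mul]

lemma sv_prod {n p k : ℕ} (t : Fin n → ℝ) (y : Fin p → ℝ) (a : ℝ) :
    ∏ i ∈ univ.filter (fun i : Fin (n+p+1) => (i : ℕ) < n), sv (Fin.append t y) a i ^ k = ∏ i, t i ^ k := by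
  rw [Finset.prod_filter, Fin.prod_univ_castSucc, Fin.prod_univ_add]
  simp [sv]

lemma sum_append {n p : ℕ} (t : Fin n → ℝ) (y : Fin p → ℝ) : 
    ∑ i, Fin.append t y i = (∑ i, t i) + ∑ i, y i := by
  rw [Fin.sum_univ_add]; simp

lemma ftlueR_int (α : ℝ) (n p : ℕ) (r : ℝ) (t : Fin n → ℝ) :
    ∫ y : Fin (n + p + 1 - 1 - n) → ℝ,
        (if (∀ k, 0 ≤ y k) ∧ (∑ i, t i) + (∑ k, y k) ≤ r then
          vdm2 (ftlueVec (n+p+1) n r t y) * lagWeight α (ftlueVec (n+p+1) n r t y) else 0) = 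
    ∫ y : Fin p → ℝ,
        (if (∀ k, 0 ≤ y k) ∧ (∑ i, t i) + (∑ k, y k) ≤ r then
          vdm2 (sv (Fin.append t y) (r - ∑ i, Fin.append t y i)) * 
            lagWeight α (sv (Fin.append t y) (r - ∑ i, Fin.append t y i)) else 0) := by
  unfold ftlueVec
  have key : ∀ p' : ℕ, p' = p → ∫ y : Fin p' → ℝ,
        (if (∀ k, 0 ≤ y k) ∧ (∑ i, t i) + (∑ k, y k) ≤ r then
          vdm2 (fun i : Fin (n+p+1) => if (i : ℕ) < n then extFun t (i : ℕ)
    else if (i : ℕ) < n + p + 1 - 1 then extFun y ((i : ℕ) - n)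
    else r - (∑ j, t j) - (∑ k, y k)) * lagWeight α (fun i : Fin (n+p+1) => if (i : ℕ) < n then extFun t (i : ℕ)
    else if (i : ℕ) < n + p + 1 - 1 then extFun y ((i : ℕ) - n)
    else r - (∑ j, t j) - (∑ k, y k)) else 0) = 
       ∫ y : Fin p → ℝ,
        (if (∀ k, 0 ≤ y k) ∧ (∑ i, t i) + (∑ k, y k) ≤ r then
          vdm2 (sv (Fin.append t y) (r - ∑ i, Fin.append t y i)) * 
            lagWeight α (sv (Fin.append t y) (r - ∑ i, Fin.append t y i)) else 0) := by
    intro p' hp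
    subst hp
    congr 1
    funext y
    have : (fun i : Fin (n+p'+1) => if (i : ℕ) < n then extFun t (i : ℕ)
      else if (i : ℕ) < n + p' + 1 - 1 then extFun y ((i : ℕ) - n)
      else r - (∑ j, t j) - (∑ k, y k)) = sv (Fin.append t y) (r - ∑ i, Fin.append t y i) := by
      funext i
      refine Fin.lastCases ?_ (fun i => ?_) i
      · simp [sv, Fin.sum_univ_add]; ring
      · refine Fin.addCases (fun i => ?_) (fun i => ?_) i
        · simp [sv, extFun]
        · simp only [sv, Fin.snoc_castSucc, Fin.append_right]
          simp [extFun]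
    rw [this]
  exact key _ (by omega)

lemma ftlueZ_pos (α : ℝ) (hα : -1 < α) (N : ℕ) (hN : 0 < N) (r : ℝ) (hr : 0 < r) : 0 < ftlueZ α N r := by
  have hNr : (1:ℝ) ≤ N := by exact_mod_cast hN
  have hM : 0 < (N:ℝ) * (N + α) := by apply mul_pos <;> linarith
  have := Pz_pos α hα N
  have := Real.Gamma_pos_of_pos hM
  change 0 < r ^ ((N : ℝ) * ((N : ℝ) + α)) * Pz α N / Real.Gamma ((N : ℝ) * ((N : ℝ) + α))
  positivity

lemma ftlueR_le (α : ℝ) (hα : -1 < α) (n p k : ℕ) (r : ℝ) (hr : 0 < r) (t : Fin n → ℝ) :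
    ‖ftlueR α (n+p+1) n r t‖ₑ * ENNReal.ofReal (∏ i, t i ^ k) ≤ 
      ENNReal.ofReal ((((n+p+1).factorial : ℝ) / ((n+p+1 - n).factorial : ℝ)) / ftlueZ α (n+p+1) r) *
      ∫⁻ y : Fin p → ℝ, Fd α n k (n+p+1) (sv (Fin.append t y) (r - ∑ i, Fin.append t y i)) := by
  have hZ := ftlueZ_pos α hα (n+p+1) (by omega) r hr
  unfold ftlueR
  by_cases hc : (∀ i, 0 ≤ t i) ∧ (∑ i, t i) ≤ r
  · rw [if_pos hc, ftlueR_int, enorm_mul, mul_assoc]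
    rw [Real.enorm_of_nonneg (by positivity)]
    refine mul_le_mul_right ?_ _
    refine (mul_le_mul_left (enorm_integral_le_lintegral_enorm _) _).trans ?_
    rw [← lintegral_mul_const' _ _ ENNReal.ofReal_ne_top]
    refine lintegral_mono fun y => ?_
    simp only
    by_cases hy : (∀ k, 0 ≤ y k) ∧ (∑ i, t i) + (∑ k, y k) ≤ r
    · rw [if_pos hy]
      have hs : ∀ i, 0 ≤ sv (Fin.append t y) (r - ∑ i, Fin.append t y i) i := by
        intro i
        refine Fin.lastCases ?_ (fun i => ?_) i
        · simp only [sv, Fin.snoc_last, sum_append]; linarith [hy.2]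
        · simp only [sv, Fin.snoc_castSucc]
          refine Fin.addCases (fun i => ?_) (fun i => ?_) i
          · simpa using hc.1 i
          · simpa using hy.1 i
      have hv := vdm2_nonneg (sv (Fin.append t y) (r - ∑ i, Fin.append t y i))
      have hl : 0 ≤ lagWeight α (sv (Fin.append t y) (r - ∑ i, Fin.append t y i)) := 
        Finset.prod_nonneg fun i _ => Real.rpow_nonneg (hs i) _
      unfold Fd
      rw [if_pos hs, sv_prod, Real.enorm_of_nonneg (mul_nonneg hv hl), ENNReal.ofReal_mul (mul_nonneg hv hl)]
    · rw [if_neg hy]; simp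
  · rw [if_neg hc]; simp

/-- rescaling -/
lemma rescale (n : ℕ) (L : ℝ) (hL : 0 < L) (G : (Fin n → ℝ) → ENNReal) :
    ∫⁻ y : EuclideanSpace ℝ (Fin n), G (fun i => 1 + y i / L) = ENNReal.ofReal (L ^ n) * ∫⁻ t, G t := by
  have h := (PiLp.volume_preserving_toLp (Fin n)).lintegral_comp_emb 
    (MeasurableEquiv.toLp 2 (Fin n → ℝ)).measurableEmbedding (fun y : EuclideanSpace ℝ (Fin n) => G (fun i => 1 + y i / L))
  rw [← h]
  have h2 := lint_smul L⁻¹ (by positivity) (fun x : Fin n → ℝ => G ((fun _ => 1) + x))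
  rw [lintegral_add_left_eq_self G (fun _ => 1)] at h2
  have e1 : (L⁻¹ ^ n)⁻¹ = L ^ n := by rw [inv_pow, inv_inv]
  rw [e1] at h2
  rw [← h2]
  refine lintegral_congr fun x => ?_
  congr 1
  funext i
  simp only [Pi.add_apply, Pi.smul_apply, smul_eq_mul]
  ring

lemma pref_bound (α : ℝ) (hα : -1 < α) (N n k : ℕ) (hn : n ≤ N) (hN : 0 < N) (r E : ℝ) (hE : 0 < E)
    (hr : r = ((N:ℝ) + α) / 4) (hr1 : 1 ≤ r) :
    ((N.factorial : ℝ) / ((N - n).factorial : ℝ)) / ftlueZ α N r * 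
      ((Pz α N * E) / (N.choose n * ((((4 * (N:ℝ)) ^ k)⁻¹) ^ n * 
          (Real.Gamma ((N:ℝ) * (N + α) + (n * k : ℕ)) / 
        r ^ ((N:ℝ) * (N + α) + (n * k : ℕ) - 1))))) ≤ n.factorial * E := by
  have hNr : (0:ℝ) < N := by exact_mod_cast hN
  have hP := Pz_pos α hα N
  have hr0 : 0 < r := by linarith
  have hZ : ftlueZ α N r = r ^ ((N : ℝ) * ((N : ℝ) + α)) * Pz α N / Real.Gamma ((N : ℝ) * ((N : ℝ) + α)) := rfl
  have hMr : (N:ℝ) * (N + α) = (4 * N) * r := by rw [hr]; ring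
  rw [hZ, hMr]
  set M : ℝ := (4 * N) * r with hM
  have hM0 : 0 < M := by positivity
  have hg := Real.Gamma_pos_of_pos hM0
  rw [Gamma_prod M hM0]
  set Q : ℝ := ∏ i ∈ range (n * k), (M + i) with hQ
  have hQle : M ^ (n * k) ≤ Q := by
    have h := Finset.prod_le_prod (s := range (n * k)) (f := fun _ => M) (g := fun i : ℕ => M + i)
      (fun i _ => hM0.le) (fun i _ => by simp)
    simpa using h
  have hQ0 : 0 < Q := lt_of_lt_of_le (by positivity) hQle
  have hrp : r ^ (M + (n * k : ℕ) - 1) = r ^ M * r ^ (n * k) / r := by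
    rw [Real.rpow_sub hr0, Real.rpow_add hr0, Real.rpow_natCast, Real.rpow_one]
  rw [hrp]
  have hch : ((N.choose n : ℕ) : ℝ) = N.factorial / (n.factorial * (N - n).factorial) := by
    rw [Nat.cast_choose ℝ hn]
  rw [hch]
  have hrM : 0 < r ^ M := by positivity
  have hpw : (((4 * (N:ℝ)) ^ k)⁻¹) ^ n = ((4 * (N:ℝ)) ^ (n * k))⁻¹ := by
    rw [inv_pow, ← pow_mul, mul_comm k]
  rw [hpw]
  have hf1 : (0:ℝ) < N.factorial := by exact_mod_cast Nat.factorial_pos _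
  have hf2 : (0:ℝ) < n.factorial := by exact_mod_cast Nat.factorial_pos _
  have hf3 : (0:ℝ) < (N - n).factorial := by exact_mod_cast Nat.factorial_pos _
  rw [hM, mul_pow] at hQle
  set a : ℝ := (4 * (N:ℝ)) ^ (n * k) with ha
  have ha0 : 0 < a := by positivity
  set b : ℝ := r ^ (n * k) with hb
  have hb0 : 0 < b := by positivity
  have e : (N.factorial : ℝ) / ((N - n).factorial : ℝ) / (r ^ M * Pz α N / Real.Gamma M) * 
      ((Pz α N * E) / ((N.factorial / (n.factorial * (N - n).factorial)) * (a⁻¹ * 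
          (Q * Real.Gamma M / (r ^ M * b / r))))) = n.factorial * E * ((a * b) / (Q * r)) := by
    field_simp
  rw [e]
  have : (a * b) / (Q * r) ≤ 1 := by
    rw [div_le_one (by positivity)]
    calc a * b ≤ Q := hQle
      _ ≤ Q * r := le_mul_of_one_le_right hQ0.le hr1
  exact mul_le_of_le_one_right (by positivity) this

lemma total_bound (α : ℝ) (hα : -1 < α) (n p m : ℕ) (r : ℝ) (hr : r = (((n+p+1:ℕ):ℝ) + α) / 4) (hr1 : 1 ≤ r)
    (hk : 2 * m ≤ n + p + 1) (h1 : ((n+p+1:ℕ):ℝ) ≤ ((2*m:ℕ)+1)*√((2*m:ℕ)+1)) 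
    (h2 : ((2*m:ℕ):ℝ)^3 ≤ 64*((n+p+1:ℕ):ℝ)^2) :
    ∫⁻ t : Fin n → ℝ, (ENNReal.ofReal ((((n+p+1).factorial : ℝ) / ((n+p+1 - n).factorial : ℝ)) / ftlueZ α (n+p+1) r) *
      ∫⁻ y : Fin p → ℝ, Fd α n (2*m) (n+p+1) (sv (Fin.append t y) (r - ∑ i, Fin.append t y i))) ≤ 
     ENNReal.ofReal (n.factorial * Real.exp ((2+|α|)*Real.exp (α+9))) := by
  have hr0 : 0 < r := by linarith
  have hZ := ftlueZ_pos α hα (n+p+1) (by omega) r hr0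
  have hNp : (0:ℝ) < ((n+p+1:ℕ):ℝ) := by exact_mod_cast Nat.succ_pos _
  rw [lintegral_const_mul' _ _ ENNReal.ofReal_ne_top]
  rw [← lint_append (fun x => Fd α n (2*m) (n+p+1) (sv x (r - ∑ i, x i)))]
  · have hX := X_bound α hα (n+p) n m (by omega) r hr0 hk h1 h2 (mul_pos hNp (by linarith))
    refine (mul_le_mul_right hX _).trans ?_
    rw [← ENNReal.ofReal_mul (by positivity)]
    exact ENNReal.ofReal_le_ofReal (pref_bound α hα (n+p+1) n (2*m) (by omega) (by omega) r _ (Real.exp_pos _) hr hr1)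
  · exact (measurable_Fd _ _ _ _).comp (measurable_sv.comp (f := fun x : Fin (n+p) → ℝ => (x, r - ∑ i, x i)) (by fun_prop))

lemma choice_m (N : ℕ) (hN : 64 ≤ N) : ∃ m : ℕ, 2 * m ≤ N ∧ (N:ℝ) ≤ ((2*m:ℕ)+1)*√((2*m:ℕ)+1) ∧
    ((2*m:ℕ):ℝ)^3 ≤ 64*(N:ℝ)^2 ∧ ((2*m:ℕ):ℝ) ≤ 4 * (2 * (N:ℝ)) ^ ((2:ℝ)/3) := by
  have hNr : (64:ℝ) ≤ N := by exact_mod_cast hN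
  have hN0 : (0:ℝ) < N := by linarith
  set x : ℝ := (N:ℝ) ^ ((2:ℝ)/3) with hx
  have hx3 : x ^ 3 = (N:ℝ) ^ 2 := by
    rw [hx, ← Real.rpow_natCast, ← Real.rpow_mul hN0.le, ← Real.rpow_natCast]; norm_num
  have hx1 : 1 ≤ x := Real.one_le_rpow (by linarith) (by norm_num)
  have hxL : x ≤ (2 * (N:ℝ)) ^ ((2:ℝ)/3) := Real.rpow_le_rpow hN0.le (by linarith) (by norm_num)
  refine ⟨⌈x⌉₊, ?_⟩
  have hm1 : x ≤ ⌈x⌉₊ := Nat.le_ceil x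
  have hm2 : (⌈x⌉₊ : ℝ) < x + 1 := Nat.ceil_lt_add_one (by linarith)
  set m := ⌈x⌉₊
  have hk : ((2*m:ℕ):ℝ) ≤ 4 * x := by push_cast; linarith
  have hk1 : x ≤ ((2*m:ℕ):ℝ) + 1 := by push_cast; linarith
  have hcube : (4 * x) ^ 3 = 64 * (N:ℝ)^2 := by rw [mul_pow, hx3]; norm_num
  refine ⟨?_, ?_, ?_, ?_⟩
  · have : 4 * x ≤ N := by
      apply le_of_pow_le_pow_left₀ (n := 3) (by norm_num) hN0.le
      rw [hcube]
      calc 64 * (N:ℝ)^2 ≤ N * (N:ℝ)^2 := by gcongr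
        _ = _ := by ring
    exact_mod_cast hk.trans this
  · apply le_of_pow_le_pow_left₀ (n := 2) (by norm_num) (by positivity)
    rw [mul_pow, Real.sq_sqrt (by positivity), ← hx3]
    calc x ^ 3 ≤ (((2*m:ℕ):ℝ) + 1) ^ 3 := by gcongr
      _ = _ := by ring
  · rw [← hcube]; gcongr
  · linarith

lemma exp_low (δ : ℝ) (h0 : 0 ≤ δ) (h : δ ≤ 1/2) : Real.exp (-(2*δ)) ≤ 1 - δ := by
  have h1 := Real.add_one_le_exp (2*δ)
  have h2 : Real.exp (-(2*δ)) * Real.exp (2*δ) = 1 := by rw [← Real.exp_add]; simp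
  have h3 := Real.exp_pos (-(2*δ))
  have h4 : 1 ≤ (1 - δ) * Real.exp (2*δ) := by nlinarith
  have h5 := Real.exp_pos (2*δ)
  by_contra hh
  push Not at hh
  nlinarith

/-- uniform integral bound for the rescaled fixed trace LUE correlation
function at the soft edge, over a ball of radius `R`. -/
theorem ftlue_soft_edge_bound (α : ℝ) (hα : -1 < α) (n : ℕ) (hn : 1 ≤ n)
    (R : ℝ) (hR : 0 < R) :
    ∃ C : ℝ, ∃ N₀ : ℕ, ∀ N : ℕ, max N₀ (n + 1) ≤ N →
      (∫ y in Metric.closedBall (0 : EuclideanSpace ℝ (Fin n)) R,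
          ftlueR α N n (((N : ℝ) + α) / 4)
            (fun i => 1 + y i / (2 * (N : ℝ)) ^ ((2 : ℝ) / 3))) /
        ((2 * (N : ℝ)) ^ ((2 : ℝ) / 3)) ^ n ≤ C := by
  refine ⟨Real.exp (8 * R) ^ n * (n.factorial * Real.exp ((2+|α|)*Real.exp (α+9))), 
    max 64 ⌈(1 + 2 * R) ^ 2⌉₊, ?_⟩
  intro N hN
  have hN64 : 64 ≤ N := le_trans (le_max_left _ _) (le_trans (le_max_left _ _) hN)
  have hNR : (1 + 2 * R) ^ 2 ≤ (N:ℝ) := (Nat.le_ceil _).trans (by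
    exact_mod_cast le_trans (le_max_right _ _) (le_trans (le_max_left _ _) hN))
  have hNn : n + 1 ≤ N := le_trans (le_max_right _ _) hN
  obtain ⟨m, hk, h1, h2, h3⟩ := choice_m N hN64
  have hN64r : (64:ℝ) ≤ N := by exact_mod_cast hN64
  set L : ℝ := (2 * (N : ℝ)) ^ ((2 : ℝ) / 3) with hL
  have hL0 : 0 < L := by positivity
  have hL3 : L ^ 3 = 4 * (N:ℝ) ^ 2 := by
    rw [hL, ← Real.rpow_natCast, ← Real.rpow_mul (by positivity)]
    norm_num; ring
  have hLR : 2 * R ≤ L := by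
    apply le_of_pow_le_pow_left₀ (n := 3) (by norm_num) hL0.le
    rw [hL3]
    calc (2 * R) ^ 3 ≤ (1 + 2 * R) ^ 3 := by gcongr; linarith
      _ ≤ (1 + 2 * R) ^ 4 := pow_le_pow_right₀ (by linarith) (by norm_num)
      _ = ((1 + 2 * R) ^ 2) ^ 2 := by ring
      _ ≤ (N:ℝ) ^ 2 := by gcongr
      _ ≤ 4 * (N:ℝ) ^ 2 := by nlinarith
  obtain ⟨p, rfl⟩ : ∃ p, N = n + p + 1 := ⟨N - n - 1, by omega⟩
  set r : ℝ := (((n + p + 1 : ℕ) : ℝ) + α) / 4 with hr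
  have hr1 : 1 ≤ r := by rw [hr]; linarith
  have hr0 : 0 < r := by linarith
  set G : (Fin n → ℝ) → ENNReal := fun t => 
    ENNReal.ofReal ((((n+p+1).factorial : ℝ) / ((n+p+1 - n).factorial : ℝ)) / ftlueZ α (n+p+1) r) *
      ∫⁻ y : Fin p → ℝ, Fd α n (2*m) (n+p+1) (sv (Fin.append t y) (r - ∑ i, Fin.append t y i)) with hG
  have hGb : ∫⁻ t, G t ≤ _ := total_bound α hα n p m r hr hr1 hk h1 h2
  set κ : ℝ := Real.exp (8 * R) ^ n with hκ
  have hκ0 : 0 < κ := by positivity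
  set E : ℝ := n.factorial * Real.exp ((2+|α|)*Real.exp (α+9)) with hE
  have hE0 : 0 ≤ E := by positivity
  have hpt : ∀ y ∈ Metric.closedBall (0 : EuclideanSpace ℝ (Fin n)) R,
      ‖ftlueR α (n+p+1) n r (fun i => 1 + y i / L)‖ₑ ≤ ENNReal.ofReal κ * G (fun i => 1 + y i / L) := by
    intro y hy
    have hy' : ‖y‖ ≤ R := by simpa using hy
    have hlow : ∀ i, Real.exp (-(8 * R)) ≤ (1 + y i / L) ^ (2 * m) := by
      intro i
      have hi : |y i| ≤ R := (PiLp.norm_apply_le y i).trans hy'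
      have hδ : R / L ≤ 1 / 2 := by rw [div_le_div_iff₀ hL0 (by norm_num)]; linarith
      have hyl : -(R / L) ≤ y i / L := by
        rw [← neg_div]; gcongr; linarith [neg_abs_le (y i)]
      have he := exp_low (R / L) (by positivity) hδ
      calc Real.exp (-(8 * R)) ≤ Real.exp (-(2 * (R / L))) ^ (2 * m) := by
            rw [← Real.exp_nat_mul]
            apply Real.exp_le_exp.2
            have : ((2*m:ℕ):ℝ) * (R / L) ≤ (4 * L) * (R / L) := by gcongr
            have e4 : (4 * L) * (R / L) = 4 * R := by field_simp
            linarith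
        _ ≤ _ := by gcongr; linarith
    have hprod : 1 ≤ κ * ∏ i, (1 + y i / L) ^ (2 * m) := by
      have h := Finset.prod_le_prod (s := (univ : Finset (Fin n))) (f := fun _ => Real.exp (-(8 * R))) 
        (g := fun i => (1 + y i / L) ^ (2 * m)) (fun i _ => (Real.exp_pos _).le) (fun i _ => hlow i)
      rw [Finset.prod_const, Finset.card_univ, Fintype.card_fin] at h
      calc (1:ℝ) = κ * Real.exp (-(8*R)) ^ n := by
            rw [hκ, ← mul_pow, ← Real.exp_add]; simp
        _ ≤ _ := by gcongr
    calc ‖ftlueR α (n+p+1) n r (fun i => 1 + y i / L)‖ₑ 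
        ≤ ‖ftlueR α (n+p+1) n r (fun i => 1 + y i / L)‖ₑ * ENNReal.ofReal (κ * ∏ i, (1 + y i / L) ^ (2 * m)) := 
          le_mul_of_one_le_right zero_le (by rwa [ENNReal.one_le_ofReal])
      _ = ENNReal.ofReal κ * (‖ftlueR α (n+p+1) n r (fun i => 1 + y i / L)‖ₑ * 
            ENNReal.ofReal (∏ i, (1 + y i / L) ^ (2 * m))) := by
          rw [ENNReal.ofReal_mul hκ0.le]; ring
      _ ≤ _ := mul_le_mul_right (ftlueR_le α hα n p (2*m) r hr0 _) _
  rw [div_le_iff₀ (by positivity)]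
  have hfin : ‖∫ y in Metric.closedBall (0 : EuclideanSpace ℝ (Fin n)) R,
      ftlueR α (n+p+1) n r (fun i => 1 + y i / L)‖ₑ ≤ ENNReal.ofReal (κ * E * L ^ n) := by
    calc _ ≤ ∫⁻ y in Metric.closedBall (0 : EuclideanSpace ℝ (Fin n)) R, 
          ‖ftlueR α (n+p+1) n r (fun i => 1 + y i / L)‖ₑ := enorm_integral_le_lintegral_enorm _
      _ ≤ ∫⁻ y in Metric.closedBall (0 : EuclideanSpace ℝ (Fin n)) R, 
          ENNReal.ofReal κ * G (fun i => 1 + y i / L) := 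
          setLIntegral_mono' Metric.isClosed_closedBall.measurableSet hpt
      _ ≤ ∫⁻ y : EuclideanSpace ℝ (Fin n), ENNReal.ofReal κ * G (fun i => 1 + y i / L) := 
          setLIntegral_le_lintegral _ _
      _ = ENNReal.ofReal κ * (ENNReal.ofReal (L ^ n) * ∫⁻ t, G t) := by
          rw [lintegral_const_mul' _ _ ENNReal.ofReal_ne_top, rescale n L hL0 G]
      _ ≤ ENNReal.ofReal κ * (ENNReal.ofReal (L ^ n) * ENNReal.ofReal E) := by gcongr
      _ = _ := by
          rw [← ENNReal.ofReal_mul (by positivity), ← ENNReal.ofReal_mul (by positivity)]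
          congr 1; ring
  rw [← ofReal_norm, ENNReal.ofReal_le_ofReal_iff (by positivity)] at hfin
  exact (le_abs_self _).trans hfin

end RMT
end
end

section
/- Fix a real α > −1 and let f : ℝ → ℝ be bounded and Lipschitz continuous. Then lim_{N→∞} ∫₀^∞ f(x) · (1/N) · R₁^{θ,(N+α)/4}(x) dx = ∫₀¹ f(x)·ψ(x) dx. (The limiting global eigenvalue density of the bounded trace Laguerre unitary ensemble is the Marchenko–Pastur law.) -/
open MeasureTheory Filter Topology Finset
open scoped Real Classical

noncomputable section

namespace RMT

/-- The Laguerre weight on the half line. -/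
def wt (α : ℝ) (x : ℝ) : ℝ := if 0 ≤ x then x ^ α * Real.exp (-x) else 0

lemma wt_nonneg (α x : ℝ) : 0 ≤ wt α x := by
  unfold wt; split_ifs with h
  · positivity
  · exact le_rfl

lemma wt_meas (α : ℝ) : Measurable (wt α) := by
  unfold wt
  exact Measurable.ite measurableSet_Ici (by fun_prop) measurable_const

lemma wt_indicator (α : ℝ) (n : ℕ) :
    (fun x : ℝ => x ^ n * wt α x) =
      (Set.Ici (0:ℝ)).indicator (fun x => x ^ n * (x ^ α * Real.exp (-x))) := by
  funext x
  by_cases h : 0 ≤ x <;> simp [wt, Set.indicator, h]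

lemma wt_congr (α : ℝ) (n : ℕ) (x : ℝ) (hx : x ∈ Set.Ioi (0:ℝ)) :
    Real.exp (-x) * x ^ ((α + n + 1) - 1) = x ^ n * (x ^ α * Real.exp (-x)) := by
  have hx' : 0 < x := hx
  have : α + n + 1 - 1 = α + n := by ring
  rw [this, Real.rpow_add hx', Real.rpow_natCast]; ring

lemma wt_pow_integrable (α : ℝ) (hα : -1 < α) (n : ℕ) :
    Integrable (fun x : ℝ => x ^ n * wt α x) := by
  rw [wt_indicator, integrable_indicator_iff measurableSet_Ici, integrableOn_Ici_iff_integrableOn_Ioi]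
  have h := Real.GammaIntegral_convergent (s := α + n + 1) (by have : (0:ℝ) ≤ n := n.cast_nonneg; linarith)
  exact h.congr_fun (wt_congr α n) measurableSet_Ioi

lemma wt_pow_integral (α : ℝ) (hα : -1 < α) (n : ℕ) :
    ∫ x : ℝ, x ^ n * wt α x = Real.Gamma (α + n + 1) := by
  rw [wt_indicator, integral_indicator measurableSet_Ici, integral_Ici_eq_integral_Ioi,
    Real.Gamma_eq_integral (by have : (0:ℝ) ≤ n := n.cast_nonneg; linarith)]
  exact (setIntegral_congr_fun measurableSet_Ioi (wt_congr α n)).symm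

open Polynomial in
lemma wt_poly_integrable (α : ℝ) (hα : -1 < α) (q : ℝ[X]) :
    Integrable (fun x : ℝ => q.eval x * wt α x) := by
  induction q using Polynomial.induction_on' with
  | add p q hp hq => exact (hp.add hq).congr (ae_of_all _ fun x => by simp [add_mul])
  | monomial n a =>
    simpa [mul_assoc] using (wt_pow_integrable α hα n).const_mul a

open Polynomial in
/-- The Laguerre functional. -/
def Lf (α : ℝ) (q : ℝ[X]) : ℝ := ∫ x : ℝ, q.eval x * wt α x

open Polynomial in
lemma Lf_add (α : ℝ) (hα : -1 < α) (p q : ℝ[X]) : Lf α (p + q) = Lf α p + Lf α q := by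
  unfold Lf
  rw [← integral_add (wt_poly_integrable α hα p) (wt_poly_integrable α hα q)]
  simp [add_mul]

open Polynomial in
lemma Lf_C_mul (α : ℝ) (c : ℝ) (q : ℝ[X]) : Lf α (C c * q) = c * Lf α q := by
  unfold Lf
  rw [← integral_const_mul]
  simp [mul_assoc]

open Polynomial in
lemma Lf_by_parts (α : ℝ) (hα : -1 < α) (q : ℝ[X]) :
    Lf α (X * derivative q) = Lf α (X * q) - (α + 1) * Lf α q := by
  induction q using Polynomial.induction_on' with
  | add p q hp hq => 
    rw [derivative_add, mul_add, mul_add, Lf_add α hα, Lf_add α hα, Lf_add α hα, hp, hq]; ring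
  | monomial n a =>
    have h1 : Lf α (monomial n a) = a * Real.Gamma (α + n + 1) := by
      rw [← wt_pow_integral α hα, ← integral_const_mul]; simp [Lf, mul_assoc]
    have h2 : Lf α (X * monomial n a) = a * Real.Gamma (α + (n + 1 : ℕ) + 1) := by
      rw [← wt_pow_integral α hα, ← integral_const_mul]; unfold Lf; congr 1; ext x; simp; ring
    have h3 : X * derivative (monomial n a) = C (n:ℝ) * monomial n a := by
      rw [derivative_monomial]
      rcases n with _ | n
      · simp
      · rw [X_mul_monomial, C_mul_monomial]; simp [mul_comm]
    rw [h3, Lf_C_mul, h1, h2]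
    have : α + (n + 1 : ℕ) + 1 = (α + n + 1) + 1 := by push_cast; ring
    rw [this, Real.Gamma_add_one (s := α + n + 1) (by have : (0:ℝ) ≤ n := n.cast_nonneg; linarith)]
    ring

open Polynomial in
/-- Sign-normalised Laguerre polynomials `(-1)^k L_k^{(α)}`. -/
def Q (α : ℝ) : ℕ → ℝ[X]
  | 0 => 1
  | 1 => X - C (1 + α)
  | (k + 2) => C (((k : ℝ) + 2)⁻¹) *
      ((X - C (2 * (k:ℝ) + 3 + α)) * Q α (k + 1) - C ((k:ℝ) + 1 + α) * Q α k)

open Polynomial in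
lemma Q_rec (α : ℝ) (k : ℕ) :
    X * Q α (k + 1) = C ((k:ℝ) + 2) * Q α (k + 2) + C (2 * (k:ℝ) + 3 + α) * Q α (k + 1)
      + C ((k:ℝ) + 1 + α) * Q α k := by
  rw [Q, ← mul_assoc, ← C_mul, mul_inv_cancel₀ (by positivity)]
  simp only [C_1]; ring

open Polynomial in
lemma Q_rec0 (α : ℝ) : X * Q α 0 = Q α 1 + C (1 + α) * Q α 0 := by
  simp [Q]

open Polynomial in
lemma Q_deriv (α : ℝ) (k : ℕ) :
    X * derivative (Q α (k + 1)) = C ((k:ℝ) + 1) * Q α (k + 1) + C ((k:ℝ) + 1 + α) * Q α k := by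
  suffices h : ∀ k : ℕ, 
    X * derivative (Q α (k + 1)) = C ((k:ℝ) + 1) * Q α (k + 1) + C ((k:ℝ) + 1 + α) * Q α k ∧ 
    X * derivative (Q α (k + 2)) = C ((k:ℝ) + 2) * Q α (k + 2) + C ((k:ℝ) + 2 + α) * Q α (k + 1)
    from (h k).1
  clear k
  have key : ∀ k : ℕ, C ((k:ℝ) + 2) * (X * derivative (Q α (k+2))) = 
      X * Q α (k+1) + (X - C (2 * (k:ℝ) + 3 + α)) * (X * derivative (Q α (k+1)))
       - C ((k:ℝ) + 1 + α) * (X * derivative (Q α k)) := by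
    intro k
    have := congrArg derivative (Q_rec α k)
    simp only [derivative_mul, derivative_add, derivative_X, derivative_C] at this
    linear_combination X * (-this)
  have canc : ∀ (k : ℕ) (a b : ℝ[X]), C ((k:ℝ) + 2) * a = C ((k:ℝ)+2) * b → a = b := by
    intro k a b h
    exact mul_left_cancel₀ (by rw [Ne, C_eq_zero]; positivity) h
  intro k
  induction k with
  | zero =>
    have h1 : X * derivative (Q α 1) = C (((0:ℕ):ℝ) + 1) * Q α 1 + C (((0:ℕ):ℝ) + 1 + α) * Q α 0 := by
      simp [Q]
    refine ⟨h1, canc 0 _ _ ?_⟩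
    rw [key, h1]
    have h0 : derivative (Q α 0) = 0 := by simp [Q]
    have r := Q_rec α 0
    have r0 : Q α 1 = X - C (1 + α) := by simp [Q]
    have r1 : Q α 0 = 1 := by simp [Q]
    rw [h0]
    simp only [r0, r1, Nat.cast_zero, zero_add, C_add, C_mul, C_1, C_ofNat, C_0] at r ⊢
    linear_combination 2 * r
  | succ k ih =>
    obtain ⟨i1, i2⟩ := ih
    push_cast
    have e1 : (k:ℝ) + 1 + 1 = k + 2 := by ring
    have e2 : (k:ℝ) + 1 + 2 = k + 3 := by ring
    refine ⟨by rw [e1]; exact i2, canc (k+1) _ _ ?_⟩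
    rw [key, i1]
    have i2' : X * derivative (Q α (k + 1 + 1)) = _ := i2
    rw [i2']
    have r := Q_rec α k
    have r' := Q_rec α (k + 1)
    push_cast at r r' ⊢
    simp only [C_add, C_mul, C_1, C_ofNat] at r r' ⊢
    linear_combination (C (k:ℝ) + 3) * r' + (C (k:ℝ) + 2 + C α) * r

open Polynomial in
lemma Lf_sub (α : ℝ) (hα : -1 < α) (p q : ℝ[X]) : Lf α (p - q) = Lf α p - Lf α q := by
  have := Lf_add α hα (p - q) q
  rw [sub_add_cancel] at this
  linarith

lemma Lf_Q (α : ℝ) (hα : -1 < α) (k : ℕ) : Lf α (Q α (k + 1)) = 0 := by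
  induction k with
  | zero =>
    have h := Lf_by_parts α hα (Q α 0)
    rw [Q_rec0, Lf_add α hα, Lf_C_mul] at h
    have h0 : Polynomial.derivative (Q α 0) = 0 := by simp [Q]
    rw [h0, mul_zero] at h
    have : Lf α 0 = 0 := by simp [Lf]
    rw [this] at h
    rw [zero_add]; linarith
  | succ k ih =>
    have h := Lf_by_parts α hα (Q α (k+1))
    rw [Q_deriv, Q_rec, Lf_add α hα, Lf_add α hα, Lf_add α hα] at h
    simp only [Lf_C_mul, ih] at h
    have : ((k:ℝ) + 2) * Lf α (Q α (k+2)) = 0 := by linarith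
    rcases mul_eq_zero.1 this with h' | h'
    · have : (0:ℝ) ≤ k := k.cast_nonneg
      linarith
    · exact h'

/-- Inner products with powers. -/
def Ip (α : ℝ) (p i j : ℕ) : ℝ := Lf α (Polynomial.X ^ p * Q α i * Q α j)

lemma Ip_comm (α : ℝ) (p i j : ℕ) : Ip α p i j = Ip α p j i := by
  unfold Ip; congr 1; ring

open Polynomial in
lemma Ip_succ (α : ℝ) (hα : -1 < α) (p i j : ℕ) :
    Ip α (p + 1) (i + 1) j = ((i:ℝ) + 2) * Ip α p (i + 2) j
      + (2 * (i:ℝ) + 3 + α) * Ip α p (i + 1) j + ((i:ℝ) + 1 + α) * Ip α p i j := by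
  unfold Ip
  rw [← Lf_C_mul, ← Lf_C_mul, ← Lf_C_mul, ← Lf_add α hα, ← Lf_add α hα]
  congr 1
  linear_combination X ^ p * Q α j * Q_rec α i

open Polynomial in
lemma Ip_succ0 (α : ℝ) (hα : -1 < α) (p j : ℕ) :
    Ip α (p + 1) 0 j = Ip α p 1 j + (1 + α) * Ip α p 0 j := by
  unfold Ip
  rw [← Lf_C_mul, ← Lf_add α hα]
  congr 1
  linear_combination X ^ p * Q α j * Q_rec0 α

lemma Ip_zero_lt (α : ℝ) (hα : -1 < α) (j : ℕ) : ∀ i, j < i → Ip α 0 i j = 0 := by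
  induction j using Nat.strong_induction_on with
  | _ j ih =>
    intro i hij
    obtain ⟨i, rfl⟩ : ∃ i', i = i' + 1 := ⟨i - 1, by omega⟩
    rcases j with _ | _ | j
    · have := Lf_Q α hα i
      simpa [Ip, Q] using this
    · -- j = 1
      have h1 := Ip_succ α hα 0 i 0
      have h2 := Ip_succ0 α hα 0 (i+1)
      rw [Ip_comm] at h1
      rw [h1, Ip_comm α 0 1, Ip_comm α 0 0] at h2
      rw [ih 0 (by omega) (i+2) (by omega), ih 0 (by omega) (i+1) (by omega), ih 0 (by omega) i (by omega)] at h2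
      linarith
    · have h1 := Ip_succ α hα 0 i (j+1)
      have h2 := Ip_succ α hα 0 j (i+1)
      rw [Ip_comm] at h1
      rw [h1, Ip_comm α 0 (j+2), Ip_comm α 0 (j+1), Ip_comm α 0 j] at h2
      rw [ih (j+1) (by omega) (i+2) (by omega), ih (j+1) (by omega) (i+1) (by omega), ih (j+1) (by omega) i (by omega), ih j (by omega) (i+1) (by omega)] at h2
      have : ((j:ℝ) + 2) * Ip α 0 (i+1) (j+2) = 0 := by linarith
      rcases mul_eq_zero.1 this with h' | h'
      · have : (0:ℝ) ≤ j := j.cast_nonneg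
        linarith
      · exact h'

lemma Ip_zero_ne (α : ℝ) (hα : -1 < α) (i j : ℕ) (h : i ≠ j) : Ip α 0 i j = 0 := by
  rcases lt_or_gt_of_ne h with h | h
  · rw [Ip_comm]; exact Ip_zero_lt α hα _ _ h
  · exact Ip_zero_lt α hα _ _ h

lemma Ip_zero_pos (α : ℝ) (hα : -1 < α) (i : ℕ) : 0 < Ip α 0 i i := by
  induction i with
  | zero =>
    have := wt_pow_integral α hα 0
    simp only [pow_zero, one_mul] at this
    simp only [Ip, Q, Lf]
    simp only [pow_zero, mul_one, Polynomial.eval_one, one_mul, this]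
    exact Real.Gamma_pos_of_pos (by push_cast; linarith)
  | succ i ih =>
    rcases i with _ | i
    · have h1 := Ip_succ α hα 0 0 0
      have h2 := Ip_succ0 α hα 0 1
      rw [Ip_comm] at h1
      rw [h1, Ip_zero_ne α hα 2 0 (by omega), Ip_zero_ne α hα (0+1) 0 (by omega), Ip_zero_ne α hα 0 1 (by omega)] at h2
      push_cast at h2
      have : 0 < (1 + α) * Ip α 0 0 0 := mul_pos (by linarith) ih
      rw [zero_add]
      linarith
    · have h1 := Ip_succ α hα 0 (i+1) (i+1)
      have h2 := Ip_succ α hα 0 i (i+1+1)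
      rw [Ip_comm] at h1
      rw [h1, Ip_zero_ne α hα (i+1+2) _ (by omega), Ip_zero_ne α hα (i+1+1) (i+1) (by omega), Ip_zero_ne α hα (i+1) (i+1+1) (by omega), Ip_zero_ne α hα i _ (by omega)] at h2
      push_cast at h2
      have hi : (0:ℝ) ≤ i := i.cast_nonneg
      have h3 : 0 < ((i:ℝ) + 1 + 1 + α) * Ip α 0 (i+1) (i+1) := mul_pos (by linarith) ih
      have h4 : 0 < ((i:ℝ) + 2) * Ip α 0 (i+1+1) (i+1+1) := by 
        have : Ip α 0 (i+2) (i+1+1) = Ip α 0 (i+1+1) (i+1+1) := rfl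
        rw [this] at h2
        linarith
      exact pos_of_mul_pos_right h4 (by linarith)

/-- Binomial coefficients with integer lower index. -/
def cz (n : ℕ) (m : ℤ) : ℝ := if m < 0 then 0 else (n.choose m.toNat : ℝ)

lemma cz_pascal (n : ℕ) (m : ℤ) : cz (n + 1) m = cz n (m - 1) + cz n m := by
  unfold cz
  rcases lt_trichotomy m 0 with h | h | h
  · simp [h, show m - 1 < 0 by omega]
  · subst h; simp
  · obtain ⟨k, rfl⟩ : ∃ k : ℕ, m = k + 1 := ⟨(m - 1).toNat, by omega⟩
    have h1 : ((k:ℤ) + 1).toNat = k + 1 := by omega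
    have h2 : ((k:ℤ) + 1 - 1).toNat = k := by omega
    rw [if_neg (by omega), if_neg (by omega), if_neg (by omega), h1, h2, Nat.choose_succ_succ]
    push_cast; ring

lemma cz_step (p : ℕ) (d : ℤ) :
    cz (2 * (p + 1)) ((p + 1 : ℕ) + d) =
      cz (2 * p) (p + (d + 1)) + 2 * cz (2 * p) (p + d) + cz (2 * p) (p + (d - 1)) := by
  rw [show 2 * (p + 1) = 2 * p + 1 + 1 by ring, cz_pascal, cz_pascal, cz_pascal]
  push_cast
  rw [show (p:ℤ) + 1 + d - 1 - 1 = p + (d - 1) by ring, show (p:ℤ) + 1 + d - 1 = p + d by ring,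
    show (p:ℤ) + 1 + d = p + (d + 1) by ring]
  ring

/-- Normalised matrix element. -/
def up (α : ℝ) (p : ℕ) (d : ℤ) (k : ℕ) : ℝ := Ip α p ((k:ℤ) + d).toNat k / Ip α 0 k k

lemma tendsto_lin (a c : ℝ) : Tendsto (fun k : ℕ => (a * (k:ℝ) + c) / k) atTop (𝓝 a) := by
  have h1 : Tendsto (fun k : ℕ => a + c / (k:ℝ)) atTop (𝓝 (a + 0)) :=
    tendsto_const_nhds.add (tendsto_const_div_atTop_nhds_zero_nat c)
  rw [add_zero] at h1
  refine h1.congr' ?_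
  filter_upwards [eventually_gt_atTop 0] with k hk
  have : (k:ℝ) ≠ 0 := by positivity
  field_simp

lemma up_rec (α : ℝ) (hα : -1 < α) (p : ℕ) (d : ℤ) (k : ℕ) (hk : 1 ≤ (k:ℤ) + d) :
    up α (p + 1) d k = ((k:ℝ) + d + 1) * up α p (d + 1) k + (2 * ((k:ℝ) + d) + 1 + α) * up α p d k
      + ((k:ℝ) + d + α) * up α p (d - 1) k := by
  obtain ⟨i, hi⟩ : ∃ i : ℕ, (k:ℤ) + d = i + 1 := ⟨((k:ℤ) + d - 1).toNat, by omega⟩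
  have hr : (k:ℝ) + d = i + 1 := by exact_mod_cast hi
  unfold up
  rw [show ((k:ℤ) + d).toNat = i + 1 by omega, show ((k:ℤ) + (d + 1)).toNat = i + 2 by omega,
    show ((k:ℤ) + (d - 1)).toNat = i by omega, Ip_succ α hα, hr]
  ring

lemma up_tendsto (α : ℝ) (hα : -1 < α) (p : ℕ) : ∀ d : ℤ,
    Tendsto (fun k : ℕ => up α p d k / (k:ℝ) ^ p) atTop (𝓝 (cz (2 * p) (p + d))) := by
  induction p with
  | zero =>
    intro d
    refine tendsto_const_nhds.congr' ?_
    filter_upwards [eventually_gt_atTop d.natAbs] with k hk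
    unfold up
    by_cases hd : d = 0
    · subst hd
      have := (Ip_zero_pos α hα k).ne'
      simp [cz, this]
    · rw [Ip_zero_ne α hα _ _ (by omega)]
      unfold cz
      rcases lt_or_gt_of_ne hd with h | h
      · simp [h]
      · simp [h.not_gt, Nat.choose_eq_zero_of_lt (show 0 < d.toNat by omega)]
  | succ p ih =>
    intro d
    have h1 := (tendsto_lin 1 ((d:ℝ) + 1)).mul (ih (d + 1))
    have h2 := (tendsto_lin 2 (2 * (d:ℝ) + 1 + α)).mul (ih d)
    have h3 := (tendsto_lin 1 ((d:ℝ) + α)).mul (ih (d - 1))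
    have h := (h1.add h2).add h3
    rw [cz_step]
    simp only [one_mul] at h
    refine h.congr' ?_
    filter_upwards [eventually_gt_atTop d.natAbs] with k hk
    rw [up_rec α hα p d k (by omega)]
    have : (k:ℝ) ≠ 0 := by
      have : 0 < k := by omega
      positivity
    field_simp
    ring

lemma diag_tendsto (α : ℝ) (hα : -1 < α) (p : ℕ) :
    Tendsto (fun k : ℕ => (Ip α p k k / Ip α 0 k k) / (k:ℝ) ^ p) atTop (𝓝 (p.centralBinom : ℝ)) := by
  have := up_tendsto α hα p 0
  have h : cz (2 * p) (p + 0) = (p.centralBinom : ℝ) := by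
    rw [cz, if_neg (by omega)]; simp [Nat.centralBinom]
  rw [h] at this
  simpa [up] using this

/-- Telescoping comparison sequence. -/
def vk (p k : ℕ) : ℝ := ((k:ℝ) + 1) ^ (p + 1) - (k:ℝ) ^ (p + 1)

lemma vk_sum (p N : ℕ) : ∑ k ∈ range N, vk p k = (N:ℝ) ^ (p + 1) := by
  induction N with
  | zero => simp
  | succ N ih => rw [sum_range_succ, ih, vk]; push_cast; ring

lemma vk_tendsto (p : ℕ) : Tendsto (fun k : ℕ => vk p k / (k:ℝ) ^ p) atTop (𝓝 ((p:ℝ) + 1)) := by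
  induction p with
  | zero =>
    refine tendsto_const_nhds.congr fun k => ?_
    simp [vk]
  | succ p ih =>
    have h1 : Tendsto (fun k : ℕ => (((1:ℝ) * k + 1) / k)) atTop (𝓝 1) := tendsto_lin 1 1
    have h := (h1.mul ih).add_const 1
    have e : ((p + 1 : ℕ) : ℝ) + 1 = 1 * ((p:ℝ) + 1) + 1 := by push_cast; ring
    rw [e]
    refine h.congr' ?_
    filter_upwards [eventually_gt_atTop 0] with k hk
    have : (k:ℝ) ≠ 0 := by positivity
    unfold vk
    field_simp
    ring

lemma cesaro (u : ℕ → ℝ) (p : ℕ) (c : ℝ)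
    (h : Tendsto (fun k : ℕ => u k / (k:ℝ) ^ p) atTop (𝓝 c)) :
    Tendsto (fun N : ℕ => (∑ k ∈ range N, u k) / (N:ℝ) ^ (p + 1)) atTop (𝓝 (c / ((p:ℝ) + 1))) := by
  have hp : (0:ℝ) < (p:ℝ) + 1 := by positivity
  have hv0 : ∀ k, 0 < vk p k := fun k => by
    unfold vk
    have : (k:ℝ) ^ (p + 1) < ((k:ℝ) + 1) ^ (p + 1) := by gcongr; linarith; 
    linarith
  have hlo : (fun k => u k - c / ((p:ℝ) + 1) * vk p k) =o[atTop] (vk p) := by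
    rw [Asymptotics.isLittleO_iff_tendsto' (Eventually.of_forall fun k hk => absurd hk (hv0 k).ne')]
    have h2 := (h.div (vk_tendsto p) hp.ne').sub_const (c / ((p:ℝ) + 1))
    rw [sub_self] at h2
    refine h2.congr' ?_
    filter_upwards [eventually_gt_atTop 0] with k hk
    have : (k:ℝ) ≠ 0 := by positivity
    have := (hv0 k).ne'
    simp only [Pi.div_apply]
    field_simp
  have hT : Tendsto (fun N => ∑ k ∈ range N, vk p k) atTop atTop := by
    simp_rw [vk_sum]
    exact (tendsto_pow_atTop (by omega)).comp tendsto_natCast_atTop_atTop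
  have h3 := (hlo.sum_range (fun k => (hv0 k).le) hT).tendsto_div_nhds_zero
  simp_rw [sum_sub_distrib, ← mul_sum, vk_sum] at h3
  have h4 := h3.add_const (c / ((p:ℝ) + 1))
  rw [zero_add] at h4
  refine h4.congr' ?_
  filter_upwards [eventually_gt_atTop 0] with k hk
  have : (k:ℝ) ≠ 0 := by positivity
  field_simp
  ring

lemma lue_moment_tendsto (α : ℝ) (hα : -1 < α) (p : ℕ) :
    Tendsto (fun N : ℕ => (∑ k ∈ range N, Ip α p k k / Ip α 0 k k) / (N:ℝ) ^ (p + 1)) atTop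
      (𝓝 ((p.centralBinom : ℝ) / ((p:ℝ) + 1))) :=
  cesaro _ p _ (diag_tendsto α hα p)

lemma gamma_ratio (D : ℝ) (hD : 0 < D) (p : ℕ) :
    Real.Gamma (D + p + 1) = (∏ j ∈ range p, (D + ((j:ℝ) + 1))) * Real.Gamma (D + 1) := by
  induction p with
  | zero => simp
  | succ p ih =>
    rw [prod_range_succ]
    push_cast
    rw [show D + ((p:ℝ) + 1) + 1 = (D + p + 1) + 1 by ring, Real.Gamma_add_one (by positivity), ih]
    ring

lemma D_atTop (α : ℝ) : Tendsto (fun N : ℕ => (N:ℝ) * ((N:ℝ) + α)) atTop atTop :=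
  tendsto_natCast_atTop_atTop.atTop_mul_atTop₀ (tendsto_atTop_add_const_right _ _ tendsto_natCast_atTop_atTop)

lemma factor_tendsto (p : ℕ) :
    Tendsto (fun D : ℝ => D ^ p / (∏ j ∈ range p, (D + ((j:ℝ) + 1)))) atTop (𝓝 1) := by
  have : ∀ j : ℕ, Tendsto (fun D : ℝ => D / (D + ((j:ℝ) + 1))) atTop (𝓝 1) := by
    intro j
    have h : Tendsto (fun D : ℝ => 1 - ((j:ℝ) + 1) / (D + ((j:ℝ) + 1))) atTop (𝓝 (1 - 0)) :=
      tendsto_const_nhds.sub ((tendsto_atTop_add_const_right _ _ tendsto_id).const_div_atTop _)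
    rw [sub_zero] at h
    refine h.congr' ?_
    filter_upwards [eventually_gt_atTop 0] with D hD
    have : D + ((j:ℝ) + 1) ≠ 0 := by positivity
    field_simp
    ring
  have h := tendsto_finsetProd (range p) (fun j _ => this j)
  simp only [prod_const_one, prod_div_distrib, prod_const, card_range] at h
  exact h

lemma bt_moment_tendsto (α : ℝ) (hα : -1 < α) (p : ℕ) :
    Tendsto (fun N : ℕ => (((N:ℝ) + α) / 4) ^ p * Real.Gamma ((N:ℝ) * (N + α) + 1) /
      Real.Gamma ((N:ℝ) * (N + α) + p + 1) * ((∑ k ∈ range N, Ip α p k k / Ip α 0 k k) / N)) atTop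
      (𝓝 ((p.centralBinom : ℝ) / ((p:ℝ) + 1) / 4 ^ p)) := by
  have h := (((factor_tendsto p).comp (D_atTop α)).mul (lue_moment_tendsto α hα p)).div_const (4 ^ p)
  rw [one_mul] at h
  refine h.congr' ?_
  filter_upwards [eventually_gt_atTop 1] with N hN
  have hN1 : (1:ℝ) < N := by exact_mod_cast hN
  have hN' : (0:ℝ) < N := by linarith
  have hNa : 0 < (N:ℝ) + α := by linarith
  have hD : 0 < (N:ℝ) * (N + α) := by positivity
  rw [gamma_ratio _ hD]
  have hg : Real.Gamma ((N:ℝ) * (N + α) + 1) ≠ 0 := (Real.Gamma_pos_of_pos (by linarith)).ne'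
  have hpr : (∏ j ∈ range p, ((N:ℝ) * (N + α) + ((j:ℝ) + 1))) ≠ 0 := by positivity
  simp only [Function.comp]
  rw [mul_pow, div_pow]
  field_simp
  ring

lemma psi_beta (p : ℕ) (x : ℝ) : x ^ p * psiMP x =
    (2 / π * ProbabilityTheory.beta (p + 1/2) (3/2)) *
      ProbabilityTheory.betaPDFReal (p + 1/2) (3/2) x := by
  have hb := (ProbabilityTheory.beta_pos (α := (p:ℝ) + 1/2) (β := 3/2) (by positivity) (by norm_num)).ne'
  unfold psiMP ProbabilityTheory.betaPDFReal
  by_cases h : 0 < x ∧ x < 1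
  · have h0 := h.1
    rw [if_pos ⟨h.1, h.2.le⟩, if_pos h]
    have e1 : (p:ℝ) + 1/2 - 1 = p - 1/2 := by ring
    have e2 : (3:ℝ)/2 - 1 = 1/2 := by norm_num
    rw [e1, e2, Real.rpow_sub h0, Real.rpow_natCast, Real.sqrt_div' _ h0.le, ← Real.sqrt_eq_rpow, ← Real.sqrt_eq_rpow]
    generalize ProbabilityTheory.beta ((p:ℝ) + 1/2) (3/2) = b at hb
    field_simp
  · rw [if_neg h, mul_zero]
    split_ifs with h'
    · have : x = 1 := by
        rcases h'.2.lt_or_eq with h2 | h2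
        · exact absurd ⟨h'.1, h2⟩ h
        · exact h2
      simp [this]
    · simp

lemma beta_val (p : ℕ) : 2 / π * ProbabilityTheory.beta (p + 1/2) (3/2) =
    (p.centralBinom : ℝ) / ((p:ℝ) + 1) / 4 ^ p := by
  unfold ProbabilityTheory.beta
  induction p with
  | zero =>
    have h : Real.Gamma (3/2) = 1/2 * √π := by
      rw [show (3:ℝ)/2 = 1/2 + 1 by norm_num, Real.Gamma_add_one (by norm_num), Real.Gamma_one_half_eq]
    have h2 : Real.Gamma 2 = 1 := Real.Gamma_two
    have hpi : √π * √π = π := Real.mul_self_sqrt Real.pi_pos.le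
    simp only [Nat.cast_zero, zero_add, h, Real.Gamma_one_half_eq]
    rw [show (1:ℝ)/2 + 3/2 = 2 by norm_num, h2]
    have := Real.pi_pos
    simp
    field_simp
    nlinarith
  | succ p ih =>
    have h1 : Real.Gamma ((p + 1 : ℕ) + 1/2) = ((p:ℝ) + 1/2) * Real.Gamma (p + 1/2) := by
      rw [← Real.Gamma_add_one (by positivity)]; congr 1; push_cast; ring
    have h2 : Real.Gamma ((p + 1 : ℕ) + 1/2 + 3/2) = ((p:ℝ) + 2) * Real.Gamma (p + 1/2 + 3/2) := by
      rw [show ((p + 1 : ℕ) + 1/2 + 3/2 : ℝ) = ((p:ℝ) + 1/2 + 3/2) + 1 by push_cast; ring, Real.Gamma_add_one (by positivity)]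
      congr 1; ring
    rw [h1, h2]
    have h3 : ((p:ℝ) + 1) * (p + 1).centralBinom = 2 * (2 * p + 1) * p.centralBinom := by
      exact_mod_cast Nat.succ_mul_centralBinom_succ p
    have h4 : ((p + 1).centralBinom : ℝ) = 2 * (2 * p + 1) * p.centralBinom / ((p:ℝ) + 1) := by
      rw [← h3]; field_simp
    rw [h4]
    have e : 2 / π * (((p:ℝ) + 1/2) * Real.Gamma (p + 1/2) * Real.Gamma (3/2) / (((p:ℝ) + 2) * Real.Gamma (p + 1/2 + 3/2))) = ((p:ℝ) + 1/2) / (p + 2) * (2 / π * (Real.Gamma (p + 1/2) * Real.Gamma (3/2) / Real.Gamma (p + 1/2 + 3/2))) := by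
      rw [mul_assoc ((p:ℝ) + 1/2), mul_div_mul_comm]; ring
    rw [e, ih]
    push_cast
    field_simp
    ring

lemma betaReal_integral (a b : ℝ) (ha : 0 < a) (hb : 0 < b) :
    Integrable (ProbabilityTheory.betaPDFReal a b) ∧ ∫ x, ProbabilityTheory.betaPDFReal a b x = 1 := by
  have hn : ∀ x, 0 ≤ ProbabilityTheory.betaPDFReal a b x := by
    intro x
    by_cases h : 0 < x ∧ x < 1
    · exact (ProbabilityTheory.betaPDFReal_pos h.1 h.2 ha hb).le
    · rw [ProbabilityTheory.betaPDFReal, if_neg h]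
  have h1 : ∫⁻ x, ENNReal.ofReal (ProbabilityTheory.betaPDFReal a b x) = 1 :=
    ProbabilityTheory.lintegral_betaPDF_eq_one ha hb
  have hm := ProbabilityTheory.measurable_betaPDFReal a b
  constructor
  · refine ⟨hm.aestronglyMeasurable, ?_⟩
    rw [hasFiniteIntegral_iff_ofReal (ae_of_all _ hn), h1]
    exact ENNReal.one_lt_top
  · rw [integral_eq_lintegral_of_nonneg_ae (ae_of_all _ hn) hm.aestronglyMeasurable, h1]
    simp

lemma psi_moment (p : ℕ) : Integrable (fun x => x ^ p * psiMP x) ∧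
    ∫ x, x ^ p * psiMP x = (p.centralBinom : ℝ) / ((p:ℝ) + 1) / 4 ^ p := by
  have h := betaReal_integral (p + 1/2) (3/2) (by positivity) (by norm_num)
  simp_rw [psi_beta]
  refine ⟨h.1.const_mul _, ?_⟩
  rw [integral_const_mul, h.2, mul_one, beta_val]

lemma psi_nonneg (x : ℝ) : 0 ≤ psiMP x := by
  unfold psiMP; split_ifs
  · have := Real.pi_pos
    positivity
  · exact le_rfl

lemma psi_meas : Measurable psiMP := by
  unfold psiMP
  exact Measurable.ite measurableSet_Ioc (by fun_prop) measurable_const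

/-- The Marchenko-Pastur measure. -/
def mpM : Measure ℝ := volume.withDensity (fun x => ENNReal.ofReal (psiMP x))

lemma mp_integral (g : ℝ → ℝ) : ∫ x, g x ∂mpM = ∫ x in Set.Ioc (0:ℝ) 1, g x * psiMP x := by
  unfold mpM
  rw [integral_withDensity_eq_integral_toReal_smul (by have := psi_meas; fun_prop) (by simp)]
  rw [← integral_indicator measurableSet_Ioc]
  congr 1; ext x
  rw [ENNReal.toReal_ofReal (psi_nonneg x), smul_eq_mul, mul_comm]
  by_cases h : x ∈ Set.Ioc (0:ℝ) 1
  · simp [h]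
  · have : psiMP x = 0 := by unfold psiMP; exact if_neg h
    simp [h, this]

lemma mp_moment (p : ℕ) : ∫ x, x ^ p ∂mpM = (p.centralBinom : ℝ) / ((p:ℝ) + 1) / 4 ^ p := by
  unfold mpM
  rw [integral_withDensity_eq_integral_toReal_smul (by have := psi_meas; fun_prop) (by simp), ← (psi_moment p).2]
  congr 1; ext x
  rw [ENNReal.toReal_ofReal (psi_nonneg x), smul_eq_mul, mul_comm]

lemma mp_prob : IsProbabilityMeasure mpM := by
  constructor
  unfold mpM
  rw [withDensity_apply _ MeasurableSet.univ, Measure.restrict_univ]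
  have h := psi_moment 0
  simp only [pow_zero, one_mul] at h
  rw [← ofReal_integral_eq_lintegral_ofReal h.1 (ae_of_all _ psi_nonneg), h.2]
  simp

lemma mp_supp : ∀ᵐ x ∂mpM, x ∈ Set.Icc (0:ℝ) 1 := by
  unfold mpM
  rw [ae_withDensity_iff (by have := psi_meas; fun_prop)]
  refine ae_of_all _ fun x hx => ?_
  by_contra h
  apply hx
  rw [psiMP, if_neg]
  · simp
  · exact fun h' => h ⟨h'.1.le, h'.2⟩

/-- Method of moments for a compactly supported limit. -/
lemma moment_method (μ : ℕ → Measure ℝ) (ν : Measure ℝ) [IsProbabilityMeasure ν]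
    (hμ : ∀ᶠ n in atTop, IsProbabilityMeasure (μ n))
    (hsupp : ∀ᶠ n in atTop, ∀ᵐ x ∂(μ n), 0 ≤ x)
    (hIntg : ∀ᶠ n in atTop, ∀ p : ℕ, Integrable (fun x => x ^ p) (μ n))
    (hν : ∀ᵐ x ∂ν, x ∈ Set.Icc (0:ℝ) 1)
    (hmom : ∀ p : ℕ, Tendsto (fun n => ∫ x, x ^ p ∂(μ n)) atTop (𝓝 (∫ x, x ^ p ∂ν)))
    (f : ℝ → ℝ) (hf : Continuous f) (M : ℝ) (hM : ∀ x, |f x| ≤ M) :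
    Tendsto (fun n => ∫ x, f x ∂(μ n)) atTop (𝓝 (∫ x, f x ∂ν)) := by
  have hM0 : 0 ≤ M := (abs_nonneg _).trans (hM 0)
  have hνint : ∀ p : ℕ, Integrable (fun x => x ^ p) ν := by
    intro p
    refine Integrable.mono' (integrable_const (1:ℝ)) (by fun_prop) ?_
    filter_upwards [hν] with x hx
    rw [Real.norm_eq_abs, abs_pow, abs_of_nonneg hx.1]
    exact pow_le_one₀ hx.1 hx.2
  have hfint : ∀ (ρ : Measure ℝ) [IsProbabilityMeasure ρ], Integrable f ρ := fun ρ _ =>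
    Integrable.mono' (integrable_const M) hf.aestronglyMeasurable (ae_of_all _ hM)
  have hqint : ∀ (ρ : Measure ℝ), (∀ p : ℕ, Integrable (fun x => x ^ p) ρ) →
      ∀ q : Polynomial ℝ, Integrable (fun x => q.eval x) ρ := by
    intro ρ h q
    simp_rw [Polynomial.eval_eq_sum_range]
    exact integrable_finsetSum _ fun i _ => (h i).const_mul _
  have hqval : ∀ (ρ : Measure ℝ), (∀ p : ℕ, Integrable (fun x => x ^ p) ρ) →
      ∀ q : Polynomial ℝ, ∫ x, q.eval x ∂ρ = ∑ i ∈ range (q.natDegree + 1), q.coeff i * ∫ x, x ^ i ∂ρ := by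
    intro ρ h q
    simp_rw [Polynomial.eval_eq_sum_range]
    rw [integral_finsetSum _ fun i _ => (h i).const_mul _]
    simp_rw [integral_const_mul]
  rw [Metric.tendsto_nhds]
  intro ε hε
  set δ := ε / 6 with hδ
  have hδ0 : 0 < δ := by positivity
  obtain ⟨q, hq⟩ := exists_polynomial_near_of_continuousOn 0 2 f hf.continuousOn δ hδ0
  set k := q.natDegree with hk
  set A := ∑ i ∈ range (k + 1), |q.coeff i| with hA
  have hA0 : 0 ≤ A := sum_nonneg fun i _ => abs_nonneg _
  set C := M + A * 2 ^ k with hC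
  have hC0 : 0 ≤ C := by positivity
  have hbound : ∀ m, k ≤ m → ∀ x : ℝ, 0 ≤ x → |f x - q.eval x| ≤ δ + C / 2 ^ m * x ^ m := by
    intro m hm x hx
    rcases le_or_gt x 2 with h2 | h2
    · have := hq x ⟨hx, h2⟩
      rw [abs_sub_comm] at this
      have : 0 ≤ C / 2 ^ m * x ^ m := by positivity
      linarith
    · have hx2 : 1 ≤ x / 2 := by linarith
      have e1 : |q.eval x| ≤ A * x ^ k := by
        rw [Polynomial.eval_eq_sum_range, hA, sum_mul]
        refine (abs_sum_le_sum_abs _ _).trans (sum_le_sum fun i hi => ?_)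
        rw [abs_mul, abs_pow, abs_of_nonneg hx]
        have : i ≤ k := by simp at hi; omega
        gcongr
        linarith
      have e2 : x ^ k = 2 ^ k * (x / 2) ^ k := by rw [← mul_pow]; congr 1; ring
      have e3 : (x / 2) ^ k ≤ (x / 2) ^ m := pow_le_pow_right₀ hx2 hm
      have e4 : (1:ℝ) ≤ (x / 2) ^ m := one_le_pow₀ hx2
      have e5 : C / 2 ^ m * x ^ m = C * (x / 2) ^ m := by rw [div_pow]; ring
      rw [e5]
      calc |f x - q.eval x| ≤ |f x| + |q.eval x| := abs_sub _ _
        _ ≤ M + A * x ^ k := add_le_add (hM x) e1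
        _ = M * 1 + A * 2 ^ k * (x / 2) ^ k := by rw [e2]; ring
        _ ≤ M * (x / 2) ^ m + A * 2 ^ k * (x / 2) ^ m := by gcongr
        _ = C * (x / 2) ^ m := by rw [hC]; ring
        _ ≤ _ := by linarith
  have hdiff : ∀ (ρ : Measure ℝ), IsProbabilityMeasure ρ → (∀ p : ℕ, Integrable (fun x => x ^ p) ρ) →
      (∀ᵐ x ∂ρ, 0 ≤ x) → ∀ m, k ≤ m →
      |∫ x, f x ∂ρ - ∫ x, q.eval x ∂ρ| ≤ δ + C / 2 ^ m * ∫ x, x ^ m ∂ρ := by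
    intro ρ hρ hi hs m hm
    rw [← integral_sub (hfint ρ) (hqint ρ hi q)]
    have hIntg2 : Integrable (fun x => δ + C / 2 ^ m * x ^ m) ρ :=
      (integrable_const δ).add ((hi m).const_mul _)
    have : ∫ x, (δ + C / 2 ^ m * x ^ m) ∂ρ = δ + C / 2 ^ m * ∫ x, x ^ m ∂ρ := by
      rw [integral_add (integrable_const δ) ((hi m).const_mul _), integral_const_mul]; simp
    rw [← this, ← Real.norm_eq_abs]
    refine norm_integral_le_of_norm_le hIntg2 ?_
    filter_upwards [hs] with x hx
    exact hbound m hm x hx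
  obtain ⟨m, hkm, hm⟩ : ∃ m, k ≤ m ∧ C / 2 ^ m < δ := by
    have h1 : Tendsto (fun m : ℕ => C / (2:ℝ) ^ m) atTop (𝓝 0) :=
      (tendsto_pow_atTop_atTop_of_one_lt (by norm_num)).const_div_atTop _
    exact ((eventually_ge_atTop k).and (h1.eventually (gt_mem_nhds hδ0))).exists
  have hνm : ∫ x, x ^ m ∂ν ≤ 1 := by
    have h1 : (fun x : ℝ => x ^ m) ≤ᵐ[ν] fun _ => (1:ℝ) := by
      filter_upwards [hν] with x hx
      exact pow_le_one₀ hx.1 hx.2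
    have := integral_mono_ae (hνint m) (integrable_const (1:ℝ)) h1
    simpa using this
  have hq1 : Tendsto (fun n => ∫ x, q.eval x ∂(μ n)) atTop (𝓝 (∫ x, q.eval x ∂ν)) := by
    rw [hqval ν hνint]
    have : Tendsto (fun n => ∑ i ∈ range (q.natDegree + 1), q.coeff i * ∫ x, x ^ i ∂(μ n)) atTop
       (𝓝 (∑ i ∈ range (q.natDegree + 1), q.coeff i * ∫ x, x ^ i ∂ν)) :=
      tendsto_finsetSum _ fun i _ => (hmom i).const_mul _
    refine this.congr' ?_
    filter_upwards [hIntg] with n hn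
    rw [hqval _ hn]
  have hlim1 := (Metric.tendsto_nhds.1 hq1) δ hδ0
  have hlim2 := (hmom m).eventually (gt_mem_nhds (show ∫ x, x ^ m ∂ν < 2 by linarith))
  have hνd := hdiff ν inferInstance hνint (hν.mono fun x hx => hx.1) m hkm
  have hpos : 0 ≤ C / 2 ^ m := by positivity
  filter_upwards [hμ, hsupp, hIntg, hlim1, hlim2] with n h1 h2 h3 h4 h5
  have hn := hdiff (μ n) h1 h3 h2 m hkm
  rw [Real.dist_eq] at h4 ⊢
  have hb1 : C / 2 ^ m * ∫ x, x ^ m ∂(μ n) ≤ 2 * δ := by nlinarith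
  have hb2 : C / 2 ^ m * ∫ x, x ^ m ∂ν ≤ δ := by nlinarith
  rw [abs_lt] at h4 ⊢
  rw [abs_le] at hn hνd
  constructor <;> linarith [hn.1, hn.2, hνd.1, hνd.2, h4.1, h4.2]

lemma Q_deg (α : ℝ) (k : ℕ) :
    (Q α k).natDegree ≤ k ∧ (Q α k).coeff k = ((k.factorial : ℝ))⁻¹ := by
  induction k using Nat.strong_induction_on with
  | _ k ih =>
    rcases k with _ | _ | k
    · simp [Q]
    · constructor
      · rw [Q]; compute_degree
      · simp [Q, Polynomial.coeff_one]
    · obtain ⟨a1, a2⟩ := ih (k+1) (by omega)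
      obtain ⟨b1, b2⟩ := ih k (by omega)
      constructor
      · rw [Q]
        refine (Polynomial.natDegree_C_mul_le _ _).trans ?_
        refine (Polynomial.natDegree_sub_le _ _).trans (max_le ?_ ?_)
        · refine Polynomial.natDegree_mul_le.trans ?_
          rw [Polynomial.natDegree_X_sub_C]; omega
        · refine (Polynomial.natDegree_C_mul_le _ _).trans ?_
          omega
      · have e : Q α (k + 1 + 1) = Polynomial.C (((k : ℝ) + 2)⁻¹) *
          ((Polynomial.X - Polynomial.C (2 * (k:ℝ) + 3 + α)) * Q α (k + 1) - Polynomial.C ((k:ℝ) + 1 + α) * Q α k) := by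
          rw [Q]
        rw [e, sub_mul, Polynomial.coeff_C_mul, Polynomial.coeff_sub, Polynomial.coeff_sub, Polynomial.coeff_X_mul,
          Polynomial.coeff_C_mul, Polynomial.coeff_C_mul, a2,
          Polynomial.coeff_eq_zero_of_natDegree_lt (show (Q α (k+1)).natDegree < k + 1 + 1 by omega),
          Polynomial.coeff_eq_zero_of_natDegree_lt (show (Q α k).natDegree < k + 1 + 1 by omega)]
        rw [Nat.factorial_succ (k+1)]
        push_cast
        rw [show (k:ℝ) + 1 + 1 = k + 2 by ring]
        field_simp
        ring

lemma vdm2_Q (α : ℝ) (N : ℕ) : ∃ c : ℝ, 0 < c ∧ ∀ x : Fin N → ℝ,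
    vdm2 x = c * (Matrix.of (fun i j : Fin N => (Q α i).eval (x j))).det ^ 2 := by
  refine ⟨(∏ j : Fin N, ((j:ℕ).factorial : ℝ)) ^ 2, by positivity, fun x => ?_⟩
  have hf : ∀ k : ℕ, (k.factorial : ℝ) ≠ 0 := fun k => by positivity
  have hd : ∀ i : Fin N, (Polynomial.C ((i:ℕ).factorial : ℝ) * Q α i).natDegree ≤ i := fun i =>
    (Polynomial.natDegree_C_mul_le _ _).trans (Q_deg α i).1
  have hc : ∀ i : Fin N, (Polynomial.C ((i:ℕ).factorial : ℝ) * Q α i).coeff i = 1 := fun i => by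
    rw [Polynomial.coeff_C_mul, (Q_deg α i).2, mul_inv_cancel₀ (hf _)]
  rw [vdm2_eq, Matrix.det_eval_matrixOfPolynomials_eq_det_vandermonde x
    (fun i => Polynomial.C ((i:ℕ).factorial : ℝ) * Q α i)
    (fun i => Polynomial.natDegree_eq_of_le_of_coeff_ne_zero (hd i) (by rw [hc]; exact one_ne_zero))
    (fun i => Polynomial.monic_of_natDegree_le_of_coeff_eq_one _ (hd i) (hc i)),
    ← mul_pow, ← Matrix.det_transpose]
  congr 1
  rw [← Matrix.det_mul_column]
  congr 1
  ext i j
  simp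

/-- Exponent selecting the first coordinate. -/
def pp {n : ℕ} (p : ℕ) (i : Fin (n + 1)) : ℕ := if i = 0 then p else 0

lemma expand_det (α : ℝ) (n p : ℕ) (x : Fin (n + 1) → ℝ) :
    x 0 ^ p * (Matrix.of (fun i j : Fin (n+1) => (Q α i).eval (x j))).det ^ 2 * ∏ i, wt α (x i) =
    ∑ σ : Equiv.Perm (Fin (n+1)), ∑ τ : Equiv.Perm (Fin (n+1)),
      (((Equiv.Perm.sign σ : ℤ) : ℝ) * ((Equiv.Perm.sign τ : ℤ) : ℝ)) *
      ∏ i, ((Polynomial.X ^ (pp p i) * Q α (σ i) * Q α (τ i)).eval (x i) * wt α (x i)) := by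
  have h0 : x 0 ^ p = ∏ i, x i ^ (pp p i) := by
    rw [Fin.prod_univ_succ]; simp [pp, Fin.succ_ne_zero]
  rw [sq, Matrix.det_apply', Finset.sum_mul_sum, h0, Finset.mul_sum, Finset.sum_mul]
  refine Finset.sum_congr rfl fun σ _ => ?_
  rw [Finset.mul_sum, Finset.sum_mul]
  refine Finset.sum_congr rfl fun τ _ => ?_
  simp only [Polynomial.eval_mul, Polynomial.eval_pow, Polynomial.eval_X, Finset.prod_mul_distrib, Matrix.of_apply]
  ring

lemma expand_integrable (α : ℝ) (hα : -1 < α) (n p : ℕ) :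
    Integrable (fun x : Fin (n + 1) → ℝ =>
      x 0 ^ p * (Matrix.of (fun i j : Fin (n+1) => (Q α i).eval (x j))).det ^ 2 * ∏ i, wt α (x i)) := by
  simp_rw [expand_det]
  refine integrable_finsetSum _ fun σ _ => integrable_finsetSum _ fun τ _ => Integrable.const_mul ?_ _
  exact Integrable.fintype_prod (f := fun i y => (Polynomial.X ^ (pp p i) * Q α (σ i) * Q α (τ i)).eval y * wt α y)
    fun i => wt_poly_integrable α hα _

lemma expand_integral (α : ℝ) (hα : -1 < α) (n p : ℕ) :
    ∫ x : Fin (n + 1) → ℝ,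
      x 0 ^ p * (Matrix.of (fun i j : Fin (n+1) => (Q α i).eval (x j))).det ^ 2 * ∏ i, wt α (x i) =
    ∑ σ : Equiv.Perm (Fin (n+1)), ∑ τ : Equiv.Perm (Fin (n+1)),
      (((Equiv.Perm.sign σ : ℤ) : ℝ) * ((Equiv.Perm.sign τ : ℤ) : ℝ)) *
      ∏ i, Ip α (pp p i) (σ i) (τ i) := by
  simp_rw [expand_det]
  have hi : ∀ σ τ : Equiv.Perm (Fin (n+1)), Integrable (fun x : Fin (n + 1) → ℝ =>
      (((Equiv.Perm.sign σ : ℤ) : ℝ) * ((Equiv.Perm.sign τ : ℤ) : ℝ)) *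
      ∏ i, ((Polynomial.X ^ (pp p i) * Q α (σ i) * Q α (τ i)).eval (x i) * wt α (x i))) := fun σ τ =>
    (Integrable.fintype_prod (f := fun i y => (Polynomial.X ^ (pp p i) * Q α (σ i) * Q α (τ i)).eval y * wt α y)
    fun i => wt_poly_integrable α hα _).const_mul _
  rw [integral_finsetSum _ fun σ _ => integrable_finsetSum _ fun τ _ => hi σ τ]
  refine Finset.sum_congr rfl fun σ _ => ?_
  rw [integral_finsetSum _ fun τ _ => hi σ τ]
  refine Finset.sum_congr rfl fun τ _ => ?_
  rw [integral_const_mul]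
  congr 1
  exact integral_fintype_prod_volume_eq_prod
    (fun (i : Fin (n+1)) (y : ℝ) => (Polynomial.X ^ (pp p i) * Q α (σ i) * Q α (τ i)).eval y * wt α y)

lemma perm_sum (n : ℕ) (g : Fin (n + 1) → ℝ) :
    ∑ σ : Equiv.Perm (Fin (n+1)), g (σ 0) = ((n+1).factorial : ℝ) * ((∑ k, g k) / ((n + 1 : ℕ) : ℝ)) := by
  have h1 : ∀ i : Fin (n+1), ∑ σ : Equiv.Perm (Fin (n+1)), g (σ i) = ∑ σ : Equiv.Perm (Fin (n+1)), g (σ 0) := by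
    intro i
    refine Fintype.sum_equiv (Equiv.mulRight (Equiv.swap 0 i)) _ _ fun σ => ?_
    simp
  have h2 : ∑ i : Fin (n+1), ∑ σ : Equiv.Perm (Fin (n+1)), g (σ i) = ((n+1).factorial : ℝ) * ∑ k, g k := by
    rw [Finset.sum_comm]
    have : ∀ σ : Equiv.Perm (Fin (n+1)), ∑ i, g (σ i) = ∑ k, g k := fun σ => Equiv.sum_comp σ g
    simp [this, Fintype.card_perm]
  simp_rw [h1] at h2
  rw [Finset.sum_const, Finset.card_univ, Fintype.card_fin, nsmul_eq_mul] at h2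
  have : ((n + 1 : ℕ) : ℝ) ≠ 0 := by positivity
  field_simp
  linarith

lemma andreief_s17 (α : ℝ) (hα : -1 < α) (n p : ℕ) :
    ∫ x : Fin (n + 1) → ℝ,
      x 0 ^ p * (Matrix.of (fun i j : Fin (n+1) => (Q α i).eval (x j))).det ^ 2 * ∏ i, wt α (x i) =
    ((∏ k : Fin (n+1), Ip α 0 k k) * ((n+1).factorial : ℝ)) *
      ((∑ k ∈ range (n + 1), Ip α p k k / Ip α 0 k k) / ((n + 1 : ℕ) : ℝ)) := by
  rw [expand_integral α hα]
  have h1 : ∀ σ : Equiv.Perm (Fin (n+1)), ∑ τ : Equiv.Perm (Fin (n+1)),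
      (((Equiv.Perm.sign σ : ℤ) : ℝ) * ((Equiv.Perm.sign τ : ℤ) : ℝ)) *
      ∏ i, Ip α (pp p i) (σ i) (τ i) = (∏ k : Fin (n+1), Ip α 0 k k) * (Ip α p (σ 0) (σ 0) / Ip α 0 (σ 0) (σ 0)) := by
    intro σ
    rw [Finset.sum_eq_single σ]
    · have hs : ((Equiv.Perm.sign σ : ℤ) : ℝ) * ((Equiv.Perm.sign σ : ℤ) : ℝ) = 1 := by
        rcases Int.units_eq_one_or (Equiv.Perm.sign σ) with h | h <;> simp [h]
      rw [hs, one_mul, ← Equiv.prod_comp σ (fun k : Fin (n+1) => Ip α 0 k k), Fin.prod_univ_succ, Fin.prod_univ_succ]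
      have := (Ip_zero_pos α hα (σ 0)).ne'
      simp only [pp, Fin.succ_ne_zero, if_true, if_false]
      field_simp
    · intro τ _ hτ
      have : ∃ i : Fin n, σ i.succ ≠ τ i.succ := by
        by_contra hcon
        push Not at hcon
        apply hτ
        have h0 : ∀ i, i ≠ 0 → σ i = τ i := fun i hi => by
          obtain ⟨j, rfl⟩ := Fin.exists_succ_eq.2 hi
          exact hcon j
        ext i
        by_cases hi : i = 0
        · subst hi
          obtain ⟨j, hj⟩ := σ.surjective (τ 0)
          by_cases hj0 : j = 0
          · subst hj0; rw [hj]
          · have := h0 j hj0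
            rw [hj] at this
            exact absurd (τ.injective this).symm hj0
        · rw [h0 i hi]
      obtain ⟨i, hi⟩ := this
      rw [Finset.prod_eq_zero (Finset.mem_univ i.succ), mul_zero]
      simp only [pp, Fin.succ_ne_zero, if_false]
      exact Ip_zero_ne α hα _ _ (fun h => hi (Fin.ext h))
    · simp
  simp_rw [h1]
  rw [← Finset.mul_sum, perm_sum n (fun k => Ip α p k k / Ip α 0 k k), Finset.sum_range (fun k => Ip α p k k / Ip α 0 k k)]
  ring

/-- Homogeneous density on the orthant, with an extra power of the first coordinate. -/
def Hd (α : ℝ) (n p : ℕ) (x : Fin (n + 1) → ℝ) : ℝ :=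
  if ∀ i, 0 ≤ x i then x 0 ^ p * (vdm2 x * lagWeight α x) else 0

lemma Hd_nonneg (α : ℝ) (n p : ℕ) (x : Fin (n + 1) → ℝ) : 0 ≤ Hd α n p x := by
  unfold Hd; split_ifs with h
  · have h1 := vdm2_nonneg x
    have h2 : 0 ≤ lagWeight α x := Finset.prod_nonneg fun i _ => Real.rpow_nonneg (h i) _
    have := h 0
    positivity
  · exact le_rfl

lemma orth_meas (n : ℕ) : MeasurableSet {x : Fin (n + 1) → ℝ | ∀ i, 0 ≤ x i} := by
  simp only [Set.ofPred_forall]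
  exact MeasurableSet.iInter fun i => measurableSet_le measurable_const (measurable_pi_apply i)

lemma Hd_meas (α : ℝ) (n p : ℕ) : Measurable (Hd α n p) := by
  unfold Hd vdm2 lagWeight
  refine Measurable.ite (orth_meas n) ?_ measurable_const
  fun_prop

lemma card_pairs (N : ℕ) :
    (((Finset.univ.filter (fun p : Fin N × Fin N => p.1 < p.2)).card : ℕ) : ℝ) * 2 = (N:ℝ) * (N - 1) := by
  have h : ∏ p ∈ Finset.univ.filter (fun p : Fin N × Fin N => p.1 < p.2), Real.exp 1 =
      ∏ i : Fin N, ∏ j ∈ Finset.Ioi i, Real.exp 1 := by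
    rw [Finset.prod_filter, Fintype.prod_prod_type]
    refine Finset.prod_congr rfl fun i _ => ?_
    rw [← Finset.prod_filter]
    refine Finset.prod_congr ?_ fun _ _ => rfl
    ext j; simp
  have h2 : (Finset.univ.filter (fun p : Fin N × Fin N => p.1 < p.2)).card = ∑ i : Fin N, (N - 1 - i) := by
    rw [Finset.card_filter, Fintype.sum_prod_type]
    refine Finset.sum_congr rfl fun i _ => ?_
    rw [← Finset.card_filter, ← Fin.card_Ioi]
    congr 1; ext j; simp
  rw [h2, Finset.sum_range (fun i => N - 1 - i) |>.symm, Finset.sum_range_reflect (fun i => i) N]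
  have := Finset.sum_range_id_mul_two N
  have h3 : (((∑ i ∈ range N, i) : ℕ) : ℝ) * 2 = ((N * (N - 1) : ℕ) : ℝ) := by exact_mod_cast this
  rw [h3]
  rcases N with _ | N
  · simp
  · simp

lemma vdm2_smul (n : ℕ) (t : ℝ) (ht : 0 < t) (x : Fin (n + 1) → ℝ) :
    vdm2 (t • x) = t ^ (((n + 1 : ℕ) : ℝ) * (((n + 1 : ℕ) : ℝ) - 1)) * vdm2 x := by
  unfold vdm2
  have : ∀ p : Fin (n+1) × Fin (n+1), ((t • x) p.2 - (t • x) p.1) ^ 2 = t ^ 2 * (x p.2 - x p.1) ^ 2 := by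
    intro p; simp only [Pi.smul_apply, smul_eq_mul]; ring
  simp_rw [this]
  rw [Finset.prod_mul_distrib, Finset.prod_const, ← card_pairs, ← pow_mul, ← Real.rpow_natCast]
  congr 2; push_cast; ring

lemma Hd_smul (α : ℝ) (n p : ℕ) (t : ℝ) (ht : 0 < t) (x : Fin (n + 1) → ℝ) :
    Hd α n p (t • x) = t ^ (((n + 1 : ℕ) : ℝ) * (((n + 1 : ℕ) : ℝ) + α) + p - ((n + 1 : ℕ) : ℝ)) * Hd α n p x := by
  have hiff : (∀ i, 0 ≤ (t • x) i) ↔ ∀ i, 0 ≤ x i := by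
    refine forall_congr' fun i => ?_
    simp only [Pi.smul_apply, smul_eq_mul]
    exact mul_nonneg_iff_of_pos_left ht
  unfold Hd
  by_cases h : ∀ i, 0 ≤ x i
  · rw [if_pos h, if_pos (hiff.2 h), vdm2_smul n t ht]
    have h1 : lagWeight α (t • x) = t ^ (((n + 1 : ℕ) : ℝ) * α) * lagWeight α x := by
      unfold lagWeight
      simp_rw [Pi.smul_apply, smul_eq_mul, fun i => Real.mul_rpow (z := α) ht.le (h i)]
      rw [Finset.prod_mul_distrib, Finset.prod_const, mul_comm _ α, Real.rpow_mul ht.le, Real.rpow_natCast]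
      simp
    rw [h1]
    have h2 : t ^ (((n + 1 : ℕ) : ℝ) * (((n + 1 : ℕ) : ℝ) + α) + p - ((n + 1 : ℕ) : ℝ)) =
      t ^ p * (t ^ (((n + 1 : ℕ) : ℝ) * (((n + 1 : ℕ) : ℝ) - 1)) * t ^ (((n + 1 : ℕ) : ℝ) * α)) := by
      rw [← Real.rpow_natCast t p, ← Real.rpow_add ht, ← Real.rpow_add ht]
      congr 1; ring
    rw [h2]
    simp only [Pi.smul_apply, smul_eq_mul]
    ring
  · rw [if_neg h, if_neg (fun h' => h (hiff.1 h')), mul_zero]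

/-- Bounded trace integral in `ENNReal`. -/
def Jt (α : ℝ) (n p : ℕ) (t : ℝ) : ENNReal :=
  ∫⁻ x in {x : Fin (n + 1) → ℝ | ∑ i, x i ≤ t}, ENNReal.ofReal (Hd α n p x)

lemma sum_set_meas (n : ℕ) (t : ℝ) : MeasurableSet {x : Fin (n + 1) → ℝ | ∑ i, x i ≤ t} :=
  measurableSet_le (by fun_prop) measurable_const

lemma Jt_scale (α : ℝ) (n p : ℕ) (t : ℝ) (ht : 0 < t) :
    Jt α n p t = ENNReal.ofReal (t ^ (((n + 1 : ℕ) : ℝ) * (((n + 1 : ℕ) : ℝ) + α) + p)) * Jt α n p 1 := by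
  have hm : Measurable (fun x => ENNReal.ofReal (Hd α n p x)) := (Hd_meas α n p).ennreal_ofReal
  have hmap := Measure.map_addHaar_smul (volume : Measure (Fin (n+1) → ℝ)) ht.ne'
  rw [Module.finrank_fintype_fun_eq_card, Fintype.card_fin, abs_of_nonneg (by positivity)] at hmap
  set g := {x : Fin (n + 1) → ℝ | ∑ i, x i ≤ t}.indicator (fun x => ENNReal.ofReal (Hd α n p x)) with hg
  have hgm : Measurable g := hm.indicator (sum_set_meas n t)
  have h1 : ∫⁻ y, g (t • y) = ENNReal.ofReal ((t ^ (n+1))⁻¹) * Jt α n p t := by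
    have h := lintegral_map hgm (measurable_const_smul t) (μ := (volume : Measure (Fin (n+1) → ℝ)))
    rw [hmap, lintegral_smul_measure, smul_eq_mul, hg, lintegral_indicator (sum_set_meas n t)] at h
    exact h.symm
  have h2 : ∫⁻ y, g (t • y) = ENNReal.ofReal (t ^ (((n + 1 : ℕ) : ℝ) * (((n + 1 : ℕ) : ℝ) + α) + p - ((n + 1 : ℕ) : ℝ))) * Jt α n p 1 := by
    unfold Jt
    rw [← lintegral_indicator (sum_set_meas n 1), ← lintegral_const_mul _ (hm.indicator (sum_set_meas n 1))]
    congr 1; ext y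
    have hiff : (∑ i, (t • y) i ≤ t) ↔ (∑ i, y i ≤ 1) := by
      simp only [Pi.smul_apply, smul_eq_mul, ← Finset.mul_sum]
      exact mul_le_iff_le_one_right ht
    by_cases h : ∑ i, y i ≤ 1
    · rw [hg, Set.indicator_of_mem (by exact hiff.2 h), Set.indicator_of_mem (by exact h), Hd_smul α n p t ht,
        ENNReal.ofReal_mul (by positivity)]
    · rw [hg, Set.indicator_of_notMem (by exact fun h' => h (hiff.1 h')), Set.indicator_of_notMem (by exact h), mul_zero]
  rw [h1] at h2
  have h3 : ENNReal.ofReal (t ^ (n+1)) * ENNReal.ofReal ((t ^ (n+1))⁻¹) = 1 := by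
    rw [← ENNReal.ofReal_mul (by positivity), mul_inv_cancel₀ (by positivity), ENNReal.ofReal_one]
  calc Jt α n p t = (ENNReal.ofReal (t ^ (n+1)) * ENNReal.ofReal ((t ^ (n+1))⁻¹)) * Jt α n p t := by rw [h3, one_mul]
    _ = ENNReal.ofReal (t ^ (n+1)) * (ENNReal.ofReal ((t ^ (n+1))⁻¹) * Jt α n p t) := by rw [mul_assoc]
    _ = _ := by
      rw [h2, ← mul_assoc, ← ENNReal.ofReal_mul (by positivity), ← Real.rpow_natCast t (n+1), ← Real.rpow_add ht]
      congr 3; ring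

lemma exp_tail (s : ℝ) (hs : 0 ≤ s) :
    ENNReal.ofReal (Real.exp (-s)) = ∫⁻ t in Set.Ioi (0:ℝ), if s ≤ t then ENNReal.ofReal (Real.exp (-t)) else 0 := by
  have h1 : ∫⁻ t in Set.Ioi (0:ℝ), (if s ≤ t then ENNReal.ofReal (Real.exp (-t)) else 0) =
      ∫⁻ t in Set.Ioi s, ENNReal.ofReal (Real.exp (-t)) := by
    rw [← setLIntegral_congr (Ioi_ae_eq_Ici (a := s) (μ := volume)).symm, ← lintegral_indicator measurableSet_Ici,
      ← lintegral_indicator measurableSet_Ioi]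
    refine lintegral_congr_ae ?_
    have : ∀ᵐ t : ℝ, t ≠ 0 := by simp [ae_iff]
    filter_upwards [this] with t ht
    by_cases h : s ≤ t
    · have : 0 < t := lt_of_le_of_ne (hs.trans h) ht.symm
      simp [Set.indicator, h, this]
    · simp [Set.indicator, h]
  rw [h1, ← ofReal_integral_eq_lintegral_ofReal (integrableOn_exp_neg_Ioi s) (ae_of_all _ fun t => (Real.exp_pos _).le),
    integral_exp_neg_Ioi]

lemma laplace (α : ℝ) (hα : -1 < α) (n p : ℕ) :
    ∫⁻ x, ENNReal.ofReal (Hd α n p x * Real.exp (-∑ i, x i)) =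
      ENNReal.ofReal (Real.Gamma (((n + 1 : ℕ) : ℝ) * (((n + 1 : ℕ) : ℝ) + α) + p + 1)) * Jt α n p 1 := by
  have hm : Measurable (fun x => ENNReal.ofReal (Hd α n p x)) := (Hd_meas α n p).ennreal_ofReal
  have hD : 0 < ((n + 1 : ℕ) : ℝ) * (((n + 1 : ℕ) : ℝ) + α) + p + 1 := by
    have : 0 < ((n + 1 : ℕ) : ℝ) + α := by push_cast; have : (0:ℝ) ≤ n := n.cast_nonneg; linarith
    positivity
  set D := ((n + 1 : ℕ) : ℝ) * (((n + 1 : ℕ) : ℝ) + α) + p with hDdef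
  have h1 : ∀ x : Fin (n+1) → ℝ, ENNReal.ofReal (Hd α n p x * Real.exp (-∑ i, x i)) =
      ∫⁻ t in Set.Ioi (0:ℝ), (if ∑ i, x i ≤ t then ENNReal.ofReal (Real.exp (-t)) * ENNReal.ofReal (Hd α n p x) else 0) := by
    intro x
    by_cases h : ∀ i, 0 ≤ x i
    · rw [ENNReal.ofReal_mul (Hd_nonneg _ _ _ _), exp_tail _ (Finset.sum_nonneg fun i _ => h i), mul_comm,
        ← lintegral_mul_const]
      · congr 1; ext t; split_ifs <;> simp
      · exact Measurable.ite measurableSet_Ici (by fun_prop) measurable_const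
    · have : Hd α n p x = 0 := by rw [Hd, if_neg h]
      simp [this]
  simp_rw [h1]
  rw [lintegral_lintegral_swap]
  · have h2 : ∀ t ∈ Set.Ioi (0:ℝ), (∫⁻ x : Fin (n+1) → ℝ, (if ∑ i, x i ≤ t then ENNReal.ofReal (Real.exp (-t)) * ENNReal.ofReal (Hd α n p x) else 0)) = ENNReal.ofReal (Real.exp (-t) * t ^ (D + 1 - 1)) * Jt α n p 1 := by
      intro t ht
      have ht' : 0 < t := ht
      rw [ENNReal.ofReal_mul (Real.exp_pos _).le, mul_assoc, add_sub_cancel_right, ← Jt_scale α n p t ht, Jt,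
        ← lintegral_const_mul _ hm, ← lintegral_indicator (sum_set_meas n t)]
      rfl
    rw [setLIntegral_congr_fun measurableSet_Ioi h2, lintegral_mul_const _ (by fun_prop), Real.Gamma_eq_integral hD,
      ofReal_integral_eq_lintegral_ofReal (Real.GammaIntegral_convergent hD)]
    filter_upwards [ae_restrict_mem measurableSet_Ioi] with t ht
    have : 0 < t := ht
    positivity
  · apply Measurable.aemeasurable
    refine Measurable.ite (measurableSet_le (by fun_prop) (by fun_prop)) ?_ measurable_const
    exact Measurable.mul (by fun_prop) (hm.comp measurable_fst)

lemma Hd_exp (α : ℝ) (n p : ℕ) (c : ℝ) 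
    (hc : ∀ x : Fin (n+1) → ℝ, vdm2 x = c * (Matrix.of (fun i j : Fin (n+1) => (Q α i).eval (x j))).det ^ 2)
    (x : Fin (n+1) → ℝ) : Hd α n p x * Real.exp (-∑ i, x i) =
     c * (x 0 ^ p * (Matrix.of (fun i j : Fin (n+1) => (Q α i).eval (x j))).det ^ 2 * ∏ i, wt α (x i)) := by
  unfold Hd
  by_cases h : ∀ i, 0 ≤ x i
  · have : ∏ i, wt α (x i) = lagWeight α x * Real.exp (-∑ i, x i) := by
      unfold lagWeight
      rw [← Finset.sum_neg_distrib, Real.exp_sum, ← Finset.prod_mul_distrib]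
      exact Finset.prod_congr rfl fun i _ => by rw [wt, if_pos (h i)]
    rw [if_pos h, this, hc]; ring
  · rw [if_neg h]
    push Not at h
    obtain ⟨i, hi⟩ := h
    rw [Finset.prod_eq_zero (Finset.mem_univ i) (by rw [wt, if_neg hi.not_ge])]
    simp

/-- The bounded trace integrand. -/
def Gd (α : ℝ) (n p : ℕ) (r : ℝ) (x : Fin (n + 1) → ℝ) : ℝ :=
  {x : Fin (n + 1) → ℝ | ∑ i, x i ≤ r}.indicator (Hd α n p) x

lemma Gd_meas (α : ℝ) (n p : ℕ) (r : ℝ) : Measurable (Gd α n p r) :=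
  (Hd_meas α n p).indicator (sum_set_meas n r)

lemma Gd_nonneg (α : ℝ) (n p : ℕ) (r : ℝ) (x) : 0 ≤ Gd α n p r x :=
  Set.indicator_nonneg (fun x _ => Hd_nonneg α n p x) x

lemma Gd_lintegral (α : ℝ) (n p : ℕ) (r : ℝ) : ∫⁻ x, ENNReal.ofReal (Gd α n p r x) = Jt α n p r := by
  unfold Jt
  rw [← lintegral_indicator (sum_set_meas n r)]
  congr 1; ext x
  unfold Gd
  by_cases h : x ∈ {x : Fin (n + 1) → ℝ | ∑ i, x i ≤ r}
  · rw [Set.indicator_of_mem h, Set.indicator_of_mem h]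
  · rw [Set.indicator_of_notMem h, Set.indicator_of_notMem h]; simp

/-- Main computation: bounded trace integrals. -/
lemma Gd_main (α : ℝ) (hα : -1 < α) (n : ℕ) : ∃ K : ℝ, 0 < K ∧ ∀ (p : ℕ) (r : ℝ), 0 < r →
    Integrable (Gd α n p r) ∧ ∫ x, Gd α n p r x =
      r ^ (((n + 1 : ℕ) : ℝ) * (((n + 1 : ℕ) : ℝ) + α) + p) *
      (K * ((∑ k ∈ range (n + 1), Ip α p k k / Ip α 0 k k) / ((n + 1 : ℕ) : ℝ))) /
       Real.Gamma (((n + 1 : ℕ) : ℝ) * (((n + 1 : ℕ) : ℝ) + α) + p + 1) := by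
  obtain ⟨c, hc0, hc⟩ := vdm2_Q α (n+1)
  refine ⟨c * ((∏ k : Fin (n+1), Ip α 0 k k) * ((n+1).factorial : ℝ)), ?_, ?_⟩
  · have : 0 < ∏ k : Fin (n+1), Ip α 0 k k := Finset.prod_pos fun k _ => Ip_zero_pos α hα k
    positivity
  intro p r hr
  have hG : 0 < Real.Gamma (((n + 1 : ℕ) : ℝ) * (((n + 1 : ℕ) : ℝ) + α) + p + 1) := by
    have : 0 < ((n + 1 : ℕ) : ℝ) + α := by push_cast; have : (0:ℝ) ≤ n := n.cast_nonneg; linarith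
    exact Real.Gamma_pos_of_pos (by positivity)
  have hIntg : Integrable (fun x : Fin (n+1) → ℝ => Hd α n p x * Real.exp (-∑ i, x i)) := by
    simp_rw [Hd_exp α n p c hc]
    exact (expand_integrable α hα n p).const_mul _
  have hval : ∫ x : Fin (n+1) → ℝ, Hd α n p x * Real.exp (-∑ i, x i) =
      c * (((∏ k : Fin (n+1), Ip α 0 k k) * ((n+1).factorial : ℝ)) *
        ((∑ k ∈ range (n + 1), Ip α p k k / Ip α 0 k k) / ((n + 1 : ℕ) : ℝ))) := by
    simp_rw [Hd_exp α n p c hc]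
    rw [integral_const_mul, andreief_s17 α hα]
  have hnn : ∀ x : Fin (n+1) → ℝ, 0 ≤ Hd α n p x * Real.exp (-∑ i, x i) := fun x =>
    mul_nonneg (Hd_nonneg _ _ _ _) (Real.exp_pos _).le
  have hlap := laplace α hα n p
  rw [← ofReal_integral_eq_lintegral_ofReal hIntg (ae_of_all _ hnn)] at hlap
  have hJ1 : Jt α n p 1 ≠ ⊤ := by
    intro h
    rw [h, ENNReal.mul_top (by simpa using hG)] at hlap
    exact ENNReal.ofReal_ne_top hlap
  have hJr : Jt α n p r ≠ ⊤ := by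
    rw [Jt_scale α n p r hr]
    exact ENNReal.mul_ne_top ENNReal.ofReal_ne_top hJ1
  have hJ1v : (Jt α n p 1).toReal = (∫ x : Fin (n+1) → ℝ, Hd α n p x * Real.exp (-∑ i, x i)) /
      Real.Gamma (((n + 1 : ℕ) : ℝ) * (((n + 1 : ℕ) : ℝ) + α) + p + 1) := by
    have h := congrArg ENNReal.toReal hlap
    rw [ENNReal.toReal_mul, ENNReal.toReal_ofReal hG.le, ENNReal.toReal_ofReal (integral_nonneg hnn)] at h
    rw [h]; field_simp
  constructor
  · refine ⟨(Gd_meas α n p r).aestronglyMeasurable, ?_⟩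
    rw [hasFiniteIntegral_iff_ofReal (ae_of_all _ (Gd_nonneg α n p r)), Gd_lintegral]
    exact lt_top_iff_ne_top.2 hJr
  · rw [integral_eq_lintegral_of_nonneg_ae (ae_of_all _ (Gd_nonneg α n p r)) (Gd_meas α n p r).aestronglyMeasurable,
      Gd_lintegral, Jt_scale α n p r hr, ENNReal.toReal_mul, ENNReal.toReal_ofReal (by positivity), hJ1v, hval]
    ring

lemma Gd_pow (α : ℝ) (n p : ℕ) (r : ℝ) (x : Fin (n+1) → ℝ) :
    Gd α n p r x = x 0 ^ p * Gd α n 0 r x := by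
  simp only [Gd, Hd, Set.indicator]
  split_ifs <;> simp

lemma Gd_eq_if (α : ℝ) (n : ℕ) (r : ℝ) (x : Fin (n+1) → ℝ) :
    Gd α n 0 r x = if (∀ i, 0 ≤ x i) ∧ (∑ i, x i) ≤ r then vdm2 x * lagWeight α x else 0 := by
  simp only [Gd, Hd, Set.indicator, Set.mem_ofPred_eq]
  split_ifs <;> simp_all

lemma Z_eq (α : ℝ) (n : ℕ) (r : ℝ) : btlueZ α (n+1) r = ∫ x, Gd α n 0 r x := by
  unfold btlueZ
  exact integral_congr_ae (ae_of_all _ fun x => (Gd_eq_if α n r x).symm)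

lemma bt_moment_all (α : ℝ) (hα : -1 < α) (n : ℕ) (r : ℝ) (hr : 0 < r) :
    0 < btlueZ α (n+1) r ∧ ∀ p : ℕ, Integrable (Gd α n p r) ∧
    (btlueZ α (n+1) r)⁻¹ * ∫ x, Gd α n p r x =
     r ^ p * Real.Gamma (((n + 1 : ℕ) : ℝ) * (((n + 1 : ℕ) : ℝ) + α) + 1) /
      Real.Gamma (((n + 1 : ℕ) : ℝ) * (((n + 1 : ℕ) : ℝ) + α) + p + 1) *
      ((∑ k ∈ range (n + 1), Ip α p k k / Ip α 0 k k) / ((n + 1 : ℕ) : ℝ)) := by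
  obtain ⟨K, hK, h⟩ := Gd_main α hα n
  have hD : 0 < ((n + 1 : ℕ) : ℝ) * (((n + 1 : ℕ) : ℝ) + α) := by
    have : 0 < ((n + 1 : ℕ) : ℝ) + α := by push_cast; have : (0:ℝ) ≤ n := n.cast_nonneg; linarith
    positivity
  have h1 : (∑ k ∈ range (n + 1), Ip α 0 k k / Ip α 0 k k) / ((n + 1 : ℕ) : ℝ) = 1 := by
    rw [Finset.sum_congr rfl (fun k _ => div_self (Ip_zero_pos α hα k).ne')]
    have h3 : ((n + 1 : ℕ) : ℝ) ≠ 0 := by positivity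
    simp only [Finset.sum_const, Finset.card_range, nsmul_eq_mul, mul_one]
    exact div_self h3
  set D := ((n + 1 : ℕ) : ℝ) * (((n + 1 : ℕ) : ℝ) + α) with hDd
  have hZ : btlueZ α (n+1) r = r ^ D * K / Real.Gamma (D + 1) := by
    rw [Z_eq, (h 0 r hr).2, h1]; simp
  have hG := Real.Gamma_pos_of_pos (show 0 < D + 1 by linarith)
  have hrD : 0 < r ^ D := by positivity
  refine ⟨by rw [hZ]; positivity, fun p => ⟨(h p r hr).1, ?_⟩⟩
  rw [(h p r hr).2, hZ, Real.rpow_add hr, Real.rpow_natCast]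
  have hG2 := Real.Gamma_pos_of_pos (show 0 < D + p + 1 by positivity)
  field_simp

lemma coord_meas (n : ℕ) : Measurable (fun x : Fin (n+1) → ℝ => x 0) := measurable_pi_apply 0

/-- one-point law -/
def btM (α : ℝ) (n : ℕ) (r : ℝ) : Measure ℝ :=
  Measure.map (fun x : Fin (n+1) → ℝ => x 0)
    (volume.withDensity (fun x => ENNReal.ofReal ((btlueZ α (n+1) r)⁻¹ * Gd α n 0 r x)))

lemma dens_meas (α : ℝ) (n : ℕ) (r : ℝ) :
    Measurable (fun x => ENNReal.ofReal ((btlueZ α (n+1) r)⁻¹ * Gd α n 0 r x)) :=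
  ((Gd_meas α n 0 r).const_mul _).ennreal_ofReal

lemma btM_integral (α : ℝ) (hα : -1 < α) (n : ℕ) (r : ℝ) (hr : 0 < r) (g : ℝ → ℝ)
    (hg : Continuous g) :
    ∫ x, g x ∂(btM α n r) = (btlueZ α (n+1) r)⁻¹ * ∫ x : Fin (n+1) → ℝ, g (x 0) * Gd α n 0 r x := by
  have hZ := (bt_moment_all α hα n r hr).1
  unfold btM
  rw [integral_map (measurable_pi_apply 0).aemeasurable hg.aestronglyMeasurable,
    integral_withDensity_eq_integral_toReal_smul (dens_meas α n r) (ae_of_all _ fun _ => ENNReal.ofReal_lt_top),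
    ← integral_const_mul]
  refine integral_congr_ae (ae_of_all _ fun x => ?_)
  have := mul_nonneg (inv_pos.2 hZ).le (Gd_nonneg α n 0 r x)
  simp only [ENNReal.toReal_ofReal this, smul_eq_mul]
  ring

lemma btM_integrable (α : ℝ) (hα : -1 < α) (n : ℕ) (r : ℝ) (hr : 0 < r) (p : ℕ) :
    Integrable (fun x => x ^ p) (btM α n r) := by
  obtain ⟨hZ, h⟩ := bt_moment_all α hα n r hr
  unfold btM
  rw [integrable_map_measure (by fun_prop) (coord_meas n).aemeasurable,
    integrable_withDensity_iff_integrable_smul' (dens_meas α n r) (ae_of_all _ fun _ => ENNReal.ofReal_lt_top)]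
  refine ((h p).1.const_mul (btlueZ α (n+1) r)⁻¹).congr (ae_of_all _ fun x => ?_)
  have := mul_nonneg (inv_pos.2 hZ).le (Gd_nonneg α n 0 r x)
  simp only [ENNReal.toReal_ofReal this, smul_eq_mul, Gd_pow α n p r x, Function.comp]
  ring

lemma btM_prob (α : ℝ) (hα : -1 < α) (n : ℕ) (r : ℝ) (hr : 0 < r) :
    IsProbabilityMeasure (btM α n r) := by
  obtain ⟨hZ, h⟩ := bt_moment_all α hα n r hr
  unfold btM
  have : IsProbabilityMeasure ((volume : Measure (Fin (n+1) → ℝ)).withDensity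
      (fun x => ENNReal.ofReal ((btlueZ α (n+1) r)⁻¹ * Gd α n 0 r x))) := by
    constructor
    rw [withDensity_apply _ MeasurableSet.univ, Measure.restrict_univ,
      ← ofReal_integral_eq_lintegral_ofReal ((h 0).1.const_mul _)
        (ae_of_all _ fun x => mul_nonneg (inv_pos.2 hZ).le (Gd_nonneg α n 0 r x)),
      integral_const_mul, ← Z_eq, inv_mul_cancel₀ hZ.ne']
    simp
  exact Measure.isProbabilityMeasure_map (measurable_pi_apply 0).aemeasurable

lemma btM_supp (α : ℝ) (n : ℕ) (r : ℝ) : ∀ᵐ x ∂(btM α n r), 0 ≤ x := by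
  unfold btM
  rw [ae_map_iff (coord_meas n).aemeasurable measurableSet_Ici, ae_withDensity_iff (dens_meas α n r)]
  refine ae_of_all _ fun x hx => ?_
  by_contra hneg
  apply hx
  rw [Gd_eq_if, if_neg (fun h => hneg (h.1 0))]
  simp

lemma fullVec_one (n : ℕ) (x : ℝ) (y : Fin n → ℝ) :
    fullVec (n+1) 1 (fun _ => x) y = Fin.cons x y := by
  funext i
  refine Fin.cases ?_ (fun j => ?_) i
  · simp [fullVec, extFun]
  · simp [fullVec, extFun]

lemma R_eq (α : ℝ) (n : ℕ) (r : ℝ) (x : ℝ) (hx : 0 ≤ x) :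
    ((n + 1 : ℕ) : ℝ)⁻¹ * btlueR α (n+1) 1 r (fun _ => x) =
      (btlueZ α (n+1) r)⁻¹ * ∫ y : Fin n → ℝ, Gd α n 0 r (Fin.cons x y : Fin (n+1) → ℝ) := by
  unfold btlueR
  rw [if_pos (fun _ => hx)]
  have h1 : (((n+1).factorial : ℝ) / ((n + 1 - 1).factorial : ℝ)) = ((n + 1 : ℕ) : ℝ) := by
    rw [Nat.add_sub_cancel, Nat.factorial_succ]
    have : (n.factorial : ℝ) ≠ 0 := by positivity
    push_cast
    field_simp
  rw [h1]
  have h2 : (∫ y : Fin n → ℝ, (if (∀ k, 0 ≤ y k) ∧ (∑ i : Fin 1, x) + (∑ k, y k) ≤ r then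
          vdm2 (fullVec (n+1) 1 (fun _ => x) y) * lagWeight α (fullVec (n+1) 1 (fun _ => x) y) else 0))
      = ∫ y : Fin n → ℝ, Gd α n 0 r (Fin.cons x y : Fin (n+1) → ℝ) := by
    refine integral_congr_ae (ae_of_all _ fun y => ?_)
    simp only [Gd_eq_if, fullVec_one, Fin.sum_univ_succ, Fin.forall_fin_succ, Fin.cons_zero,
      Fin.cons_succ, hx, true_and]
    simp
  have h3 : ((n + 1 : ℕ) : ℝ) ≠ 0 := by positivity
  rw [← h2]
  change _ * (_ / _ * ∫ y : Fin n → ℝ, (if (∀ k, 0 ≤ y k) ∧ (∑ i : Fin 1, x) + (∑ k, y k) ≤ r then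
          vdm2 (fullVec (n+1) 1 (fun _ => x) y) * lagWeight α (fullVec (n+1) 1 (fun _ => x) y) else 0)) = _
  generalize (∫ y : Fin n → ℝ, (if (∀ k, 0 ≤ y k) ∧ (∑ i : Fin 1, x) + (∑ k, y k) ≤ r then
          vdm2 (fullVec (n+1) 1 (fun _ => x) y) * lagWeight α (fullVec (n+1) 1 (fun _ => x) y) else 0)) = I
  field_simp

lemma stmt_eq (α : ℝ) (hα : -1 < α) (n : ℕ) (r : ℝ) (hr : 0 < r) (f : ℝ → ℝ)
    (hf : Continuous f) (M : ℝ) (hM : ∀ x, |f x| ≤ M) :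
    ∫ x in Set.Ioi (0 : ℝ), f x * (((n + 1 : ℕ) : ℝ)⁻¹ * btlueR α (n+1) 1 r (fun _ => x)) =
      ∫ x, f x ∂(btM α n r) := by
  obtain ⟨hZ, h⟩ := bt_moment_all α hα n r hr
  rw [btM_integral α hα n r hr f hf]
  have hIntg : Integrable (fun x : Fin (n+1) → ℝ => f (x 0) * Gd α n 0 r x) :=
    (h 0).1.bdd_mul (c := M) (hf.comp (continuous_apply 0)).aestronglyMeasurable (ae_of_all _ fun x => hM _)
  have hmp := (volume_preserving_piFinSuccAbove (fun _ : Fin (n+1) => ℝ) 0).symm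
  have hIntg2 := (hmp.integrable_comp_emb (MeasurableEquiv.measurableEmbedding _)).2 hIntg
  rw [← hmp.integral_comp']
  rw [Measure.volume_eq_prod] at hIntg2
  have hip := integral_prod _ hIntg2
  simp only [Function.comp_def] at hip
  have hcons : ∀ z : ℝ × (Fin n → ℝ),
      (MeasurableEquiv.piFinSuccAbove (fun _ : Fin (n+1) => ℝ) 0).symm z = (Fin.cons z.1 z.2 : Fin (n+1) → ℝ) := by
    intro z
    simp [MeasurableEquiv.piFinSuccAbove, Fin.insertNthEquiv]
  rw [Measure.volume_eq_prod, hip]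
  simp only [hcons, Fin.cons_zero, integral_const_mul]
  have hcut : ∫ x, f x * ∫ y : Fin n → ℝ, Gd α n 0 r (Fin.cons x y : Fin (n+1) → ℝ) =
      ∫ x in Set.Ioi 0, f x * ∫ y : Fin n → ℝ, Gd α n 0 r (Fin.cons x y : Fin (n+1) → ℝ) := by
    rw [← integral_Ici_eq_integral_Ioi]
    refine (setIntegral_eq_integral_of_forall_compl_eq_zero fun x hx => ?_).symm
    have : ∀ y : Fin n → ℝ, Gd α n 0 r (Fin.cons x y : Fin (n+1) → ℝ) = 0 := by
      intro y
      rw [Gd_eq_if, if_neg (fun h => hx (by simpa using h.1 0))]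
    simp [this]
  rw [hcut, ← integral_const_mul]
  refine setIntegral_congr_fun measurableSet_Ioi fun x hx => ?_
  rw [R_eq α n r x (le_of_lt hx)]
  ring

/-- the limiting global eigenvalue density of the bounded trace LUE is the
Marchenko–Pastur law. -/
theorem btlue_global_density (α : ℝ) (hα : -1 < α) (f : ℝ → ℝ)
    (hbd : ∃ M : ℝ, ∀ x, |f x| ≤ M) (hlip : ∃ K : NNReal, LipschitzWith K f) :
    Tendsto (fun N : ℕ =>
        ∫ x in Set.Ioi (0 : ℝ),
          f x * ((N : ℝ)⁻¹ * btlueR α N 1 (((N : ℝ) + α) / 4) (fun _ => x)))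
      atTop (𝓝 (∫ x in Set.Ioc (0 : ℝ) 1, f x * psiMP x)) := by
  obtain ⟨M, hM⟩ := hbd
  obtain ⟨K, hK⟩ := hlip
  have hf := hK.continuous
  have hr : ∀ n : ℕ, 0 < (((n + 1 : ℕ) : ℝ) + α) / 4 := fun n => by
    push_cast; have : (0:ℝ) ≤ n := n.cast_nonneg; linarith
  rw [← tendsto_add_atTop_iff_nat 1, ← mp_integral]
  have e : (fun n : ℕ => ∫ x in Set.Ioi (0 : ℝ),
          f x * (((n + 1 : ℕ) : ℝ)⁻¹ * btlueR α (n+1) 1 ((((n + 1 : ℕ) : ℝ) + α) / 4) (fun _ => x))) =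
      fun n => ∫ x, f x ∂(btM α n ((((n + 1 : ℕ) : ℝ) + α) / 4)) :=
    funext fun n => stmt_eq α hα n _ (hr n) f hf M hM
  rw [e]
  have := mp_prob
  refine moment_method _ mpM (Eventually.of_forall fun n => btM_prob α hα n _ (hr n))
    (Eventually.of_forall fun n => btM_supp α n _)
    (Eventually.of_forall fun n p => btM_integrable α hα n _ (hr n) p) mp_supp (fun p => ?_) f hf M hM
  rw [mp_moment]
  refine ((tendsto_add_atTop_iff_nat 1).2 (bt_moment_tendsto α hα p)).congr fun n => ?_
  rw [btM_integral α hα n _ (hr n) _ (continuous_pow p)]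
  simp_rw [← Gd_pow]
  rw [((bt_moment_all α hα n _ (hr n)).2 p).2]

end RMT
end
end

section
/- Fix a real α > −1. For integers N large enough that N(N+α) > 1, the complex-valued function φ_N(y) = e^{iy(N+α)} · (1 + iy/N)^{−N(N+α)} (principal branch of the complex power) is absolutely integrable over ℝ, and lim_{N→∞} ∫_{−∞}^{∞} φ_N(y) dy = √(2π), the limit being taken in ℂ. -/
open MeasureTheory Filter Topology Finset
open scoped Real Classical

noncomputable section

namespace RMT

theorem norm_phiN (α : ℝ) (N : ℕ) (y : ℝ) :
    ‖phiN α N y‖ = (1 + (y / N) ^ 2) ^ (-((N : ℝ) * ((N : ℝ) + α)) / 2) := by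
  unfold phiN
  have h1 : ‖Complex.exp (Complex.I * (y : ℂ) * (((N : ℝ) + α : ℝ) : ℂ))‖ = 1 := by
    rw [show Complex.I * (y : ℂ) * (((N : ℝ) + α : ℝ) : ℂ)
      = ((y * ((N : ℝ) + α) : ℝ) : ℂ) * Complex.I by push_cast; ring]
    exact Complex.norm_exp_ofReal_mul_I _
  have h2 : ‖(1 + Complex.I * (y : ℂ) / (N : ℂ))‖ = (1 + (y / N) ^ 2) ^ ((1 : ℝ) / 2) := by
    rw [← Real.sqrt_eq_rpow, show (1 + Complex.I * (y : ℂ) / (N : ℂ))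
      = ((1 : ℝ) : ℂ) + ((y / N : ℝ) : ℂ) * Complex.I by push_cast; ring,
      Complex.norm_add_mul_I]
    norm_num
  rw [norm_mul, h1, one_mul, ← Complex.ofReal_neg, Complex.norm_cpow_real, h2,
    ← Real.rpow_mul (by positivity)]
  congr 1
  ring

theorem continuous_phiN (α : ℝ) (N : ℕ) : Continuous (phiN α N) := by
  unfold phiN
  refine Continuous.mul (by fun_prop) ?_
  refine Continuous.cpow (by fun_prop) continuous_const ?_
  intro y
  left
  rw [show (1 + Complex.I * (y : ℂ) / (N : ℂ))
      = ((1 : ℝ) : ℂ) + ((y / N : ℝ) : ℂ) * Complex.I by push_cast; ring]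
  simp only [Complex.add_re, Complex.ofReal_re, Complex.re_ofReal_mul, Complex.I_re]
  norm_num

theorem integrable_phiN (α : ℝ) (N : ℕ) (h : 1 < (N : ℝ) * ((N : ℝ) + α)) :
    Integrable (phiN α N) := by
  have hN : (N : ℝ) ≠ 0 := by
    intro h0
    rw [h0] at h
    norm_num at h
  have h1 : Integrable (fun x : ℝ => ((1 : ℝ) + ‖x‖ ^ 2) ^ (-((N : ℝ) * ((N : ℝ) + α)) / 2)) :=
    integrable_rpow_neg_one_add_norm_sq (by simpa using h)
  refine (h1.comp_div hN).mono' (continuous_phiN α N).aestronglyMeasurable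
    (Eventually.of_forall fun y => ?_)
  rw [norm_phiN, Real.norm_eq_abs, sq_abs]

theorem phiN_bound (α : ℝ) (hα : -1 < α) (N : ℕ) (hN : 3 ≤ N) (y : ℝ) :
    ‖phiN α N y‖ ≤ (1 + (y / 2) ^ 2)⁻¹ := by
  have hN' : (3 : ℝ) ≤ N := by exact_mod_cast hN
  rw [norm_phiN, neg_div, Real.rpow_neg (by positivity)]
  have hp : (N : ℝ) ^ 2 / 4 ≤ (N : ℝ) * ((N : ℝ) + α) / 2 := by nlinarith
  have hp1 : 1 ≤ (N : ℝ) * ((N : ℝ) + α) / 2 := by nlinarith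
  apply inv_anti₀ (by positivity)
  refine le_trans ?_ (one_add_mul_self_le_rpow_one_add
    (s := (y / N) ^ 2) (by linarith [sq_nonneg (y / N)]) hp1)
  have : (y / 2) ^ 2 = (N : ℝ) ^ 2 / 4 * (y / N) ^ 2 := by field_simp; norm_num
  rw [this]
  gcongr

theorem phiN_tendsto (α : ℝ) (y : ℝ) :
    Tendsto (fun N : ℕ => phiN α N y) atTop (𝓝 ((Real.exp (-(1 / 2) * y ^ 2) : ℝ) : ℂ)) := by
  have hinv : Tendsto (fun N : ℕ => α / (N : ℝ)) atTop (𝓝 0) :=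
    tendsto_const_div_atTop_nhds_zero_nat α
  have hy : Tendsto (fun N : ℕ => |y| / (N : ℝ)) atTop (𝓝 0) :=
    tendsto_const_div_atTop_nhds_zero_nat _
  -- the remainder
  set R : ℕ → ℂ := fun N => (((N : ℝ) * ((N : ℝ) + α) : ℝ) : ℂ) *
    (Complex.log (1 + Complex.I * (y : ℂ) / (N : ℂ))
      - Complex.logTaylor 3 (Complex.I * (y : ℂ) / (N : ℂ))) with hR
  have hR0 : Tendsto R atTop (𝓝 0) := by
    have hb : Tendsto (fun N : ℕ => |1 + α / (N : ℝ)| * (|y| ^ 2 * (|y| / N)) *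
        (1 - |y| / N)⁻¹ / 3) atTop (𝓝 (|1 + 0| * (|y| ^ 2 * 0) * (1 - 0)⁻¹ / 3)) :=
      ((((hinv.const_add 1).abs).mul (hy.const_mul _)).mul
        ((hy.const_sub 1).inv₀ (by norm_num))).div_const 3
    rw [show |1 + 0| * (|y| ^ 2 * 0) * ((1 : ℝ) - 0)⁻¹ / 3 = 0 by simp] at hb
    refine squeeze_zero_norm' ?_ hb
    filter_upwards [hy.eventually (gt_mem_nhds (zero_lt_one)), eventually_gt_atTop 0]
      with N h1 h0
    have h0' : (0 : ℝ) < N := by exact_mod_cast h0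
    have hz : ‖Complex.I * (y : ℂ) / (N : ℂ)‖ = |y| / N := by simp
    have := Complex.norm_log_sub_logTaylor_le 2 (z := Complex.I * (y : ℂ) / (N : ℂ))
      (by rw [hz]; exact h1)
    rw [hz] at this
    rw [hR]
    simp only [norm_mul, Complex.norm_real, Real.norm_eq_abs]
    refine (mul_le_mul_of_nonneg_left this (by positivity)).trans (le_of_eq ?_)
    have : (N : ℝ) * ((N : ℝ) + α) = N ^ 2 * (1 + α / N) := by field_simp
    rw [← abs_mul, this, abs_mul, abs_of_pos (by positivity : (0 : ℝ) < N ^ 2)]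
    generalize (1 - |y| / (N : ℝ))⁻¹ = w
    generalize |1 + α / (N : ℝ)| = v
    push_cast
    field_simp
    norm_num
  have hmain : Tendsto (fun N : ℕ => Complex.exp
      (((-(1 / 2) * y ^ 2 * (1 + α / N) : ℝ) : ℂ) - R N)) atTop
      (𝓝 (Complex.exp (((-(1 / 2) * y ^ 2 * (1 + 0) : ℝ) : ℂ) - 0))) := by
    refine (Complex.continuous_exp.tendsto _).comp (Tendsto.sub ?_ hR0)
    exact (Complex.continuous_ofReal.tendsto _).comp ((hinv.const_add 1).const_mul _)
  rw [sub_zero, add_zero, mul_one, ← Complex.ofReal_exp] at hmain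
  refine hmain.congr' ?_
  filter_upwards [eventually_gt_atTop 0] with N h0
  have h0' : (N : ℂ) ≠ 0 := by exact_mod_cast h0.ne'
  have hne : (1 + Complex.I * (y : ℂ) / (N : ℂ)) ≠ 0 := by
    intro h
    have := congrArg Complex.re h
    rw [show (1 + Complex.I * (y : ℂ) / (N : ℂ))
      = ((1 : ℝ) : ℂ) + ((y / N : ℝ) : ℂ) * Complex.I by push_cast; ring] at this
    simp only [Complex.add_re, Complex.ofReal_re, Complex.re_ofReal_mul, Complex.I_re] at this
    norm_num at this
  unfold phiN
  rw [Complex.cpow_def_of_ne_zero hne, ← Complex.exp_add]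
  congr 1
  simp only [hR, Complex.logTaylor_succ, Complex.logTaylor_zero, Pi.add_apply]
  generalize Complex.log (1 + Complex.I * (y : ℂ) / (N : ℂ)) = L
  push_cast
  field_simp
  ring_nf
  simp only [Complex.I_sq]
  ring

/-- `φ_N` is absolutely integrable over ℝ (for `N(N+α) > 1`) and
`∫ φ_N → √(2π)` as `N → ∞`. -/
theorem phiN_integrable_and_integral_limit (α : ℝ) (hα : -1 < α) :
    (∀ N : ℕ, 1 < (N : ℝ) * ((N : ℝ) + α) → Integrable (phiN α N)) ∧
      Tendsto (fun N : ℕ => ∫ y : ℝ, phiN α N y) atTop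
        (𝓝 ((Real.sqrt (2 * π) : ℝ) : ℂ)) := by
  refine ⟨fun N h => integrable_phiN α N h, ?_⟩
  have hg : ∫ y : ℝ, ((Real.exp (-(1 / 2) * y ^ 2) : ℝ) : ℂ)
      = ((Real.sqrt (2 * π) : ℝ) : ℂ) := by
    rw [integral_complex_ofReal, integral_gaussian]
    congr 2
    ring
  rw [← hg]
  refine tendsto_integral_filter_of_dominated_convergence
    (fun y : ℝ => (1 + (y / 2) ^ 2)⁻¹) ?_ ?_ ?_ ?_
  · exact Eventually.of_forall fun N => (continuous_phiN α N).aestronglyMeasurable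
  · filter_upwards [eventually_ge_atTop 3] with N hN
    exact Eventually.of_forall fun y => phiN_bound α hα N hN y
  · exact integrable_inv_one_add_sq.comp_div (by norm_num)
  · exact Eventually.of_forall fun y => phiN_tendsto α y

end RMT
end
end
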